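/- arXiv:0801.0586 — 2 statements merged into one kernel-verified Lean document; each statement's English description precedes it below -/
import Mathlib

section
/- Let K be a subfield of ℝ, n ≥ 3, 2 ≤ s ≤ n−1, r = s+n−1, and d_1,…,d_r positive integers. Let h_1,…,h_s ∈ K[x_1,…,x_n] with deg h_i ≤ d_i, and let h_{s+1},…,h_r ∈ K[x_1,…,x_n,μ_1,…,μ_s] with deg_x h_i ≤ d_i and h_i homogeneous of degree 1 in μ_1,…,μ_s. Let g_1,…,g_s ∈ K[x] with deg g_i = d_i, and g_{s+1},…,g_r ∈ K[x,μ] with deg_x g_i = d_i and homogeneous of degree 1 in μ, and set D = (∏_{i=1}^{s} d_i) · (∑_{E ⊆ {s+1,…,r}, #E = n−s} ∏_{j∈E} d_j). Assume that the system g_1(x) = … = g_s(x) = 0, g_{s+1}(x,μ_1,…,μ_{s−1},1) = … = g_r(x,μ_1,…,μ_{s−1},1) = 0 has exactly D solutions in L^n × L^{s−1}, where L is an algebraic closure of K, that distinct solutions have distinct x-components, and that the Jacobian determinant of these r polynomials with respect to (x_1,…,x_n,μ_1,…,μ_{s−1}) is nonzero at every solution. Let t be a new variable and set F_i = (1−t)h_i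 + t g_i for 1 ≤ i ≤ r. Then the system F_1 = … = F_s = 0, F_{s+1}(t,x,μ_1,…,μ_{s−1},1) = … = F_r(t,x,μ_1,…,μ_{s−1},1) = 0, regarded over an algebraic closure M of the rational function field K(t), has exactly D solutions in M^n × M^{s−1}, and distinct solutions have distinct x-components. -/
set_option synthInstance.maxHeartbeats 1000000
set_option maxHeartbeats 1000000

open MvPolynomial

/-- Extend a point `(x, μ₁, …, μ_{s-1})` to the full set of variables
`(x, μ₁, …, μ_s)` by substituting `μ_s = 1`. -/
def ptExt {n s : ℕ} {R : Type*} (x : Fin n → R) (μ : Fin (s - 1) → R) [One R] :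
    Fin n ⊕ Fin s → R :=
  Sum.elim x fun k : Fin s => if h : (k : ℕ) < s - 1 then μ ⟨(k : ℕ), h⟩ else 1

/-- Solutions in `Rⁿ × R^{s-1}` of the system
`g₁(x) = ⋯ = g_s(x) = 0, g_{s+1}(x,μ,1) = ⋯ = g_r(x,μ,1) = 0`. -/
def Sols0 {K : Type*} [Field K] {n s : ℕ} (R : Type*) [CommRing R] [Algebra K R]
    (g : Fin s → MvPolynomial (Fin n) K)
    (g' : Fin (n - 1) → MvPolynomial (Fin n ⊕ Fin s) K) :
    Set ((Fin n → R) × (Fin (s - 1) → R)) :=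
  {p | (∀ i, aeval p.1 (g i) = 0) ∧ ∀ i, aeval (ptExt p.1 p.2) (g' i) = 0}

/-- Solutions in `Rⁿ × R^{s-1}` of the deformed system `F_i = (1-c)h_i + c g_i`
(with `μ_s = 1`), for a parameter value `c`. -/
def SolsF {K : Type*} [Field K] {n s : ℕ} (R : Type*) [CommRing R] [Algebra K R] (c : R)
    (h g : Fin s → MvPolynomial (Fin n) K)
    (h' g' : Fin (n - 1) → MvPolynomial (Fin n ⊕ Fin s) K) :
    Set ((Fin n → R) × (Fin (s - 1) → R)) :=
  {p | (∀ i, (1 - c) * aeval p.1 (h i) + c * aeval p.1 (g i) = 0) ∧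
       ∀ i, (1 - c) * aeval (ptExt p.1 p.2) (h' i) + c * aeval (ptExt p.1 p.2) (g' i) = 0}

/-- The Jacobian matrix of the system `g₁,…,g_s, g_{s+1}(·,·,1),…,g_r(·,·,1)` with
respect to the variables `(x₁,…,x_n,μ₁,…,μ_{s-1})`, evaluated at a point; the columns
are indexed through an identification `e` of the two index sets. -/
noncomputable def jacMat {K : Type*} [Field K] {n s : ℕ} (R : Type*) [CommRing R]
    [Algebra K R]
    (g : Fin s → MvPolynomial (Fin n) K)
    (g' : Fin (n - 1) → MvPolynomial (Fin n ⊕ Fin s) K)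
    (e : (Fin s ⊕ Fin (n - 1)) ≃ (Fin n ⊕ Fin (s - 1)))
    (x : Fin n → R) (μ : Fin (s - 1) → R) :
    Matrix (Fin s ⊕ Fin (n - 1)) (Fin s ⊕ Fin (n - 1)) R :=
  Matrix.of fun i i' =>
    Sum.elim
      (fun i1 : Fin s =>
        Sum.elim (fun j : Fin n => aeval x (pderiv j (g i1))) (fun _ => (0 : R)) (e i'))
      (fun i2 : Fin (n - 1) =>
        Sum.elim
          (fun j : Fin n => aeval (ptExt x μ) (pderiv (Sum.inl j) (g' i2)))
          (fun k : Fin (s - 1) =>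
            aeval (ptExt x μ) (pderiv (Sum.inr (Fin.castLE (Nat.sub_le s 1) k)) (g' i2)))
          (e i'))
      i

open scoped Matrix

section GradedPieces
variable {k S : Type*} [Field k] [CommRing S] [Algebra k S]

/-- The span of products of `a.1` elements of `A` and `a.2` elements of `B`. -/
def gradedPiece (A B : Submodule k S) (a : ℕ × ℕ) : Submodule k S := A ^ a.1 * B ^ a.2

/-- The part in bidegree `≤ a` of the ideal generated by the elements `g.1`, `g ∈ G`, placed in
bidegree `g.2`. -/
def relPiece (A B : Submodule k S) (G : Set (S × ℕ × ℕ)) (a : ℕ × ℕ) : Submodule k S :=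
  Submodule.span k {x | ∃ g ∈ G, ∃ c, ∃ w ∈ gradedPiece A B c, g.2 + c ≤ a ∧ g.1 * w = x}

/-- In large bidegrees, the quotient by the relations `G` is spanned by `N` elements. -/
def Covers (A B : Submodule k S) (G : Set (S × ℕ × ℕ)) (N : ℕ) : Prop :=
  ∃ a₀, ∀ a ≥ a₀, ∃ Q : Finset S, Q.card ≤ N ∧
    gradedPiece A B a ≤ Submodule.span k Q ⊔ relPiece A B G a

variable {A B : Submodule k S}

lemma Submodule.pow_mono_of_one_le (hA : 1 ≤ A) {i j : ℕ} (h : i ≤ j) : A ^ i ≤ A ^ j :=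
  pow_le_pow_right₀ hA h

lemma gradedPiece_mono (hA : 1 ≤ A) (hB : 1 ≤ B) {a b : ℕ × ℕ} (h : a ≤ b) :
    gradedPiece A B a ≤ gradedPiece A B b :=
  mul_le_mul' (Submodule.pow_mono_of_one_le hA h.1) (Submodule.pow_mono_of_one_le hB h.2)

lemma gradedPiece_mul (a b : ℕ × ℕ) :
    gradedPiece A B a * gradedPiece A B b = gradedPiece A B (a + b) := by
  simp only [gradedPiece, Prod.fst_add, Prod.snd_add, pow_add]
  ac_rfl

lemma mul_mem_gradedPiece {a b : ℕ × ℕ} {x y : S} (hx : x ∈ gradedPiece A B a)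
    (hy : y ∈ gradedPiece A B b) : x * y ∈ gradedPiece A B (a + b) :=
  gradedPiece_mul (A := A) (B := B) a b ▸ Submodule.mul_mem_mul hx hy

lemma one_mem_gradedPiece_zero : (1 : S) ∈ gradedPiece A B 0 := by
  simpa [gradedPiece] using ⟨1, map_one _⟩

lemma prod_mem_gradedPiece {ι : Type*} (T : Finset ι) (x : ι → S) (δ : ι → ℕ × ℕ)
    (h : ∀ i ∈ T, x i ∈ gradedPiece A B (δ i)) :
    ∏ i ∈ T, x i ∈ gradedPiece A B (∑ i ∈ T, δ i) := by
  classical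
  induction T using Finset.induction_on with
  | empty => simpa using one_mem_gradedPiece_zero
  | insert i T hi ih =>
    rw [Finset.prod_insert hi, Finset.sum_insert hi]
    exact mul_mem_gradedPiece (h i (by simp)) (ih fun j hj => h j (by simp [hj]))

lemma mul_mem_relPiece_of_mem {G : Set (S × ℕ × ℕ)} {g : S × ℕ × ℕ} (hg : g ∈ G)
    {c a : ℕ × ℕ} {w : S} (hw : w ∈ gradedPiece A B c) (h : g.2 + c ≤ a) :
    g.1 * w ∈ relPiece A B G a :=
  Submodule.subset_span ⟨g, hg, c, w, hw, h, rfl⟩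

lemma relPiece_mono {G G' : Set (S × ℕ × ℕ)} (h : G ⊆ G') {a b : ℕ × ℕ} (hab : a ≤ b) :
    relPiece A B G a ≤ relPiece A B G' b :=
  Submodule.span_mono fun _ ⟨g, hg, c, w, hw, hc, hx⟩ => ⟨g, h hg, c, w, hw, hc.trans hab, hx⟩

lemma mul_mem_relPiece {G : Set (S × ℕ × ℕ)} {a b : ℕ × ℕ} {x y : S}
    (hx : x ∈ gradedPiece A B a) (hy : y ∈ relPiece A B G b) :
    x * y ∈ relPiece A B G (a + b) := by
  induction hy using Submodule.span_induction with
  | mem y hy =>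
    obtain ⟨g, hg, c, w, hw, hc, rfl⟩ := hy
    rw [mul_left_comm]
    refine mul_mem_relPiece_of_mem hg (mul_mem_gradedPiece hx hw) ?_
    rw [add_left_comm]
    exact add_le_add_right hc a
  | zero => simp
  | add y z _ _ hy hz => rw [mul_add]; exact add_mem hy hz
  | smul t y _ hy => rw [mul_smul_comm]; exact Submodule.smul_mem _ _ hy

lemma mem_relPiece_insert (hA : 1 ≤ A) (hB : 1 ≤ B) {G : Set (S × ℕ × ℕ)} {g : S × ℕ × ℕ}
    {a : ℕ × ℕ} (ha : g.2 ≤ a) {x : S} (hx : x ∈ relPiece A B (insert g G) a) :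
    ∃ w ∈ gradedPiece A B (a - g.2), x - g.1 * w ∈ relPiece A B G a := by
  induction hx using Submodule.span_induction with
  | mem y hy =>
    obtain ⟨g', rfl | hg, c, w, hw, hc, rfl⟩ := hy
    · refine ⟨w, gradedPiece_mono hA hB ?_ hw, by simp⟩
      exact le_tsub_of_add_le_left hc
    · exact ⟨0, zero_mem _, by simpa using mul_mem_relPiece_of_mem hg hw hc⟩
  | zero => exact ⟨0, zero_mem _, by simp⟩
  | add y z _ _ hy hz =>
    obtain ⟨v, hv, hv'⟩ := hy
    obtain ⟨w, hw, hw'⟩ := hz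
    refine ⟨v + w, add_mem hv hw, ?_⟩
    convert add_mem hv' hw' using 1
    ring
  | smul t y _ hy =>
    obtain ⟨v, hv, hv'⟩ := hy
    refine ⟨t • v, Submodule.smul_mem _ _ hv, ?_⟩
    convert Submodule.smul_mem _ t hv' using 1
    rw [mul_smul_comm, smul_sub]

lemma Covers.mono {G G' : Set (S × ℕ × ℕ)} {N N' : ℕ} (h : Covers A B G N) (hG : G ⊆ G')
    (hN : N ≤ N') : Covers A B G' N' := by
  obtain ⟨a₀, h⟩ := h
  refine ⟨a₀, fun a ha => ?_⟩
  obtain ⟨Q, hQ, hle⟩ := h a ha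
  exact ⟨Q, hQ.trans hN, hle.trans (sup_le_sup_left (relPiece_mono hG le_rfl) _)⟩

lemma Covers.insert_one {G : Set (S × ℕ × ℕ)} : Covers A B (insert (1, 0) G) 0 := by
  refine ⟨0, fun a _ => ⟨∅, by simp, fun x hx => ?_⟩⟩
  refine Submodule.mem_sup_right ?_
  simpa using mul_mem_relPiece_of_mem (Set.mem_insert (1, 0) G) hx (by simp)

lemma Covers.insert_mul (hA : 1 ≤ A) (hB : 1 ≤ B) {G : Set (S × ℕ × ℕ)} {p q : S}
    {δ ε : ℕ × ℕ} {N N' : ℕ} (hp : p ∈ gradedPiece A B δ)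
    (h : Covers A B (insert (p, δ) G) N) (h' : Covers A B (insert (q, ε) G) N') :
    Covers A B (insert (p * q, δ + ε) G) (N + N') := by
  classical
  obtain ⟨a₀, h⟩ := h
  obtain ⟨b₀, h'⟩ := h'
  refine ⟨a₀ + (δ + (ε + b₀)), fun a ha => ?_⟩
  have ha₀ : a₀ ≤ a := le_self_add.trans ha
  have hδ' : δ + (ε + b₀) ≤ a := le_add_self.trans ha
  have hδ : δ ≤ a := le_self_add.trans hδ'
  have hb : ε + b₀ ≤ a - δ := le_tsub_of_add_le_left hδ'
  obtain ⟨Q, hQ, hle⟩ := h a ha₀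
  obtain ⟨Q', hQ', hle'⟩ := h' (a - δ) (le_add_self.trans hb)
  refine ⟨Q ∪ Q'.image (p * ·), ?_, fun x hx => ?_⟩
  · exact (Finset.card_union_le _ _).trans (add_le_add hQ (Finset.card_image_le.trans hQ'))
  obtain ⟨y, hy, z, hz, rfl⟩ := Submodule.mem_sup.1 (hle hx)
  obtain ⟨w, hw, hzw⟩ := mem_relPiece_insert (g := (p, δ)) hA hB hδ hz
  obtain ⟨y', hy', z', hz', rfl⟩ := Submodule.mem_sup.1 (hle' hw)
  have hε : ε ≤ a - δ := le_self_add.trans hb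
  obtain ⟨w', hw', hzw'⟩ := mem_relPiece_insert (g := (q, ε)) hA hB hε hz'
  have hsub : G ⊆ insert (p * q, δ + ε) G := Set.subset_insert _ _
  have e1 : p * y' ∈ Submodule.span k ((Q ∪ Q'.image (p * ·) : Finset S) : Set S) := by
    have : p * y' ∈ (Submodule.span k (Q' : Set S)).map (LinearMap.mulLeft k p) :=
      ⟨y', hy', rfl⟩
    rw [Submodule.map_span] at this
    refine Submodule.span_mono ?_ this
    rintro _ ⟨q', hq', rfl⟩
    simp only [Finset.coe_union, Finset.coe_image]
    exact Or.inr ⟨q', hq', rfl⟩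
  have e2 : p * (z' - q * w') ∈ relPiece A B G a := by
    have := mul_mem_relPiece hp hzw'
    rwa [add_tsub_cancel_of_le hδ] at this
  have e3 : p * q * w' ∈ relPiece A B (insert (p * q, δ + ε) G) a := by
    refine mul_mem_relPiece_of_mem (Set.mem_insert (p * q, δ + ε) G) hw' ?_
    change δ + ε + (a - δ - ε) ≤ a
    rw [add_assoc, add_tsub_cancel_of_le hε, add_tsub_cancel_of_le hδ]
  have : y + z = (y + p * y') +
      ((z - p * (y' + z')) + p * (z' - q * w') + p * q * w') := by ring
  rw [this]
  refine Submodule.add_mem_sup (add_mem ?_ e1)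
    (add_mem (relPiece_mono hsub le_rfl (add_mem hzw e2)) e3)
  exact Submodule.span_mono (by simp) hy

lemma Covers.insert_prod (hA : 1 ≤ A) (hB : 1 ≤ B) {G : Set (S × ℕ × ℕ)} {ι : Type*}
    (T : Finset ι) (p : ι → S) (δ : ι → ℕ × ℕ) (N : ι → ℕ)
    (hp : ∀ i ∈ T, p i ∈ gradedPiece A B (δ i))
    (h : ∀ i ∈ T, Covers A B (insert (p i, δ i) G) (N i)) :
    Covers A B (insert (∏ i ∈ T, p i, ∑ i ∈ T, δ i) G) (∑ i ∈ T, N i) := by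
  classical
  induction T using Finset.induction_on with
  | empty => simpa using Covers.insert_one
  | insert i T hi ih =>
    rw [Finset.prod_insert hi, Finset.sum_insert hi, Finset.sum_insert hi]
    exact Covers.insert_mul hA hB (hp i (by simp)) (h i (by simp))
      (ih (fun j hj => hp j (by simp [hj])) fun j hj => h j (by simp [hj]))

lemma Covers.expand_linear (hA : 1 ≤ A) (hB : 1 ≤ B) {I : Type*} (x : I → ℕ → S) (d : I → ℕ)
    (N : ℕ) (hx : ∀ i k, x i k ∈ gradedPiece A B (1, 0)) (T : Finset I) (G : Set (S × ℕ × ℕ))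
    (h : ∀ φ : I → ℕ,
      Covers A B (G ∪ (fun i => (x i (φ i), (1, 0))) '' (T : Set I)) N) :
    Covers A B (G ∪ (fun i => (∏ k ∈ Finset.range (d i), x i k, (d i, 0))) '' (T : Set I))
      ((∏ i ∈ T, d i) * N) := by
  classical
  induction T using Finset.induction_on generalizing G with
  | empty => simpa using h 0
  | insert i T hi ih =>
    rw [Finset.coe_insert, Set.image_insert_eq, Set.union_insert, Finset.prod_insert hi,
      mul_assoc]
    have := Covers.insert_prod hA hB
      (G := G ∪ (fun i => (∏ k ∈ Finset.range (d i), x i k, (d i, 0))) '' (T : Set I))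
      (Finset.range (d i)) (x i) (fun _ => (1, 0))
      (fun _ => (∏ i ∈ T, d i) * N) (fun k _ => hx i k) (fun k _ => ?_)
    · simpa using this
    · rw [← Set.insert_union]
      refine ih _ fun φ => (h (Function.update φ i k)).mono ?_ le_rfl
      rintro g (hg | ⟨j, hj, rfl⟩)
      · exact Or.inl (Or.inr hg)
      · rcases Finset.mem_insert.1 hj with rfl | hj
        · exact Or.inl (Or.inl (by simp))
        · refine Or.inr ⟨j, hj, ?_⟩
          have : j ≠ i := fun h => hi (h ▸ hj)
          simp [Function.update_of_ne this]

lemma Covers.expand_bilinear (hA : 1 ≤ A) (hB : 1 ≤ B) {J : Type*} [DecidableEq J]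
    (x : J → ℕ → S) (y : J → S) (d : J → ℕ) (hx : ∀ i k, x i k ∈ gradedPiece A B (1, 0))
    (T : Finset J) (N : Finset J → ℕ) (G : Set (S × ℕ × ℕ))
    (h : ∀ φ : J → ℕ, ∀ E ⊆ T, Covers A B (G ∪
      ((fun i => (x i (φ i), (1, 0))) '' (E : Set J) ∪
        (fun i => (y i, (0, 1))) '' ((T \ E : Finset J) : Set J))) (N E)) :
    Covers A B
      (G ∪ (fun i => ((∏ k ∈ Finset.range (d i), x i k) * y i, (d i, 1))) '' (T : Set J))
      (∑ E ∈ T.powerset, (∏ i ∈ E, d i) * N E) := by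
  induction T using Finset.induction_on generalizing G N with
  | empty => simpa using h 0 ∅
  | insert j T hj ih =>
    rw [Finset.coe_insert, Set.image_insert_eq, Set.union_insert,
      Finset.sum_powerset_insert hj, add_comm]
    set G' := G ∪ (fun i => ((∏ k ∈ Finset.range (d i), x i k) * y i, (d i, 1))) '' (T : Set J)
      with hG'
    have key : ∀ k, Covers A B (insert (x j k, (1, 0)) G')
        (∑ E ∈ T.powerset, (∏ i ∈ E, d i) * N (insert j E)) := by
      intro k
      rw [hG', ← Set.insert_union]
      refine ih (fun E => N (insert j E)) _ fun φ E hE =>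
        (h (Function.update φ j k) (insert j E) (Finset.insert_subset_insert j hE)).mono ?_ le_rfl
      rintro g (hg | ⟨i, hi, rfl⟩ | ⟨i, hi, rfl⟩)
      · exact Or.inl (Or.inr hg)
      · rcases Finset.mem_insert.1 hi with rfl | hi
        · exact Or.inl (Or.inl (by simp))
        · refine Or.inr (Or.inl ⟨i, hi, ?_⟩)
          have : i ≠ j := fun h => hj (h ▸ hE hi)
          simp [Function.update_of_ne this]
      · refine Or.inr (Or.inr ⟨i, ?_, rfl⟩)
        simp only [Finset.coe_sdiff, Finset.coe_insert, Set.mem_sdiff, Set.mem_insert_iff,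
          Finset.mem_coe] at hi ⊢
        tauto
    have key' : Covers A B (insert (y j, (0, 1)) G')
        (∑ E ∈ T.powerset, (∏ i ∈ E, d i) * N E) := by
      rw [hG', ← Set.insert_union]
      refine ih N _ fun φ E hE => (h φ E (hE.trans (Finset.subset_insert j T))).mono ?_ le_rfl
      rintro g (hg | hg | ⟨i, hi, rfl⟩)
      · exact Or.inl (Or.inr hg)
      · exact Or.inr (Or.inl hg)
      · simp only [Finset.coe_sdiff, Finset.coe_insert, Set.mem_sdiff, Set.mem_insert_iff,
          Finset.mem_coe] at hi
        rcases hi with ⟨rfl | hi, hi'⟩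
        · exact Or.inl (Or.inl rfl)
        · exact Or.inr (Or.inr ⟨i, by simp [hi, hi'], rfl⟩)
    have hprod := Covers.insert_prod hA hB (Finset.range (d j)) (x j) (fun _ => (1, 0)) _
      (fun k _ => hx j k) (fun k _ => key k)
    have hmem := prod_mem_gradedPiece (A := A) (B := B) (Finset.range (d j)) (x j)
      (fun _ => (1, 0)) (fun k _ => hx j k)
    have := Covers.insert_mul hA hB hmem hprod key'
    refine this.mono ?_ (le_of_eq ?_)
    · simp
    · congr 1
      simp only [Finset.sum_const, Finset.card_range, smul_eq_mul, Finset.mul_sum]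
      refine Finset.sum_congr rfl fun E hE => ?_
      rw [Finset.prod_insert (fun h => hj (Finset.mem_powerset.1 hE h)), mul_assoc]

lemma gradedPiece_succ_fst_le {G : Set (S × ℕ × ℕ)} {U : Set S} {Z : Submodule k S}
    (hU : ∀ u ∈ U, (u, (1, 0)) ∈ G) (h : A ≤ Z ⊔ Submodule.span k U) (a b : ℕ) :
    gradedPiece A B (a + 1, b) ≤ Z * gradedPiece A B (a, b) ⊔ relPiece A B G (a + 1, b) := by
  have : gradedPiece A B (a + 1, b) = A * gradedPiece A B (a, b) := by
    simp only [gradedPiece, pow_succ]; ac_rfl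
  rw [this]
  refine (mul_le_mul' h le_rfl).trans ?_
  rw [Submodule.sup_mul]
  refine sup_le_sup_left ?_ _
  rw [Submodule.mul_le]
  intro u hu w hw
  induction hu using Submodule.span_induction with
  | mem u hu =>
    exact mul_mem_relPiece_of_mem (hU u hu) hw (by simp [add_comm])
  | zero => simp
  | add y z _ _ hy hz => rw [add_mul]; exact add_mem hy hz
  | smul t y _ hy => rw [smul_mul_assoc]; exact Submodule.smul_mem _ _ hy

lemma gradedPiece_succ_snd_le {G : Set (S × ℕ × ℕ)} {U : Set S} {Z : Submodule k S}
    (hU : ∀ u ∈ U, (u, (0, 1)) ∈ G) (h : B ≤ Z ⊔ Submodule.span k U) (a b : ℕ) :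
    gradedPiece A B (a, b + 1) ≤ Z * gradedPiece A B (a, b) ⊔ relPiece A B G (a, b + 1) := by
  have : gradedPiece A B (a, b + 1) = B * gradedPiece A B (a, b) := by
    simp only [gradedPiece, pow_succ']; exact mul_left_comm _ _ _
  rw [this]
  refine (mul_le_mul' h le_rfl).trans ?_
  rw [Submodule.sup_mul]
  refine sup_le_sup_left ?_ _
  rw [Submodule.mul_le]
  intro u hu w hw
  induction hu using Submodule.span_induction with
  | mem u hu =>
    exact mul_mem_relPiece_of_mem (hU u hu) hw (by simp [add_comm])
  | zero => simp
  | add y z _ _ hy hz => rw [add_mul]; exact add_mem hy hz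
  | smul t y _ hy => rw [smul_mul_assoc]; exact Submodule.smul_mem _ _ hy

lemma Covers.zero_of_fst_le {G : Set (S × ℕ × ℕ)} {U : Set S}
    (hU : ∀ u ∈ U, (u, (1, 0)) ∈ G) (h : A ≤ Submodule.span k U) : Covers A B G 0 := by
  refine ⟨(1, 0), fun ⟨a, b⟩ ha => ⟨∅, by simp, ?_⟩⟩
  obtain ⟨a, rfl⟩ := Nat.exists_eq_add_of_le' ha.1
  have := gradedPiece_succ_fst_le (B := B) (Z := ⊥) hU (by simpa using h) a b
  simpa using this

lemma Covers.zero_of_snd_le {G : Set (S × ℕ × ℕ)} {U : Set S}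
    (hU : ∀ u ∈ U, (u, (0, 1)) ∈ G) (h : B ≤ Submodule.span k U) : Covers A B G 0 := by
  refine ⟨(0, 1), fun ⟨a, b⟩ ha => ⟨∅, by simp, ?_⟩⟩
  obtain ⟨b, rfl⟩ := Nat.exists_eq_add_of_le' ha.2
  have := gradedPiece_succ_snd_le (A := A) (Z := ⊥) hU (by simpa using h) a b
  simpa using this

lemma span_singleton_mul_le {G : Set (S × ℕ × ℕ)} {a b : ℕ × ℕ} {y z : S}
    (hy : y ∈ gradedPiece A B b)
    (h : gradedPiece A B a ≤ Submodule.span k {z} ⊔ relPiece A B G a) :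
    Submodule.span k {y} * gradedPiece A B a ≤
      Submodule.span k {y * z} ⊔ relPiece A B G (b + a) := by
  refine (mul_le_mul' le_rfl h).trans ?_
  rw [Submodule.mul_sup, Submodule.span_mul_span, Set.singleton_mul_singleton]
  refine sup_le_sup_left ?_ _
  rw [Submodule.mul_le]
  intro u hu w hw
  obtain ⟨t, rfl⟩ := Submodule.mem_span_singleton.1 hu
  rw [smul_mul_assoc]
  exact Submodule.smul_mem _ _ (mul_mem_relPiece hy hw)

lemma Covers.one_of_le {G : Set (S × ℕ × ℕ)} {U V : Set S} {y z : S}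
    (hy : y ∈ A) (hz : z ∈ B)
    (hU : ∀ u ∈ U, (u, (1, 0)) ∈ G) (hA : A ≤ Submodule.span k {y} ⊔ Submodule.span k U)
    (hV : ∀ u ∈ V, (u, (0, 1)) ∈ G) (hB : B ≤ Submodule.span k {z} ⊔ Submodule.span k V) :
    Covers A B G 1 := by
  have hy' : y ∈ gradedPiece A B (1, 0) := by simpa [gradedPiece] using hy
  have hz' : z ∈ gradedPiece A B (0, 1) := by simpa [gradedPiece] using hz
  have key : ∀ a b : ℕ, gradedPiece A B (a, b) ≤
      Submodule.span k {y ^ a * z ^ b} ⊔ relPiece A B G (a, b) := by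
    intro a b
    induction a with
    | zero =>
      induction b with
      | zero => simp [gradedPiece, ← Submodule.one_eq_span]
      | succ b ih =>
        refine (gradedPiece_succ_snd_le hV hB 0 b).trans (sup_le ?_ le_sup_right)
        refine (span_singleton_mul_le hz' ih).trans (le_of_eq ?_)
        congr 3
        · ring
        · simp [add_comm]
    | succ a ih =>
      refine (gradedPiece_succ_fst_le hU hA a b).trans (sup_le ?_ le_sup_right)
      refine (span_singleton_mul_le hy' ih).trans (le_of_eq ?_)
      congr 3
      · ring
      · simp [add_comm]
  exact ⟨0, fun ⟨a, b⟩ _ => ⟨{y ^ a * z ^ b}, by simp, by simpa using key a b⟩⟩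

lemma Covers.of_generalPosition {n m : ℕ} {x y : ℕ → S}
    (hxA : ∀ c, x c ∈ A) (hyB : ∀ c, y c ∈ B)
    (hx : ∀ C : Finset ℕ, n + 1 ≤ C.card → A ≤ Submodule.span k (x '' C))
    (hy : ∀ C : Finset ℕ, m + 1 ≤ C.card → B ≤ Submodule.span k (y '' C))
    {G : Set (S × ℕ × ℕ)} (C C' : Finset ℕ) (hC : ∀ c ∈ C, (x c, (1, 0)) ∈ G)
    (hC' : ∀ c ∈ C', (y c, (0, 1)) ∈ G) (hcard : C.card + C'.card = n + m) :
    Covers A B G (if C.card = n then 1 else 0) := by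
  have hU : ∀ u ∈ x '' C, (u, (1, 0)) ∈ G := by rintro _ ⟨c, hc, rfl⟩; exact hC c hc
  have hV : ∀ u ∈ y '' C', (u, (0, 1)) ∈ G := by rintro _ ⟨c, hc, rfl⟩; exact hC' c hc
  rcases lt_trichotomy C.card n with h | h | h
  · rw [if_neg h.ne]
    exact Covers.zero_of_snd_le hV (hy C' (by omega))
  · rw [if_pos h]
    obtain ⟨c, hc⟩ := Infinite.exists_notMem_finset C
    obtain ⟨c', hc'⟩ := Infinite.exists_notMem_finset C'
    refine Covers.one_of_le (hxA c) (hyB c') hU ?_ hV ?_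
    · rw [← Submodule.span_union, Set.singleton_union, ← Set.image_insert_eq,
        ← Finset.coe_insert]
      exact hx _ (by rw [Finset.card_insert_of_notMem hc, h])
    · rw [← Submodule.span_union, Set.singleton_union, ← Set.image_insert_eq,
        ← Finset.coe_insert]
      exact hy _ (by rw [Finset.card_insert_of_notMem hc']; omega)
  · rw [if_neg h.ne']
    exact Covers.zero_of_fst_le hU (hx C h)

/-- Points of a rational normal curve are in general position. -/
lemma mem_span_of_rationalNormalCurve [CharZero k] {n : ℕ} (y₀ : S) (y : Fin n → S)
    (C : Finset ℕ) (hC : n + 1 ≤ C.card) :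
    Submodule.span k (insert y₀ (Set.range y)) ≤
      Submodule.span k ((fun c : ℕ => (∏ i : Fin n, ((c : k) - (i : ℕ))) • y₀ +
        ∑ i : Fin n, (c : k) ^ (i : ℕ) • y i) '' C) := by
  by_contra hle
  obtain ⟨v, hv, hv'⟩ := SetLike.not_le_iff_exists.1 hle
  obtain ⟨φ, hφv, hφ⟩ := Submodule.exists_le_ker_of_notMem hv'
  apply hφv
  set q₀ : Polynomial k := ∏ i : Fin n, (Polynomial.X - Polynomial.C ((i : ℕ) : k)) with hq₀
  set q₁ : Polynomial k := ∑ i : Fin n, Polynomial.C (φ (y i)) * Polynomial.X ^ (i : ℕ) with hq₁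
  have hq₀m : q₀.Monic := Polynomial.monic_prod_of_monic _ _ fun i _ => Polynomial.monic_X_sub_C _
  have hq₀d : q₀.natDegree = n := by
    rw [hq₀, Polynomial.natDegree_prod_of_monic _ _ fun i _ => Polynomial.monic_X_sub_C _]
    simp only [Polynomial.natDegree_X_sub_C, Finset.sum_const, Finset.card_univ,
      Fintype.card_fin, smul_eq_mul, mul_one]
  have hq₁d : q₁.degree < n := by
    refine (Polynomial.degree_sum_le _ _).trans_lt ?_
    refine (Finset.sup_lt_iff (WithBot.bot_lt_coe n)).2 fun i _ => ?_
    exact (Polynomial.degree_C_mul_X_pow_le _ _).trans_lt (Nat.cast_lt.2 i.2)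
  set q := Polynomial.C (φ y₀) * q₀ + q₁ with hq
  have hqd : q.natDegree ≤ n := by
    refine Polynomial.natDegree_add_le_of_degree_le ?_ ?_
    · exact (Polynomial.natDegree_C_mul_le _ _).trans hq₀d.le
    · exact Polynomial.natDegree_le_of_degree_le hq₁d.le
  have hroot : ∀ c ∈ C, q.eval (c : k) = 0 := by
    intro c hc
    have := hφ (Submodule.subset_span ⟨c, hc, rfl⟩)
    rw [LinearMap.mem_ker] at this
    rw [← this]
    simp only [hq, hq₀, hq₁, Polynomial.eval_add, Polynomial.eval_mul, Polynomial.eval_C,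
      Polynomial.eval_finsetSum, Polynomial.eval_prod, Polynomial.eval_sub, Polynomial.eval_X,
      Polynomial.eval_pow, map_add, map_smul, map_sum, smul_eq_mul, mul_comm (φ _)]
  have hq0 : q = 0 := by
    refine Polynomial.eq_zero_of_natDegree_lt_card_of_eval_eq_zero' q
      (C.map ⟨(Nat.cast : ℕ → k), Nat.cast_injective⟩) ?_ ?_
    · simpa using hroot
    · rw [Finset.card_map]; omega
  have hy₀ : φ y₀ = 0 := by
    have := congrArg (Polynomial.coeff · n) hq0
    have h1 : q₀.coeff n = 1 := by rw [← hq₀d]; exact hq₀m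
    simpa [hq, h1, Polynomial.coeff_eq_zero_of_degree_lt hq₁d] using this
  have hy : ∀ i, φ (y i) = 0 := by
    intro i
    have h0 : q₁ = 0 := by simpa [hq, hy₀] using hq0
    have := congrArg (Polynomial.coeff · (i : ℕ)) h0
    simpa [hq₁, Polynomial.finsetSum_coeff, Polynomial.coeff_C_mul, Polynomial.coeff_X_pow,
      Fin.val_inj] using this
  have hle' : Submodule.span k (insert y₀ (Set.range y)) ≤ LinearMap.ker φ := by
    rw [Submodule.span_le]
    rintro _ (rfl | ⟨i, rfl⟩)
    exacts [hy₀, hy i]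
  exact hle' hv

end GradedPieces

section LinearAlgebra
variable {k S Ω : Type*} [Field k] [CommRing S] [Algebra k S] [Field Ω] [Algebra k Ω]

lemma det_smul_one_sub_ne_zero {ι : Type*} [Fintype ι] [DecidableEq ι] {u : Ω}
    (hu : Transcendental k u) (τ : Matrix ι ι k) :
    (u • (1 : Matrix ι ι Ω) - (1 + u) • τ.map (algebraMap k Ω)).det ≠ 0 := by
  set p : Polynomial k := ((Polynomial.X : Polynomial k) • (1 : Matrix ι ι (Polynomial k)) -
    (1 + Polynomial.X : Polynomial k) • τ.map Polynomial.C).det with hp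
  have h1 : Polynomial.eval (-1) p ≠ 0 := by
    have : Polynomial.eval (-1) p = (-1 : Matrix ι ι k).det := by
      rw [hp, ← Polynomial.coe_evalRingHom, RingHom.map_det]
      congr 1
      ext i j
      by_cases h : i = j <;> simp [h]
    rw [this, Matrix.det_neg, Matrix.det_one]
    simp
  have h2 : Polynomial.aeval u p =
      (u • (1 : Matrix ι ι Ω) - (1 + u) • τ.map (algebraMap k Ω)).det := by
    rw [hp, AlgHom.map_det]
    congr 1
    ext i j
    by_cases h : i = j <;> simp [h]
  rw [← h2]
  intro h
  exact h1 (by rw [transcendental_iff.1 hu p h, Polynomial.eval_zero])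

lemma det_eq_zero_of_covers {A B : Submodule k S} (hA : 1 ≤ A) (hB : 1 ≤ B) (hAfg : A.FG)
    (hBfg : B.FG) {τ : Type*} {P f : τ → S} {deg : τ → ℕ × ℕ}
    (hf : ∀ t, f t ∈ gradedPiece A B (deg t)) {D : ℕ}
    (hP : Covers A B (Set.range fun t => (P t, deg t)) D) {u : Ω} (hu : Transcendental k u)
    (ξ : Fin (D + 1) → S →ₐ[k] Ω) (hξ : ∀ i t, u * ξ i (P t) = (1 + u) * ξ i (f t))
    {a : ℕ × ℕ} (w : Fin (D + 1) → S) (hw : ∀ j, w j ∈ gradedPiece A B a) :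
    (Matrix.of fun i j => ξ i (w j)).det = 0 := by
  classical
  by_contra hdet
  obtain ⟨b, hP⟩ := hP
  obtain ⟨Q, hQ, hle⟩ := hP (b + a) le_self_add
  have hw' : ∀ j, w j ∈ gradedPiece A B (b + a) :=
    fun j => gradedPiece_mono hA hB le_add_self (hw j)
  set U : Submodule Ω (Fin (D + 1) → Ω) :=
    Submodule.span Ω ((Q.image fun q i => ξ i q : Finset (Fin (D + 1) → Ω)) : Set _) with hU
  have hUtop : U < ⊤ := by
    refine lt_top_iff_ne_top.2 fun h => ?_
    have h1 := (finrank_span_finset_le_card (R := Ω) (Q.image fun q i => ξ i q)).trans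
      (Finset.card_image_le.trans hQ)
    rw [Set.finrank, ← hU, h, finrank_top] at h1
    simp at h1
  obtain ⟨φ, hφ0, hφ⟩ := Submodule.exists_le_ker_of_lt_top U hUtop
  let y : S →ₗ[k] Ω :=
    (φ.restrictScalars k) ∘ₗ LinearMap.pi fun i => (ξ i).toLinearMap
  have hy : ∀ x, y x = φ fun i => ξ i x := fun _ => rfl
  have hyQ : ∀ x ∈ Submodule.span k (Q : Set S), y x = 0 := by
    suffices Submodule.span k (Q : Set S) ≤ LinearMap.ker y from fun x hx => this hx
    rw [Submodule.span_le]
    intro q hq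
    refine hφ (Submodule.subset_span ?_)
    simp only [Finset.coe_image]
    exact ⟨q, hq, rfl⟩
  have hyrel : ∀ x ∈ relPiece A B (Set.range fun t => (P t, deg t)) (b + a),
      ∃ x' ∈ gradedPiece A B (b + a), u * y x = (1 + u) * y x' := by
    intro x hx
    induction hx using Submodule.span_induction with
    | mem x hx =>
      obtain ⟨_, ⟨t, rfl⟩, c, v, hv, hc, rfl⟩ := hx
      refine ⟨f t * v, gradedPiece_mono hA hB hc (mul_mem_gradedPiece (hf t) hv), ?_⟩
      simp only [hy, ← smul_eq_mul, ← map_smul]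
      congr 1
      ext i
      simp only [Pi.smul_apply, smul_eq_mul, map_mul, ← mul_assoc, hξ i t]
    | zero => exact ⟨0, zero_mem _, by simp⟩
    | add x₁ x₂ _ _ h₁ h₂ =>
      obtain ⟨v₁, hv₁, e₁⟩ := h₁
      obtain ⟨v₂, hv₂, e₂⟩ := h₂
      exact ⟨v₁ + v₂, add_mem hv₁ hv₂, by rw [map_add, map_add, mul_add, mul_add, e₁, e₂]⟩
    | smul r x _ h =>
      obtain ⟨v, hv, e⟩ := h
      exact ⟨r • v, Submodule.smul_mem _ _ hv,
        by rw [map_smul, map_smul, mul_smul_comm, mul_smul_comm, e]⟩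
  have hypiece : ∀ x ∈ gradedPiece A B (b + a),
      ∃ x' ∈ gradedPiece A B (b + a), u * y x = (1 + u) * y x' := by
    intro x hx
    obtain ⟨q, hq, r, hr, rfl⟩ := Submodule.mem_sup.1 (hle hx)
    obtain ⟨x', hx', e⟩ := hyrel r hr
    exact ⟨x', hx', by rw [map_add, hyQ q hq, zero_add, e]⟩
  have hfg : (gradedPiece A B (b + a)).FG := (hAfg.pow _).mul (hBfg.pow _)
  obtain ⟨m, v, hv⟩ := Submodule.fg_iff_exists_fin_generating_family.1 hfg
  have hvm : ∀ α, v α ∈ gradedPiece A B (b + a) :=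
    fun α => hv ▸ Submodule.subset_span ⟨α, rfl⟩
  have hτ : ∀ α, ∃ c : Fin m → k, u * y (v α) = (1 + u) * ∑ β, algebraMap k Ω (c β) * y (v β) := by
    intro α
    obtain ⟨x', hx', e⟩ := hypiece (v α) (hvm α)
    rw [← hv] at hx'
    obtain ⟨c, rfl⟩ := (Submodule.mem_span_range_iff_exists_fun k).1 hx'
    exact ⟨c, by rw [e, map_sum]; simp only [map_smul]; simp only [Algebra.smul_def]⟩
  choose τ' hτ' using hτ
  have hv0 : (fun α => y (v α)) = 0 := by
    by_contra hne
    refine det_smul_one_sub_ne_zero hu (Matrix.of τ')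
      (Matrix.exists_mulVec_eq_zero_iff.1 ⟨_, hne, ?_⟩)
    ext α
    rw [Matrix.sub_mulVec, Matrix.smul_mulVec, Matrix.smul_mulVec, Matrix.one_mulVec]
    simp [hτ' α, Matrix.mulVec, dotProduct]
  have hy0 : ∀ x ∈ gradedPiece A B (b + a), y x = 0 := by
    suffices gradedPiece A B (b + a) ≤ LinearMap.ker y from fun x hx => this hx
    rw [← hv, Submodule.span_le]
    rintro _ ⟨α, rfl⟩
    exact congrFun hv0 α
  refine hdet (Matrix.exists_vecMul_eq_zero_iff.1 ⟨fun i => φ (Pi.single i 1), ?_, ?_⟩)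
  · intro h
    exact hφ0 (LinearMap.pi_ext' fun i => LinearMap.ext_ring (congrFun h i))
  · ext j
    have := hy0 (w j) (hw' j)
    rw [hy, LinearMap.pi_apply_eq_sum_univ] at this
    have hsingle : ∀ i : Fin (D + 1),
        (Pi.single i 1 : Fin (D + 1) → Ω) = fun j => if i = j then 1 else 0 := fun i => by
      ext j; simp [Pi.single_apply, eq_comm]
    simpa [Matrix.vecMul, dotProduct, mul_comm, hsingle] using this

end LinearAlgebra

section Hensel
variable {k R : Type*} [Field k] [CommRing R] {ι : Type*}

lemma MvPolynomial.eval_map_comp {R' : Type*} [CommRing R'] (φ : R →+* R') (x : ι → R)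
    (p : MvPolynomial ι R) :
    MvPolynomial.eval (fun i => φ (x i)) (MvPolynomial.map φ p) = φ (MvPolynomial.eval x p) := by
  rw [MvPolynomial.eval_map]
  exact (MvPolynomial.eval₂_comp_left φ (RingHom.id R) x p).symm

lemma MvPolynomial.eval_add_sub_mem [Fintype ι] (I : Ideal R) (p : MvPolynomial ι R) (x δ : ι → R)
    (hδ : ∀ i, δ i ∈ I) :
    MvPolynomial.eval (x + δ) p - MvPolynomial.eval x p -
      ∑ i, MvPolynomial.eval x (MvPolynomial.pderiv i p) * δ i ∈ I ^ 2 := by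
  classical
  induction p using MvPolynomial.induction_on with
  | C a => simp
  | add p q hp hq =>
    convert add_mem hp hq using 1
    simp only [map_add, add_mul, Finset.sum_add_distrib]
    ring
  | mul_X p j hp =>
    have h2 : (MvPolynomial.eval (x + δ) p - MvPolynomial.eval x p -
      ∑ i, MvPolynomial.eval x (MvPolynomial.pderiv i p) * δ i) * (x j + δ j) +
      (∑ i, MvPolynomial.eval x (MvPolynomial.pderiv i p) * δ i) * δ j ∈ I ^ 2 := by
      refine add_mem (Ideal.mul_mem_right _ _ hp) ?_
      rw [pow_two]
      exact Ideal.mul_mem_mul (sum_mem fun i _ => Ideal.mul_mem_left _ _ (hδ i)) (hδ j)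
    convert h2 using 1
    simp only [map_mul, MvPolynomial.eval_X, Pi.add_apply, Derivation.leibniz, map_add,
      smul_eq_mul, MvPolynomial.pderiv_X, add_mul, Finset.sum_add_distrib, Finset.sum_mul]
    have h3 : ∑ i, MvPolynomial.eval x p * 
        MvPolynomial.eval x ((Pi.single i 1 : ι → MvPolynomial ι R) j) * δ i
        = MvPolynomial.eval x p * δ j := by
      rw [Finset.sum_eq_single j]
      · simp
      · intro i _ hij
        simp [Pi.single_eq_of_ne hij.symm]
      · simp
    rw [h3]
    have h4 : ∑ i, x j * MvPolynomial.eval x (MvPolynomial.pderiv i p) * δ i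
       = x j * ∑ i, MvPolynomial.eval x (MvPolynomial.pderiv i p) * δ i := by
      rw [Finset.mul_sum]; simp only [mul_assoc]
    rw [h4, ← Finset.sum_mul]
    ring

lemma MvPolynomial.eval_sub_eval_mem [Fintype ι] (I : Ideal R) (p : MvPolynomial ι R) (x y : ι → R)
    (h : ∀ i, y i - x i ∈ I) : MvPolynomial.eval y p - MvPolynomial.eval x p ∈ I := by
  have h1 := MvPolynomial.eval_add_sub_mem I p x (y - x) h
  rw [add_sub_cancel] at h1
  have h2 : ∑ i, MvPolynomial.eval x (MvPolynomial.pderiv i p) * (y - x) i ∈ I :=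
    sum_mem fun i _ => Ideal.mul_mem_left _ _ (h i)
  simpa using add_mem (Ideal.pow_le_self two_ne_zero h1) h2

lemma PowerSeries.exists_newton_step {τ : Type*} [Fintype ι] [Fintype τ] [DecidableEq τ]
    (e : τ ≃ ι) (G : τ → MvPolynomial ι (PowerSeries k)) (x₀ : ι → k)
    (hJ : (Matrix.of fun t t' => MvPolynomial.eval x₀ (MvPolynomial.pderiv (e t')
      (MvPolynomial.map (PowerSeries.constantCoeff (R := k)) (G t)))).det ≠ 0)
    (m : ℕ) (x : ι → PowerSeries k) (hx₀ : ∀ i, PowerSeries.constantCoeff (x i) = x₀ i)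
    (hx : ∀ t, PowerSeries.X ^ (m + 1) ∣ MvPolynomial.eval x (G t)) :
    ∃ y : ι → PowerSeries k, (∀ i, PowerSeries.X ^ (m + 1) ∣ y i - x i) ∧
      ∀ t, PowerSeries.X ^ (m + 2) ∣ MvPolynomial.eval y (G t) := by
  set J : Matrix τ τ (PowerSeries k) :=
    Matrix.of fun t t' => MvPolynomial.eval x (MvPolynomial.pderiv (e t') (G t)) with hJdef
  have hJu : IsUnit J.det := by
    rw [PowerSeries.isUnit_iff_constantCoeff, isUnit_iff_ne_zero, RingHom.map_det]
    convert hJ using 2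
    ext t t'
    simp only [hJdef, RingHom.mapMatrix_apply, Matrix.map_apply, Matrix.of_apply,
      MvPolynomial.pderiv_map]
    rw [← funext hx₀, MvPolynomial.eval_map_comp]
  choose b hb using hx
  set δ : ι → PowerSeries k := fun i => - (PowerSeries.X ^ (m + 1) * (J⁻¹ *ᵥ b) (e.symm i))
    with hδ
  have hδI : ∀ i, δ i ∈ Ideal.span {(PowerSeries.X : PowerSeries k) ^ (m + 1)} := fun i =>
    Ideal.mem_span_singleton.2 ((dvd_mul_right _ _).neg_right)
  refine ⟨x + δ, fun i => ?_, fun t => ?_⟩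
  · simpa using Ideal.mem_span_singleton.1 (hδI i)
  · have h1 := MvPolynomial.eval_add_sub_mem _ (G t) x δ hδI
    have h2 : ∑ i, MvPolynomial.eval x (MvPolynomial.pderiv i (G t)) * δ i =
        - MvPolynomial.eval x (G t) := by
      rw [← e.sum_comp]
      have h3 : (J *ᵥ (J⁻¹ *ᵥ b)) t = b t := by
        rw [Matrix.mulVec_mulVec, Matrix.mul_nonsing_inv _ hJu, Matrix.one_mulVec]
      rw [hb t, ← h3]
      generalize J⁻¹ *ᵥ b = c at hδ
      simp only [hδ, Equiv.symm_apply_apply, Matrix.mulVec, dotProduct, Finset.mul_sum,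
        ← Finset.sum_neg_distrib, hJdef, Matrix.of_apply]
      refine Finset.sum_congr rfl fun t' _ => ?_
      ring
    rw [h2, sub_neg_eq_add, sub_add_cancel, Ideal.span_singleton_pow,
      Ideal.mem_span_singleton] at h1
    refine dvd_trans ?_ h1
    rw [← pow_mul]
    exact pow_dvd_pow _ (by omega)

/-- Multivariate Hensel lemma over power series. -/
lemma PowerSeries.exists_root_of_jacobian {τ : Type*} [Fintype ι] [Fintype τ] [DecidableEq τ]
    (e : τ ≃ ι) (G : τ → MvPolynomial ι (PowerSeries k)) (x₀ : ι → k)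
    (h₀ : ∀ t, MvPolynomial.eval x₀
      (MvPolynomial.map (PowerSeries.constantCoeff (R := k)) (G t)) = 0)
    (hJ : (Matrix.of fun t t' => MvPolynomial.eval x₀ (MvPolynomial.pderiv (e t')
      (MvPolynomial.map (PowerSeries.constantCoeff (R := k)) (G t)))).det ≠ 0) :
    ∃ x : ι → PowerSeries k, (∀ i, PowerSeries.constantCoeff (x i) = x₀ i) ∧
      ∀ t, MvPolynomial.eval x (G t) = 0 := by
  let good (m : ℕ) (x : ι → PowerSeries k) : Prop :=
    (∀ i, PowerSeries.constantCoeff (x i) = x₀ i) ∧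
      ∀ t, PowerSeries.X ^ (m + 1) ∣ MvPolynomial.eval x (G t)
  have step : ∀ m (x : {x // good m x}), ∃ y : {y // good (m + 1) y},
      ∀ i, PowerSeries.X ^ (m + 1) ∣ y.1 i - x.1 i := by
    rintro m ⟨x, hx₀, hx⟩
    obtain ⟨y, hyx, hy⟩ := PowerSeries.exists_newton_step e G x₀ hJ m x hx₀ hx
    refine ⟨⟨y, fun i => ?_, hy⟩, hyx⟩
    have h1 := PowerSeries.X_dvd_iff.1 ((dvd_pow_self _ m.succ_ne_zero).trans (hyx i))
    rw [map_sub, sub_eq_zero] at h1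
    rw [h1, hx₀]
  choose next hnext using step
  have base : good 0 fun i => PowerSeries.C (x₀ i) := by
    refine ⟨fun i => by simp, fun t => ?_⟩
    rw [zero_add, pow_one, PowerSeries.X_dvd_iff, ← h₀ t, ← MvPolynomial.eval_map_comp]
    simp
  let seq : (m : ℕ) → {x // good m x} := fun m => Nat.rec ⟨_, base⟩ (fun m x => next m x) m
  have hseq : ∀ m i, PowerSeries.X ^ (m + 1) ∣ (seq (m + 1)).1 i - (seq m).1 i :=
    fun m i => hnext m (seq m) i
  have hcoeff : ∀ j m, j ≤ m → ∀ i,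
      PowerSeries.coeff j ((seq m).1 i) = PowerSeries.coeff j ((seq j).1 i) := by
    intro j m hjm i
    induction m, hjm using Nat.le_induction with
    | base => rfl
    | succ m hm ih =>
      have := PowerSeries.X_pow_dvd_iff.1 (hseq m i) j (by omega)
      rw [map_sub, sub_eq_zero] at this
      rw [this, ih]
  refine ⟨fun i => PowerSeries.mk fun j => PowerSeries.coeff j ((seq j).1 i), fun i => ?_,
    fun t => ?_⟩
  · rw [← PowerSeries.coeff_zero_eq_constantCoeff_apply, PowerSeries.coeff_mk,
      PowerSeries.coeff_zero_eq_constantCoeff_apply]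
    exact (seq 0).2.1 i
  · ext m
    have h1 := MvPolynomial.eval_sub_eval_mem
      (Ideal.span {(PowerSeries.X : PowerSeries k) ^ (m + 1)}) (G t) (seq m).1
      (fun i => PowerSeries.mk fun j => PowerSeries.coeff j ((seq j).1 i)) fun i => by
        rw [Ideal.mem_span_singleton, PowerSeries.X_pow_dvd_iff]
        intro j hj
        rw [map_sub, PowerSeries.coeff_mk, hcoeff j m (by omega), sub_self]
    rw [Ideal.mem_span_singleton] at h1
    have h2 := PowerSeries.X_pow_dvd_iff.1 ((dvd_iff_dvd_of_dvd_sub h1).2 ((seq m).2.2 t)) m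
      (by omega)
    simpa using h2

end Hensel

section CoveringSystem
variable {k : Type*} [Field k]

/-- The polynomials of degree at most one in the variables `v j`. -/
noncomputable def affineForms (k : Type*) [Field k] {σ ι : Type*} (v : σ → ι) :
    Submodule k (MvPolynomial ι k) :=
  Submodule.span k (insert 1 (Set.range fun j => X (v j)))

lemma one_mem_affineForms {σ ι : Type*} (v : σ → ι) : 1 ∈ affineForms k v :=
  Submodule.subset_span (Set.mem_insert _ _)

lemma one_le_affineForms {σ ι : Type*} (v : σ → ι) : 1 ≤ affineForms k v :=
  Submodule.one_le.2 (one_mem_affineForms v)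

lemma X_mem_affineForms {σ ι : Type*} (v : σ → ι) (j : σ) : X (v j) ∈ affineForms k v :=
  Submodule.subset_span (Set.mem_insert_of_mem _ ⟨j, rfl⟩)

lemma C_mem_affineForms {σ ι : Type*} (v : σ → ι) (c : k) : C c ∈ affineForms k v := by
  rw [← mul_one (C c), ← MvPolynomial.smul_eq_C_mul]
  exact Submodule.smul_mem _ _ (one_mem_affineForms v)

lemma affineForms_fg {σ ι : Type*} [Finite σ] (v : σ → ι) : (affineForms k v).FG :=
  Submodule.fg_span ((Set.finite_range _).insert _)

lemma exists_affineForms_generalPosition [CharZero k] {m : ℕ} {ι : Type*} (v : Fin m → ι)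
    (z : ι → k) :
    ∃ x : ℕ → MvPolynomial ι k, (∀ c, x c ∈ affineForms k v) ∧
      (∀ C : Finset ℕ, m + 1 ≤ C.card → affineForms k v ≤ Submodule.span k (x '' C)) ∧
      ∀ c < m, eval z (x c) = 0 := by
  refine ⟨fun c : ℕ => (∏ i : Fin m, ((c : k) - (i : ℕ))) • (1 : MvPolynomial ι k) +
        ∑ i : Fin m, (c : k) ^ (i : ℕ) • (X (v i) - C (z (v i))), fun c => ?_, fun C hC => ?_,
        fun c hc => ?_⟩
  · refine add_mem (Submodule.smul_mem _ _ (one_mem_affineForms v)) (sum_mem fun i _ =>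
      Submodule.smul_mem _ _ (sub_mem (X_mem_affineForms v i) (C_mem_affineForms v _)))
  · refine le_trans ?_ (mem_span_of_rationalNormalCurve (k := k) 1
      (fun i => X (v i) - MvPolynomial.C (z (v i))) C hC)
    rw [affineForms, Submodule.span_le]
    have h1 : (1 : MvPolynomial ι k) ∈ Submodule.span k
        (insert 1 (Set.range fun i => X (v i) - MvPolynomial.C (z (v i)))) :=
      Submodule.subset_span (Set.mem_insert _ _)
    rintro _ (rfl | ⟨i, rfl⟩)
    · exact h1
    · have h2 : X (v i) - MvPolynomial.C (z (v i)) ∈ Submodule.span k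
        (insert 1 (Set.range fun i => X (v i) - MvPolynomial.C (z (v i)))) :=
        Submodule.subset_span (Set.mem_insert_of_mem _ ⟨i, rfl⟩)
      have := add_mem h2 (Submodule.smul_mem _ (z (v i)) h1)
      rwa [MvPolynomial.smul_eq_C_mul, mul_one, sub_add_cancel] at this
  · have h0 : ∏ i : Fin m, ((c : k) - (i : ℕ)) = 0 :=
      Finset.prod_eq_zero (Finset.mem_univ ⟨c, hc⟩) (by simp)
    simp [h0, MvPolynomial.smul_eval]

/-- The bidegrees of the equations of the system. -/
def systemDegree {n s : ℕ} (d : Fin s → ℕ) (d' : Fin (n - 1) → ℕ) :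
    Fin s ⊕ Fin (n - 1) → ℕ × ℕ :=
  Sum.elim (fun i => (d i, 0)) fun j => (d' j, 1)

/-- A product system of prescribed bidegrees through a given point, with quotient of the expected
dimension. -/
lemma exists_covering_system [CharZero k] {n s : ℕ} (hs : 2 ≤ s) (hsn : s ≤ n - 1)
    (d : Fin s → ℕ) (d' : Fin (n - 1) → ℕ) (hd : ∀ i, 0 < d i) (hd' : ∀ i, 0 < d' i)
    (z : Fin n ⊕ Fin (s - 1) → k) :
    ∃ P : Fin s ⊕ Fin (n - 1) → MvPolynomial (Fin n ⊕ Fin (s - 1)) k,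
      (∀ t, eval z (P t) = 0) ∧
      Covers (affineForms k Sum.inl) (affineForms k Sum.inr)
        (Set.range fun t => (P t, systemDegree d d' t))
        ((∏ i, d i) * ∑ E ∈ Finset.powersetCard (n - s) (Finset.univ : Finset (Fin (n - 1))),
          ∏ j ∈ E, d' j) := by
  obtain ⟨x, hxA, hx, hxz⟩ :=
    exists_affineForms_generalPosition (k := k) (Sum.inl : Fin n → Fin n ⊕ Fin (s - 1)) z
  obtain ⟨y, hyB, hy, hyz⟩ :=
    exists_affineForms_generalPosition (k := k) (Sum.inr : Fin (s - 1) → Fin n ⊕ Fin (s - 1)) z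
  set A := affineForms k (Sum.inl : Fin n → Fin n ⊕ Fin (s - 1)) with hAdef
  set B := affineForms k (Sum.inr : Fin (s - 1) → Fin n ⊕ Fin (s - 1)) with hBdef
  have hA : 1 ≤ A := one_le_affineForms _
  have hB : 1 ≤ B := one_le_affineForms _
  have hx' : ∀ c, x c ∈ gradedPiece A B (1, 0) := fun c => by simpa [gradedPiece] using hxA c
  set r := s + (n - 1) with hr
  set xi : Fin s → ℕ → MvPolynomial (Fin n ⊕ Fin (s - 1)) k := fun i l => x (i + r * l) with hxi
  set xj : Fin (n - 1) → ℕ → MvPolynomial (Fin n ⊕ Fin (s - 1)) k :=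
    fun j l => x (s + j + r * l) with hxj
  set yj : Fin (n - 1) → MvPolynomial (Fin n ⊕ Fin (s - 1)) k := fun j => y (n - 2 - j) with hyj
  refine ⟨Sum.elim (fun i => ∏ l ∈ Finset.range (d i), xi i l)
    fun j => (∏ l ∈ Finset.range (d' j), xj j l) * yj j, ?_, ?_⟩
  · rintro (i | j)
    · rw [Sum.elim_inl, map_prod]
      refine Finset.prod_eq_zero (Finset.mem_range.2 (hd i)) (hxz _ ?_)
      have := i.2
      omega
    · rw [Sum.elim_inr, map_mul, map_prod]
      by_cases hj : (j : ℕ) < n - s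
      · rw [Finset.prod_eq_zero (Finset.mem_range.2 (hd' j)) (hxz _ (by omega)), zero_mul]
      · rw [hyj, hyz _ (by omega), mul_zero]
  have leaf : ∀ (φ : Fin s → ℕ) (ψ : Fin (n - 1) → ℕ), ∀ E ⊆ (Finset.univ : Finset (Fin (n - 1))),
      Covers A B (((fun i => (xi i (φ i), ((1, 0) : ℕ × ℕ))) ''
          ((Finset.univ : Finset (Fin s)) : Set (Fin s))) ∪
        ((fun j => (xj j (ψ j), ((1, 0) : ℕ × ℕ))) '' (E : Set (Fin (n - 1))) ∪
        (fun j => (yj j, ((0, 1) : ℕ × ℕ))) ''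
          ((Finset.univ \ E : Finset (Fin (n - 1))) : Set (Fin (n - 1)))))
        (if E.card = n - s then 1 else 0) := by
    intro φ ψ E _
    set F : Fin s ⊕ Fin (n - 1) → ℕ :=
      Sum.elim (fun i => i + r * φ i) fun j => s + j + r * ψ j with hF
    have hFinj : Function.Injective F := by
      have hmod : ∀ t, F t % r = Sum.elim (fun i : Fin s => (i : ℕ))
          (fun j : Fin (n - 1) => s + (j : ℕ)) t := by
        rintro (i | j)
        · have := i.2
          simp only [hF, Sum.elim_inl, Nat.add_mul_mod_self_left]
          exact Nat.mod_eq_of_lt (by omega)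
        · have := j.2
          simp only [hF, Sum.elim_inr, Nat.add_mul_mod_self_left]
          exact Nat.mod_eq_of_lt (by omega)
      intro t t' htt'
      have h := hmod t
      rw [htt', hmod t'] at h
      rcases t with ⟨i, hi⟩ | ⟨j, hj⟩ <;> rcases t' with ⟨i', hi'⟩ | ⟨j', hj'⟩ <;>
        simp only [Sum.elim_inl, Sum.elim_inr, Sum.inl.injEq, Sum.inr.injEq, Fin.mk.injEq,
          reduceCtorEq] at h ⊢ <;> omega
    have hbinj : Function.Injective fun j : Fin (n - 1) => n - 2 - (j : ℕ) := by
      intro j j' h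
      have := j.2
      have := j'.2
      simp only at h
      ext
      omega
    have hEle := E.card_le_univ
    rw [Fintype.card_fin] at hEle
    have hc : (((Finset.univ : Finset (Fin s)).disjSum E).image F).card = s + E.card := by
      rw [Finset.card_image_of_injective _ hFinj, Finset.card_disjSum, Finset.card_univ,
        Fintype.card_fin]
    have hc' : ((Finset.univ \ E).image fun j : Fin (n - 1) => n - 2 - (j : ℕ)).card =
        n - 1 - E.card := by
      rw [Finset.card_image_of_injective _ hbinj, Finset.card_univ_sdiff, Fintype.card_fin]
    have := Covers.of_generalPosition hxA hyB hx hy (G := ((fun i => (xi i (φ i), ((1, 0) : ℕ × ℕ))) ''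
          ((Finset.univ : Finset (Fin s)) : Set (Fin s))) ∪
        ((fun j => (xj j (ψ j), ((1, 0) : ℕ × ℕ))) '' (E : Set (Fin (n - 1))) ∪
        (fun j => (yj j, ((0, 1) : ℕ × ℕ))) ''
          ((Finset.univ \ E : Finset (Fin (n - 1))) : Set (Fin (n - 1)))))
        (((Finset.univ : Finset (Fin s)).disjSum E).image F)
        ((Finset.univ \ E).image fun j : Fin (n - 1) => n - 2 - (j : ℕ)) ?_ ?_ (by omega)
    · refine this.mono subset_rfl (le_of_eq ?_)
      rw [hc]
      exact if_congr (by omega) rfl rfl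
    · intro c hc
      obtain ⟨i | j, ht, rfl⟩ := Finset.mem_image.1 hc
      · exact Or.inl ⟨i, by simp, rfl⟩
      · exact Or.inr (Or.inl ⟨j, by simpa using ht, rfl⟩)
    · intro c hc
      obtain ⟨j, hj, rfl⟩ := Finset.mem_image.1 hc
      exact Or.inr (Or.inr ⟨j, hj, rfl⟩)
  have h1 := fun φ => Covers.expand_bilinear hA hB xj yj d' (fun j l => hx' _) Finset.univ
    (fun E => if E.card = n - s then 1 else 0) _ (leaf φ)
  have h2 := Covers.expand_linear hA hB xi d _ (fun i l => hx' _) Finset.univ _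
    fun φ => by rw [Set.union_comm]; exact h1 φ
  refine h2.mono ?_ (le_of_eq ?_)
  · rintro _ (⟨j, -, rfl⟩ | ⟨i, -, rfl⟩)
    · exact ⟨Sum.inr j, rfl⟩
    · exact ⟨Sum.inl i, rfl⟩
  · congr 1
    rw [Finset.powersetCard_eq_filter, Finset.sum_filter]
    simp

end CoveringSystem

section Deformation
variable {k : Type*} [Field k] {ι τ : Type*}

/-- The deformation `(1 - c) p + c q`. -/
noncomputable def deform (R : Type*) [CommRing R] [Algebra k R] (c : R) (p q : MvPolynomial ι k) :
    MvPolynomial ι R :=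
  C (1 - c) * map (algebraMap k R) p + C c * map (algebraMap k R) q

lemma eval_deform {R : Type*} [CommRing R] [Algebra k R] (c : R) (p q : MvPolynomial ι k)
    (x : ι → R) : eval x (deform R c p q) = (1 - c) * aeval x p + c * aeval x q := by
  simp [deform, eval_map, aeval_def]

lemma map_deform {R R' : Type*} [CommRing R] [Algebra k R] [CommRing R'] [Algebra k R']
    (φ : R →ₐ[k] R') (c : R) (p q : MvPolynomial ι k) :
    map (φ : R →+* R') (deform R c p q) = deform R' (φ c) p q := by
  simp [deform, MvPolynomial.map_map, φ.comp_algebraMap]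

lemma map_constantCoeff_deform {L : Type*} [Field L] [Algebra k L] (p q : MvPolynomial ι k) :
    map (PowerSeries.constantCoeff (R := L)) (deform (PowerSeries L) (1 + PowerSeries.X) p q) =
      map (algebraMap k L) q := by
  have : (PowerSeries.constantCoeff (R := L)).comp (algebraMap k (PowerSeries L)) =
      algebraMap k L := by
    ext c
    simp [PowerSeries.algebraMap_apply]
  simp [deform, MvPolynomial.map_map, this]

/-- Nondegenerate solutions of a system lift to its deformations over power series. -/
lemma exists_root_deform [Fintype ι] [Fintype τ] [DecidableEq τ] {L : Type*} [Field L]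
    [Algebra k L] (e : τ ≃ ι) (p q : τ → MvPolynomial ι k) (x₀ : ι → L)
    (h₀ : ∀ t, aeval x₀ (q t) = 0)
    (hJ : (Matrix.of fun t t' => aeval x₀ (pderiv (e t') (q t))).det ≠ 0) :
    ∃ x : ι → PowerSeries L, (∀ i, PowerSeries.constantCoeff (x i) = x₀ i) ∧
      ∀ t, eval x (deform (PowerSeries L) (1 + PowerSeries.X) (p t) (q t)) = 0 := by
  apply PowerSeries.exists_root_of_jacobian e
  · intro t
    rw [map_constantCoeff_deform, ← h₀ t, aeval_def, eval_map]
  · convert hJ using 5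
    rw [map_constantCoeff_deform, pderiv_map, aeval_def, eval_map]

lemma PowerSeries.transcendental_X : Transcendental k (PowerSeries.X : PowerSeries k) := by
  rw [transcendental_iff]
  intro p hp
  have h : Polynomial.aeval (R := k) (PowerSeries.X : PowerSeries k) =
      Polynomial.coeToPowerSeries.algHom k := Polynomial.algHom_ext (by simp)
  rw [h] at hp
  simpa using hp

lemma det_eq_zero_of_covers_of_isFractionRing {S : Type*} (Ω : Type*) [CommRing S] [Algebra k S] [Field Ω]
    [Algebra (PowerSeries k) Ω] [IsFractionRing (PowerSeries k) Ω] [Algebra k Ω]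
    [IsScalarTower k (PowerSeries k) Ω] {A B : Submodule k S} (hA : 1 ≤ A) (hB : 1 ≤ B)
    (hAfg : A.FG) (hBfg : B.FG) {P f : τ → S} {deg : τ → ℕ × ℕ}
    (hf : ∀ t, f t ∈ gradedPiece A B (deg t)) {D : ℕ}
    (hP : Covers A B (Set.range fun t => (P t, deg t)) D)
    (ξ : Fin (D + 1) → S →ₐ[k] PowerSeries k)
    (hξ : ∀ i t, PowerSeries.X * ξ i (P t) = (1 + PowerSeries.X) * ξ i (f t))
    {a : ℕ × ℕ} (w : Fin (D + 1) → S) (hw : ∀ j, w j ∈ gradedPiece A B a) :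
    (Matrix.of fun i j => ξ i (w j)).det = 0 := by
  have hinj : Function.Injective (algebraMap (PowerSeries k) Ω) := IsFractionRing.injective _ _
  have hdet := det_eq_zero_of_covers hA hB hAfg hBfg hf hP
    (u := algebraMap (PowerSeries k) Ω PowerSeries.X)
    ((transcendental_algebraMap_iff hinj).2 PowerSeries.transcendental_X)
    (fun i => (IsScalarTower.toAlgHom k (PowerSeries k) Ω).comp (ξ i)) (fun i t => by
      simpa using congrArg (algebraMap (PowerSeries k) Ω) (hξ i t)) w hw
  apply hinj
  rw [map_zero, ← hdet, RingHom.map_det]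
  rfl

lemma det_powerSeries_eq_zero_of_covers {S : Type*} [CommRing S] [Algebra k S]
    {A B : Submodule k S} (hA : 1 ≤ A) (hB : 1 ≤ B)
    (hAfg : A.FG) (hBfg : B.FG) {P f : τ → S} {deg : τ → ℕ × ℕ}
    (hf : ∀ t, f t ∈ gradedPiece A B (deg t)) {D : ℕ}
    (hP : Covers A B (Set.range fun t => (P t, deg t)) D)
    (ξ : Fin (D + 1) → S →ₐ[k] PowerSeries k)
    (hξ : ∀ i t, PowerSeries.X * ξ i (P t) = (1 + PowerSeries.X) * ξ i (f t))
    {a : ℕ × ℕ} (w : Fin (D + 1) → S) (hw : ∀ j, w j ∈ gradedPiece A B a) :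
    (Matrix.of fun i j => ξ i (w j)).det = 0 :=
  det_eq_zero_of_covers_of_isFractionRing (FractionRing (PowerSeries k)) hA hB hAfg hBfg hf hP ξ
    hξ w hw

/-- Distinct points are separated by polynomials of a common bidegree. -/
lemma exists_separators {α β : Type*} [Inhabited (α ⊕ β)] {m : ℕ} (η : Fin m → α ⊕ β → k)
    (hη : Function.Injective η) :
    ∃ a, ∃ w : Fin m → MvPolynomial (α ⊕ β) k,
      (∀ j, w j ∈ gradedPiece (affineForms k Sum.inl) (affineForms k Sum.inr) a) ∧
      ∀ i j, eval (η i) (w j) = 0 ↔ i ≠ j := by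
  classical
  have h1 : ∀ i j, ∃ l, i ≠ j → η i l ≠ η j l := by
    intro i j
    by_cases h : i = j
    · exact ⟨default, fun h' => (h' h).elim⟩
    · obtain ⟨l, hl⟩ := Function.ne_iff.1 (hη.ne h)
      exact ⟨l, fun _ => hl⟩
  choose l hl using h1
  refine ⟨∑ i : Fin m, (1, 1), fun j => ∏ i, if i = j then 1 else X (l i j) - C (η i (l i j)),
    fun j => prod_mem_gradedPiece _ _ _ fun i _ => ?_, fun i j => ?_⟩
  · have hA := one_le_affineForms (k := k) (Sum.inl : α → α ⊕ β)
    have hB := one_le_affineForms (k := k) (Sum.inr : β → α ⊕ β)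
    have h10 : affineForms k (Sum.inl : α → α ⊕ β) ≤
        gradedPiece (affineForms k Sum.inl) (affineForms k Sum.inr) (1, 1) := by
      simpa [gradedPiece] using mul_le_mul_right hB (affineForms k (Sum.inl : α → α ⊕ β))
    have h01 : affineForms k (Sum.inr : β → α ⊕ β) ≤
        gradedPiece (affineForms k Sum.inl) (affineForms k Sum.inr) (1, 1) := by
      simpa [gradedPiece] using mul_le_mul_left hA (affineForms k (Sum.inr : β → α ⊕ β))
    split_ifs
    · exact h10 (one_mem_affineForms _)
    · rcases l i j with a | b
      · exact h10 (sub_mem (X_mem_affineForms _ _) (C_mem_affineForms _ _))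
      · exact h01 (sub_mem (X_mem_affineForms _ _) (C_mem_affineForms _ _))
  · rw [map_prod, Finset.prod_eq_zero_iff]
    constructor
    · rintro ⟨a, -, ha⟩ rfl
      by_cases h : a = i
      · simp [h] at ha
      · simp [h, sub_eq_zero] at ha
        exact hl a i h ha.symm
    · intro h
      exact ⟨i, Finset.mem_univ _, by simp [h]⟩

/-- A system of given bidegrees with the maximal number of nondegenerate solutions has no further
solution. -/
lemma mem_range_of_nondegenerate_solutions [CharZero k] {n s : ℕ} (hs : 2 ≤ s) (hsn : s ≤ n - 1)
    (d : Fin s → ℕ) (d' : Fin (n - 1) → ℕ) (hd : ∀ i, 0 < d i) (hd' : ∀ i, 0 < d' i)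
    (e : (Fin s ⊕ Fin (n - 1)) ≃ (Fin n ⊕ Fin (s - 1)))
    (f : Fin s ⊕ Fin (n - 1) → MvPolynomial (Fin n ⊕ Fin (s - 1)) k)
    (hf : ∀ t, f t ∈ gradedPiece (affineForms k Sum.inl) (affineForms k Sum.inr)
      (systemDegree d d' t))
    {D : ℕ} (hD : D = (∏ i, d i) * ∑ E ∈ Finset.powersetCard (n - s) Finset.univ, ∏ j ∈ E, d' j)
    (pts : Fin D → Fin n ⊕ Fin (s - 1) → k) (hinj : Function.Injective pts)
    (hroot : ∀ i t, eval (pts i) (f t) = 0)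
    (hjac : ∀ i, (Matrix.of fun t t' => eval (pts i) (pderiv (e t') (f t))).det ≠ 0)
    (z : Fin n ⊕ Fin (s - 1) → k) (hz : ∀ t, eval z (f t) = 0) : z ∈ Set.range pts := by
  by_contra hzr
  obtain ⟨P, hPz, hP⟩ := exists_covering_system hs hsn d d' hd hd' z
  rw [← hD] at hP
  set η : Fin (D + 1) → Fin n ⊕ Fin (s - 1) → k := Fin.cons z pts with hη
  have hηinj : Function.Injective η := Fin.cons_injective_iff.2 ⟨hzr, hinj⟩
  have hlift : ∀ i, ∃ x : Fin n ⊕ Fin (s - 1) → PowerSeries k,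
      (∀ v, PowerSeries.constantCoeff (x v) = η i v) ∧
      ∀ t, eval x (deform (PowerSeries k) (1 + PowerSeries.X) (P t) (f t)) = 0 := by
    intro i
    induction i using Fin.cases with
    | zero =>
      refine ⟨fun v => algebraMap k _ (z v), fun v => by simp [hη],
        fun t => ?_⟩
      have haev : ∀ p : MvPolynomial (Fin n ⊕ Fin (s - 1)) k,
          aeval (fun v => algebraMap k (PowerSeries k) (z v)) p =
            algebraMap k (PowerSeries k) (eval z p) := fun p => by
        rw [← coe_aeval_eq_eval]
        exact aeval_algebraMap_apply _ _ _
      rw [eval_deform, haev, haev, hPz, hz]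
      simp
    | succ i =>
      simpa [hη] using exists_root_deform e P f (pts i) (by simpa using hroot i)
        (by simpa using hjac i)
  choose x hx₀ hx using hlift
  have : Inhabited (Fin n ⊕ Fin (s - 1)) := ⟨Sum.inl ⟨0, by omega⟩⟩
  obtain ⟨a, w, hw, hsep⟩ := exists_separators η hηinj
  have hξ : ∀ i t, PowerSeries.X * aeval (x i) (P t) =
      (1 + PowerSeries.X) * aeval (x i) (f t) := fun i t => by
    have h1 := hx i t
    rw [eval_deform] at h1
    linear_combination - h1
  have hA := one_le_affineForms (k := k) (Sum.inl : Fin n → Fin n ⊕ Fin (s - 1))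
  have hB := one_le_affineForms (k := k) (Sum.inr : Fin (s - 1) → Fin n ⊕ Fin (s - 1))
  have hA' := affineForms_fg (k := k) (Sum.inl : Fin n → Fin n ⊕ Fin (s - 1))
  have hB' := affineForms_fg (k := k) (Sum.inr : Fin (s - 1) → Fin n ⊕ Fin (s - 1))
  have hmat := det_powerSeries_eq_zero_of_covers hA hB hA' hB' hf hP (fun i => aeval (x i)) hξ w hw
  have hdiag := congrArg (PowerSeries.constantCoeff (R := k)) hmat
  rw [map_zero, RingHom.map_det] at hdiag
  have : (PowerSeries.constantCoeff (R := k)).mapMatrix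
      (Matrix.of fun i j => (aeval (x i) (w j) : PowerSeries k)) =
      Matrix.diagonal fun i => eval (η i) (w i) := by
    ext i j
    have : PowerSeries.constantCoeff (aeval (x i) (w j)) = eval (η i) (w j) := by
      rw [aeval_def, eval₂_eq_eval_map, ← MvPolynomial.eval_map_comp, MvPolynomial.map_map]
      simp only [hx₀]
      congr 1
      exact (map_id _)
    rw [RingHom.mapMatrix_apply, Matrix.map_apply, Matrix.of_apply, this, Matrix.diagonal_apply]
    split_ifs with h
    · rw [h]
    · exact (hsep i j).2 h
  rw [this, Matrix.det_diagonal, Finset.prod_eq_zero_iff] at hdiag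
  obtain ⟨i, -, hi⟩ := hdiag
  exact (hsep i i).1 hi rfl

end Deformation

section Dehomogenization
variable {K : Type*} [Field K] {n s : ℕ}

/-- Substitution of `1` for the last variable `μ_s`. -/
noncomputable def dehomogenize :
    MvPolynomial (Fin n ⊕ Fin s) K →ₐ[K] MvPolynomial (Fin n ⊕ Fin (s - 1)) K :=
  aeval (ptExt (fun j => X (Sum.inl j)) fun l => X (Sum.inr l))

/-- The system in the variables `(x, μ₁, …, μ_{s-1})` as a single family of polynomials. -/
noncomputable def affineSystem (g : Fin s → MvPolynomial (Fin n) K)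
    (g' : Fin (n - 1) → MvPolynomial (Fin n ⊕ Fin s) K) :
    Fin s ⊕ Fin (n - 1) → MvPolynomial (Fin n ⊕ Fin (s - 1)) K :=
  Sum.elim (fun i => rename Sum.inl (g i)) fun i => dehomogenize (g' i)

lemma map_ptExt {R R' F : Type*} [CommRing R] [CommRing R'] [FunLike F R R'] [RingHomClass F R R']
    (φ : F) (x : Fin n → R) (μ : Fin (s - 1) → R) (i : Fin n ⊕ Fin s) :
    φ (ptExt x μ i) = ptExt (fun j => φ (x j)) (fun l => φ (μ l)) i := by
  rcases i with j | l
  · rfl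
  · simp only [ptExt, Sum.elim_inr]
    split_ifs
    · rfl
    · exact map_one φ

lemma aeval_dehomogenize {R : Type*} [CommRing R] [Algebra K R] (x : Fin n → R)
    (μ : Fin (s - 1) → R) (p : MvPolynomial (Fin n ⊕ Fin s) K) :
    aeval (Sum.elim x μ) (dehomogenize p) = aeval (ptExt x μ) p := by
  rw [dehomogenize, ← AlgHom.comp_apply, comp_aeval]
  congr 2
  ext i
  rw [map_ptExt]
  simp

lemma pderiv_dehomogenize (v : Fin n ⊕ Fin (s - 1)) (p : MvPolynomial (Fin n ⊕ Fin s) K) :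
    pderiv v (dehomogenize p) =
      dehomogenize (pderiv (Sum.map id (Fin.castLE (Nat.sub_le s 1)) v) p) := by
  have hX : ∀ i, pderiv v (dehomogenize (K := K) (X i)) =
      dehomogenize (pderiv (Sum.map id (Fin.castLE (Nat.sub_le s 1)) v) (X i)) := by
    intro i
    rw [pderiv_X, dehomogenize, aeval_X]
    rcases i with j | l
    · rcases v with j' | l' <;> simp [ptExt, pderiv_X, Pi.single_apply, apply_ite]
    · by_cases h : (l : ℕ) < s - 1
      · rcases v with j' | l' <;> simp [ptExt, pderiv_X, Pi.single_apply, h, apply_ite, Fin.ext_iff]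
      · rcases v with j' | l'
        · simp [ptExt, h]
        · have : (l : ℕ) ≠ l' := by have := l'.2; omega
          simp [ptExt, h, Fin.ext_iff, this]
  induction p using MvPolynomial.induction_on with
  | C a => simp [dehomogenize]
  | add p q hp hq => simp [hp, hq]
  | mul_X p i hp => simp only [map_mul, Derivation.leibniz, smul_eq_mul, hp, hX, map_add]

lemma mem_Sols0_iff {R : Type*} [CommRing R] [Algebra K R] (g : Fin s → MvPolynomial (Fin n) K)
    (g' : Fin (n - 1) → MvPolynomial (Fin n ⊕ Fin s) K) (p : (Fin n → R) × (Fin (s - 1) → R)) :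
    p ∈ Sols0 R g g' ↔ ∀ t, aeval (Sum.elim p.1 p.2) (affineSystem g g' t) = 0 := by
  simp [Sols0, affineSystem, aeval_dehomogenize, aeval_rename, Function.comp_def]

lemma mem_SolsF_iff {R : Type*} [CommRing R] [Algebra K R] (c : R)
    (h g : Fin s → MvPolynomial (Fin n) K)
    (h' g' : Fin (n - 1) → MvPolynomial (Fin n ⊕ Fin s) K) (p : (Fin n → R) × (Fin (s - 1) → R)) :
    p ∈ SolsF R c h g h' g' ↔ ∀ t, eval (Sum.elim p.1 p.2)
      (deform R c (affineSystem h h' t) (affineSystem g g' t)) = 0 := by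
  simp [SolsF, affineSystem, eval_deform, aeval_dehomogenize, aeval_rename, Function.comp_def]

lemma jacMat_eq {R : Type*} [CommRing R] [Algebra K R] (g : Fin s → MvPolynomial (Fin n) K)
    (g' : Fin (n - 1) → MvPolynomial (Fin n ⊕ Fin s) K)
    (e : (Fin s ⊕ Fin (n - 1)) ≃ (Fin n ⊕ Fin (s - 1))) (x : Fin n → R) (μ : Fin (s - 1) → R) :
    jacMat R g g' e x μ = Matrix.of fun t t' =>
      aeval (Sum.elim x μ) (pderiv (e t') (affineSystem g g' t)) := by
  ext t t'
  simp only [jacMat, Matrix.of_apply]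
  rcases t with i | i
  · simp only [affineSystem, Sum.elim_inl]
    rcases e t' with j | l
    · simp [pderiv_rename Sum.inl_injective, aeval_rename, Function.comp_def]
    · have : pderiv (Sum.inr l) (rename Sum.inl (g i)) =
          (0 : MvPolynomial (Fin n ⊕ Fin (s - 1)) K) := by
        apply pderiv_eq_zero_of_notMem_vars
        intro hl
        have := vars_rename Sum.inl (g i) hl
        simp at this
      simp [this]
  · simp only [affineSystem, Sum.elim_inr, pderiv_dehomogenize, aeval_dehomogenize]
    rcases e t' with j | l <;> rfl

lemma prod_pow_mem_pow {k S α : Type*} [Field k] [CommRing S] [Algebra k S] {A : Submodule k S}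
    (T : Finset α) (x : α → S) (m : α → ℕ) (hx : ∀ i ∈ T, x i ∈ A) :
    ∏ i ∈ T, x i ^ m i ∈ A ^ ∑ i ∈ T, m i := by
  classical
  induction T using Finset.induction_on with
  | empty => simpa using ⟨1, map_one _⟩
  | insert i T hi ih =>
    rw [Finset.prod_insert hi, Finset.sum_insert hi, pow_add]
    exact Submodule.mul_mem_mul (Submodule.pow_mem_pow _ (hx i (Finset.mem_insert_self _ _)) _)
      (ih fun j hj => hx j (Finset.mem_insert_of_mem hj))

lemma aeval_mem_of_support {k S α : Type*} [Field k] [Algebra K k] [CommRing S] [Algebra k S]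
    [Algebra K S] [IsScalarTower K k S] [Fintype α] (V : Submodule k S) (v : α → S)
    (p : MvPolynomial α K) (h : ∀ m ∈ p.support, ∏ i, v i ^ m i ∈ V) : aeval v p ∈ V := by
  rw [aeval_def, eval₂_eq']
  refine sum_mem fun m hm => ?_
  rw [IsScalarTower.algebraMap_apply K k S, ← Algebra.smul_def]
  exact V.smul_mem _ (h m hm)

lemma map_affineSystem_mem {k : Type*} [Field k] [Algebra K k] (g : Fin s → MvPolynomial (Fin n) K)
    (g' : Fin (n - 1) → MvPolynomial (Fin n ⊕ Fin s) K) (d : Fin s → ℕ) (d' : Fin (n - 1) → ℕ)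
    (hg : ∀ i, (g i).totalDegree ≤ d i)
    (hg'x : ∀ i, ∀ mon ∈ (g' i).support, (∑ j : Fin n, mon (Sum.inl j)) ≤ d' i)
    (hg'mu : ∀ i, ∀ mon ∈ (g' i).support, (∑ l : Fin s, mon (Sum.inr l)) = 1)
    (t : Fin s ⊕ Fin (n - 1)) :
    map (algebraMap K k) (affineSystem g g' t) ∈
      gradedPiece (affineForms k Sum.inl) (affineForms k Sum.inr) (systemDegree d d' t) := by
  have hA := one_le_affineForms (k := k) (Sum.inl : Fin n → Fin n ⊕ Fin (s - 1))
  have hB := one_le_affineForms (k := k) (Sum.inr : Fin (s - 1) → Fin n ⊕ Fin (s - 1))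
  have hmap : ∀ p : MvPolynomial (Fin n ⊕ Fin (s - 1)) K, map (algebraMap K k) p =
      aeval (Sum.elim (fun j => X (Sum.inl j)) fun l => X (Sum.inr l)) p := by
    have : mapAlgHom (Algebra.ofId K k) =
        aeval (Sum.elim (fun j : Fin n => X (R := k) (Sum.inl j))
          fun l : Fin (s - 1) => X (Sum.inr l)) :=
      algHom_ext fun i => by rcases i with j | l <;> simp
    exact fun p => AlgHom.congr_fun this p
  rw [hmap]
  rcases t with i | i
  · simp only [affineSystem, systemDegree, Sum.elim_inl, aeval_rename, gradedPiece, pow_zero,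
      mul_one]
    refine aeval_mem_of_support (k := k) _ _ _ fun m hm => ?_
    refine Submodule.pow_mono_of_one_le hA ?_
      (prod_pow_mem_pow _ _ _ fun j _ => X_mem_affineForms _ _)
    refine le_trans ?_ (hg i)
    simpa [Finsupp.sum_fintype] using le_totalDegree hm
  · simp only [affineSystem, systemDegree, Sum.elim_inr, aeval_dehomogenize, gradedPiece]
    refine aeval_mem_of_support (k := k) _ _ _ fun m hm => ?_
    rw [Fintype.prod_sum_type]
    refine Submodule.mul_mem_mul ?_ ?_
    · exact Submodule.pow_mono_of_one_le hA (hg'x i m hm)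
        (prod_pow_mem_pow _ _ _ fun j _ => X_mem_affineForms _ _)
    · refine Submodule.pow_mono_of_one_le hB (hg'mu i m hm).le
        (prod_pow_mem_pow _ _ _ fun l _ => ?_)
      simp only [ptExt, Sum.elim_inr]
      split_ifs
      · exact X_mem_affineForms _ _
      · exact one_mem_affineForms _

lemma deform_mem {k α : Type*} [Field k] [Algebra K k] (V : Submodule k (MvPolynomial α k)) (c : k)
    (p q : MvPolynomial α K) (hp : map (algebraMap K k) p ∈ V) (hq : map (algebraMap K k) q ∈ V) :
    deform k c p q ∈ V := by
  rw [deform, ← smul_eq_C_mul, ← smul_eq_C_mul]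
  exact add_mem (V.smul_mem _ hp) (V.smul_mem _ hq)

end Dehomogenization

section Specialization

/-- A point over an extension field specializes to an algebraically closed field, preserving
polynomial equations and one inequation. -/
lemma exists_specialization {F Ω M σ : Type*} [Field F] [Field Ω] [Field M] [IsAlgClosed M]
    [Algebra F Ω] [Algebra F M] [Finite σ] (v : σ → Ω) (N : MvPolynomial σ F)
    (hN : aeval v N ≠ 0) :
    ∃ y : σ → M, (∀ p : MvPolynomial σ F, aeval v p = 0 → aeval y p = 0) ∧ aeval y N ≠ 0 := by
  set B := Algebra.adjoin F (insert (aeval v N)⁻¹ (Set.range v)) with hB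
  have hv : ∀ i, v i ∈ B := fun i =>
    Algebra.subset_adjoin (Set.mem_insert_of_mem _ ⟨i, rfl⟩)
  let b : σ → B := fun i => ⟨v i, hv i⟩
  let N' : B := ⟨(aeval v N)⁻¹, Algebra.subset_adjoin (Set.mem_insert _ _)⟩
  have hb : ∀ p : MvPolynomial σ F, (aeval b p : B) = aeval v p := fun p => by
    rw [← Subalgebra.coe_val, ← AlgHom.comp_apply, comp_aeval]
    rfl
  have : Algebra.FiniteType F B := Subalgebra.fg_iff_finiteType _ |>.1
    (Subalgebra.fg_def.2 ⟨_, (Set.finite_range v).insert _, rfl⟩)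
  obtain ⟨m, hm⟩ := Ideal.exists_maximal B
  let _ := Ideal.Quotient.field m
  have : Algebra.FiniteType F (B ⧸ m) :=
    Algebra.FiniteType.of_surjective (Ideal.Quotient.mkₐ F m) (Ideal.Quotient.mkₐ_surjective F m)
  have : Module.Finite F (B ⧸ m) := finite_of_finite_type_of_isJacobsonRing F (B ⧸ m)
  let φ : B →ₐ[F] M := (IsAlgClosed.lift (R := F) (S := B ⧸ m) (M := M)).comp
    (Ideal.Quotient.mkₐ F m)
  have hφ : ∀ p : MvPolynomial σ F, aeval (fun i => φ (b i)) p = φ (aeval b p) := fun p => by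
    rw [← AlgHom.comp_apply, comp_aeval]
  refine ⟨fun i => φ (b i), fun p hp => ?_, ?_⟩
  · rw [hφ, Subtype.ext (hb p |>.trans hp : _ = ((0 : B) : Ω)), map_zero]
  · rw [hφ]
    have h1 : aeval b N * N' = 1 := Subtype.ext (by simp [hb, N', hN])
    intro h0
    have := congrArg φ h1
    rw [map_mul, h0, zero_mul, map_one] at this
    exact zero_ne_one this

lemma aeval_det_rename {F R α ι τ : Type*} [Field F] [CommRing R] [Algebra F R] [Fintype τ]
    [DecidableEq τ] (y : α × ι → R) (i : α) (A : τ → τ → MvPolynomial ι F) :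
    aeval y (Matrix.of fun t t' => rename (Prod.mk i) (A t t')).det =
      (Matrix.of fun t t' => aeval (fun l => y (i, l)) (A t t')).det := by
  rw [AlgHom.map_det]
  congr 1
  ext t t'
  simp [aeval_rename, Function.comp_def]

/-- Nondegenerate solutions with separated coordinates over some extension field yield as many
such solutions over any algebraically closed extension. -/
lemma exists_solutions_specialization {F Ω M ι τ κ : Type*} [Field F] [Field Ω] [Field M]
    [IsAlgClosed M] [Algebra F Ω] [Algebra F M] [Finite ι] [Fintype τ] [DecidableEq τ]
    (e : τ ≃ ι) (v : κ → ι) (G : τ → MvPolynomial ι F) {D : ℕ} (x : Fin D → ι → Ω)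
    (hx : ∀ i t, aeval (x i) (G t) = 0)
    (hJ : ∀ i, (Matrix.of fun t t' => aeval (x i) (pderiv (e t') (G t))).det ≠ 0)
    (hsep : ∀ i j, i ≠ j → ∃ l, x i (v l) ≠ x j (v l)) :
    ∃ y : Fin D → ι → M, (∀ i t, aeval (y i) (G t) = 0) ∧
      (∀ i, (Matrix.of fun t t' => aeval (y i) (pderiv (e t') (G t))).det ≠ 0) ∧
      ∀ i j, i ≠ j → ∃ l, y i (v l) ≠ y j (v l) := by
  classical
  have hsep' : ∀ q : Fin D × Fin D, ∃ S : MvPolynomial (Fin D × ι) F,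
      aeval (fun r => x r.1 r.2) S ≠ 0 ∧ ∀ y : Fin D × ι → M, aeval y S ≠ 0 →
        q.1 ≠ q.2 → ∃ l, y (q.1, v l) ≠ y (q.2, v l) := by
    rintro ⟨i, j⟩
    by_cases h : i = j
    · exact ⟨1, by simp, fun _ _ h' => (h' h).elim⟩
    · obtain ⟨l, hl⟩ := hsep i j h
      exact ⟨X (i, v l) - X (j, v l), by simpa [sub_eq_zero] using hl,
        fun y hy _ => ⟨l, by simpa [sub_eq_zero] using hy⟩⟩
  choose S hS hSsep using hsep'
  let J : Fin D → MvPolynomial (Fin D × ι) F := fun i =>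
    (Matrix.of fun t t' => rename (Prod.mk i) (pderiv (e t') (G t))).det
  obtain ⟨y, hy, hyN⟩ := exists_specialization (M := M) (fun r : Fin D × ι => x r.1 r.2)
    ((∏ i, J i) * ∏ q, S q) (by
      rw [map_mul, map_prod, map_prod, mul_ne_zero_iff, Finset.prod_ne_zero_iff,
        Finset.prod_ne_zero_iff]
      refine ⟨fun i _ => ?_, fun q _ => hS q⟩
      rw [aeval_det_rename]
      exact hJ i)
  rw [map_mul, map_prod, map_prod, mul_ne_zero_iff, Finset.prod_ne_zero_iff,
    Finset.prod_ne_zero_iff] at hyN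
  refine ⟨fun i l => y (i, l), fun i t => ?_, fun i => ?_, fun i j => ?_⟩
  · have := hy (rename (Prod.mk i) (G t)) (by rw [aeval_rename]; exact hx i t)
    rwa [aeval_rename] at this
  · have := hyN.1 i (Finset.mem_univ _)
    rwa [aeval_det_rename] at this
  · exact hSsep (i, j) y (hyN.2 _ (Finset.mem_univ _))

variable {K L : Type*} [Field K] [Field L] [Algebra K L]

lemma PowerSeries.transcendental_one_add_X :
    Transcendental K (1 + PowerSeries.X : PowerSeries L) := by
  intro h
  have h1 : IsAlgebraic K (PowerSeries.X : PowerSeries L) := by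
    simpa using h.sub (isAlgebraic_one (R := K) (A := PowerSeries L))
  exact PowerSeries.transcendental_X (h1.extendScalars (algebraMap K L).injective)

/-- Nondegenerate solutions of a system lift to nondegenerate solutions of its deformations. -/
lemma exists_deformed_solutions {Ω ι τ κ : Type*} [Field Ω] [Algebra (PowerSeries L) Ω]
    [IsFractionRing (PowerSeries L) Ω] [Algebra K Ω] [IsScalarTower K (PowerSeries L) Ω]
    [Fintype ι] [Fintype τ] [DecidableEq τ] (e : τ ≃ ι) (v : κ → ι) (p q : τ → MvPolynomial ι K)
    {D : ℕ} (x₀ : Fin D → ι → L) (hx₀ : ∀ i t, aeval (x₀ i) (q t) = 0)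
    (hJ : ∀ i, (Matrix.of fun t t' => aeval (x₀ i) (pderiv (e t') (q t))).det ≠ 0)
    (hsep : ∀ i j, i ≠ j → ∃ l, x₀ i (v l) ≠ x₀ j (v l)) :
    ∃ x : Fin D → ι → Ω,
      (∀ i t, eval (x i) (deform Ω (algebraMap (PowerSeries L) Ω (1 + PowerSeries.X))
        (p t) (q t)) = 0) ∧
      (∀ i, (Matrix.of fun t t' => eval (x i) (pderiv (e t')
        (deform Ω (algebraMap (PowerSeries L) Ω (1 + PowerSeries.X)) (p t) (q t)))).det ≠ 0) ∧
      ∀ i j, i ≠ j → ∃ l, x i (v l) ≠ x j (v l) := by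
  choose x hxx₀ hx using fun i => exists_root_deform e p q (x₀ i) (hx₀ i) (hJ i)
  have hinj : Function.Injective (algebraMap (PowerSeries L) Ω) := IsFractionRing.injective _ _
  have hdef : ∀ t, deform Ω (algebraMap (PowerSeries L) Ω (1 + PowerSeries.X)) (p t) (q t) =
      map (algebraMap (PowerSeries L) Ω)
        (deform (PowerSeries L) (1 + PowerSeries.X) (p t) (q t)) := fun t =>
    (map_deform (IsScalarTower.toAlgHom K (PowerSeries L) Ω) _ _ _).symm
  refine ⟨fun i l => algebraMap (PowerSeries L) Ω (x i l), fun i t => ?_, fun i hdet => hJ i ?_,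
    fun i j hij => ?_⟩
  · rw [hdef, MvPolynomial.eval_map_comp, hx, map_zero]
  · have h1 : (Matrix.of fun t t' => eval (x i) (pderiv (e t')
        (deform (PowerSeries L) (1 + PowerSeries.X) (p t) (q t)))).det = 0 := by
      apply hinj
      rw [map_zero, ← hdet, RingHom.map_det]
      congr 1
      ext t t'
      simp only [RingHom.mapMatrix_apply, Matrix.map_apply, Matrix.of_apply, hdef, pderiv_map]
      rw [MvPolynomial.eval_map_comp]
    have h2 := congrArg (PowerSeries.constantCoeff (R := L)) h1
    rw [map_zero, RingHom.map_det] at h2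
    rw [← h2]
    congr 1
    ext t t'
    simp only [RingHom.mapMatrix_apply, Matrix.map_apply, Matrix.of_apply]
    rw [← MvPolynomial.eval_map_comp, ← pderiv_map, map_constantCoeff_deform, pderiv_map,
      funext (hxx₀ i), aeval_def, eval_map]
  · obtain ⟨l, hl⟩ := hsep i j hij
    refine ⟨l, fun h => hl ?_⟩
    rw [← hxx₀, ← hxx₀, hinj h]

/-- The homomorphism `K(t) → Ω` sending `t` to `c`, for `c` transcendental. -/
lemma exists_ratFunc_algHom {Ω : Type*} [Field Ω] [Algebra K Ω] {c : Ω} (hc : Transcendental K c) :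
    ∃ φ : RatFunc K →ₐ[K] Ω, φ RatFunc.X = c := by
  refine ⟨IsFractionRing.liftAlgHom (A := Polynomial K) (K := RatFunc K)
    (transcendental_iff_injective.1 hc), ?_⟩
  rw [← RatFunc.algebraMap_X, IsFractionRing.liftAlgHom_apply, IsFractionRing.lift_algebraMap]
  simp

lemma exists_deformed_solutions_of_algHom {Ω M ι τ κ : Type*} [Field Ω]
    [Algebra (PowerSeries L) Ω] [IsFractionRing (PowerSeries L) Ω] [Algebra K Ω]
    [IsScalarTower K (PowerSeries L) Ω] [Field M] [IsAlgClosed M] [Algebra K M]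
    [Algebra (RatFunc K) M] [IsScalarTower K (RatFunc K) M] [Fintype ι] [Fintype τ]
    [DecidableEq τ] (e : τ ≃ ι) (v : κ → ι) (p q : τ → MvPolynomial ι K)
    (φ : RatFunc K →ₐ[K] Ω)
    (hφ : φ RatFunc.X = algebraMap (PowerSeries L) Ω (1 + PowerSeries.X))
    {D : ℕ} (x₀ : Fin D → ι → L) (hx₀ : ∀ i t, aeval (x₀ i) (q t) = 0)
    (hJ : ∀ i, (Matrix.of fun t t' => aeval (x₀ i) (pderiv (e t') (q t))).det ≠ 0)
    (hsep : ∀ i j, i ≠ j → ∃ l, x₀ i (v l) ≠ x₀ j (v l)) :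
    ∃ y : Fin D → ι → M,
      (∀ i t, eval (y i) (deform M (algebraMap (RatFunc K) M RatFunc.X) (p t) (q t)) = 0) ∧
      (∀ i, (Matrix.of fun t t' => eval (y i) (pderiv (e t')
        (deform M (algebraMap (RatFunc K) M RatFunc.X) (p t) (q t)))).det ≠ 0) ∧
      ∀ i j, i ≠ j → ∃ l, y i (v l) ≠ y j (v l) := by
  obtain ⟨x, hx, hxJ, hxsep⟩ := exists_deformed_solutions (Ω := Ω) e v p q x₀ hx₀ hJ hsep
  let _ : Algebra (RatFunc K) Ω := φ.toRingHom.toAlgebra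
  have hΩ : ∀ t, map (algebraMap (RatFunc K) Ω) (deform (RatFunc K) RatFunc.X (p t) (q t)) =
      deform Ω (algebraMap (PowerSeries L) Ω (1 + PowerSeries.X)) (p t) (q t) := fun t => by
    rw [← hφ]
    exact map_deform φ _ _ _
  have hM : ∀ t, map (algebraMap (RatFunc K) M) (deform (RatFunc K) RatFunc.X (p t) (q t)) =
      deform M (algebraMap (RatFunc K) M RatFunc.X) (p t) (q t) := fun t =>
    map_deform (IsScalarTower.toAlgHom K (RatFunc K) M) _ _ _
  simp only [← hΩ, pderiv_map, eval_map, ← aeval_def] at hx hxJ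
  simp only [← hM, pderiv_map, eval_map, ← aeval_def]
  exact exists_solutions_specialization e v _ x hx hxJ hxsep

end Specialization

/-- Nondegenerate solutions of a system over `L` yield as many nondegenerate solutions of its
deformation over an algebraically closed extension of the rational function field. -/
lemma exists_deformed_solutions_ratFunc {K L M ι τ κ : Type*} [Field K] [Field L] [Algebra K L]
    [Field M] [IsAlgClosed M] [Algebra K M] [Algebra (RatFunc K) M] [IsScalarTower K (RatFunc K) M]
    [Fintype ι] [Fintype τ] [DecidableEq τ] (e : τ ≃ ι) (v : κ → ι) (p q : τ → MvPolynomial ι K)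
    {D : ℕ} (x₀ : Fin D → ι → L) (hx₀ : ∀ i t, aeval (x₀ i) (q t) = 0)
    (hJ : ∀ i, (Matrix.of fun t t' => aeval (x₀ i) (pderiv (e t') (q t))).det ≠ 0)
    (hsep : ∀ i j, i ≠ j → ∃ l, x₀ i (v l) ≠ x₀ j (v l)) :
    ∃ y : Fin D → ι → M,
      (∀ i t, eval (y i) (deform M (algebraMap (RatFunc K) M RatFunc.X) (p t) (q t)) = 0) ∧
      (∀ i, (Matrix.of fun t t' => eval (y i) (pderiv (e t')
        (deform M (algebraMap (RatFunc K) M RatFunc.X) (p t) (q t)))).det ≠ 0) ∧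
      ∀ i j, i ≠ j → ∃ l, y i (v l) ≠ y j (v l) := by
  obtain ⟨φ, hφ⟩ := exists_ratFunc_algHom (K := K) ((transcendental_algebraMap_iff
    (IsFractionRing.injective (PowerSeries L) (FractionRing (PowerSeries L)))).2
    (PowerSeries.transcendental_one_add_X (K := K) (L := L)))
  exact exists_deformed_solutions_of_algHom e v p q φ hφ x₀ hx₀ hJ hsep

theorem statement15 (K : Subfield ℝ)
    (L : Type*) [Field L] [Algebra ↥K L] [IsAlgClosure ↥K L]
    (M : Type*) [Field M] [Algebra ↥K M] [Algebra (RatFunc ↥K) M]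
    [IsScalarTower ↥K (RatFunc ↥K) M] [IsAlgClosure (RatFunc ↥K) M]
    (n s : ℕ) (hn : 3 ≤ n) (hs : 2 ≤ s) (hsn : s ≤ n - 1)
    (d : Fin s → ℕ) (d' : Fin (n - 1) → ℕ) (hd : ∀ i, 0 < d i) (hd' : ∀ i, 0 < d' i)
    (h g : Fin s → MvPolynomial (Fin n) ↥K)
    (h' g' : Fin (n - 1) → MvPolynomial (Fin n ⊕ Fin s) ↥K)
    (hhdeg : ∀ i, (h i).totalDegree ≤ d i)
    (hgdeg : ∀ i, (g i).totalDegree = d i)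
    (hh'x : ∀ i, ∀ mon ∈ (h' i).support, (∑ j : Fin n, mon (Sum.inl j)) ≤ d' i)
    (hh'mu : ∀ i, ∀ mon ∈ (h' i).support, (∑ k : Fin s, mon (Sum.inr k)) = 1)
    (hg'xle : ∀ i, ∀ mon ∈ (g' i).support, (∑ j : Fin n, mon (Sum.inl j)) ≤ d' i)
    (hg'xeq : ∀ i, ∃ mon ∈ (g' i).support, (∑ j : Fin n, mon (Sum.inl j)) = d' i)
    (hg'mu : ∀ i, ∀ mon ∈ (g' i).support, (∑ k : Fin s, mon (Sum.inr k)) = 1)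
    (D : ℕ)
    (hD : D = (∏ i, d i) *
      ∑ E ∈ Finset.powersetCard (n - s) (Finset.univ : Finset (Fin (n - 1))),
        ∏ j ∈ E, d' j)
    (e : (Fin s ⊕ Fin (n - 1)) ≃ (Fin n ⊕ Fin (s - 1)))
    -- condition (H) on the initial system
    (hHfin : (Sols0 L g g').Finite)
    (hHcard : (Sols0 L g g').ncard = D)
    (hHinj : ∀ p ∈ Sols0 L g g', ∀ q ∈ Sols0 L g g', p.1 = q.1 → p = q)
    (hHjac : ∀ p ∈ Sols0 L g g', (jacMat L g g' e p.1 p.2).det ≠ 0) :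
    (SolsF M (algebraMap (RatFunc ↥K) M RatFunc.X) h g h' g').Finite ∧
    (SolsF M (algebraMap (RatFunc ↥K) M RatFunc.X) h g h' g').ncard = D ∧
    ∀ p ∈ SolsF M (algebraMap (RatFunc ↥K) M RatFunc.X) h g h' g',
      ∀ q ∈ SolsF M (algebraMap (RatFunc ↥K) M RatFunc.X) h g h' g',
        p.1 = q.1 → p = q := by
  set c := algebraMap (RatFunc ↥K) M RatFunc.X
  have : IsAlgClosed M := IsAlgClosure.isAlgClosed (RatFunc ↥K)
  have : CharZero M := charZero_of_injective_algebraMap (algebraMap ↥K M).injective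
  have : Finite (Sols0 L g g') := hHfin
  let E : Fin D ≃ Sols0 L g g' := (Finite.equivFinOfCardEq hHcard).symm
  have hE : ∀ i, (E i : (Fin n → L) × (Fin (s - 1) → L)) ∈ Sols0 L g g' := fun i => (E i).2
  obtain ⟨y, hy, hyJ, hysep⟩ := exists_deformed_solutions_ratFunc (M := M) e Sum.inl
    (affineSystem h h') (affineSystem g g') (fun i => Sum.elim (E i).1.1 (E i).1.2)
    (fun i => (mem_Sols0_iff g g' _).1 (hE i))
    (fun i => by rw [← jacMat_eq]; exact hHjac _ (hE i))
    (fun i j hij => by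
      refine Function.ne_iff.1 fun h1 => hij (E.injective (Subtype.ext ?_))
      exact hHinj _ (hE i) _ (hE j) h1)
  let pt : Fin D → (Fin n → M) × (Fin (s - 1) → M) := fun i => (y i ∘ Sum.inl, y i ∘ Sum.inr)
  have hfst : ∀ i j, (pt i).1 = (pt j).1 → i = j := fun i j hij => by
    by_contra hne
    obtain ⟨l, hl⟩ := hysep i j hne
    exact hl (congrFun hij l)
  have hrange : SolsF M c h g h' g' = Set.range pt := by
    ext p
    rw [mem_SolsF_iff]
    constructor
    · intro hp
      obtain ⟨i, hi⟩ := mem_range_of_nondegenerate_solutions hs hsn d d' hd hd' e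
        (fun t => deform M c (affineSystem h h' t) (affineSystem g g' t))
        (fun t => deform_mem _ _ _ _ (map_affineSystem_mem h h' d d' hhdeg hh'x hh'mu t)
          (map_affineSystem_mem g g' d d' (fun i => (hgdeg i).le) hg'xle hg'mu t))
        hD y (fun i j hij => hfst i j (by simp only [pt, hij])) hy hyJ _ hp
      refine ⟨i, ?_⟩
      simp only [pt, hi, Sum.elim_comp_inl, Sum.elim_comp_inr]
    · rintro ⟨i, rfl⟩ t
      simpa only [pt, Sum.elim_comp_inl_inr] using hy i t
  rw [hrange]
  refine ⟨Set.finite_range pt, ?_, ?_⟩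
  · rw [Set.ncard_range_of_injective fun i j hij => hfst i j (by rw [hij]), Nat.card_fin]
  · rintro _ ⟨i, rfl⟩ _ ⟨j, rfl⟩ hij
    rw [hfst i j hij]
end

section
/- In the setting of the previous deformation: let K be a subfield of ℝ, 2 ≤ s ≤ n−1, r = s+n−1, h_1,…,h_s ∈ K[x_1,…,x_n] with deg h_i ≤ d_i, h_{s+1},…,h_r ∈ K[x,μ] with deg_x h_i ≤ d_i and homogeneous of degree 1 in μ, and g_1,…,g_r an initial system satisfying condition (H) with deg_x g_i = d_i, F_i = (1−t)h_i + t g_i, and D = (∏_{i=1}^{s} d_i)·(∑_{E ⊆ {s+1,…,r}, #E=n−s} ∏_{j∈E} d_j). Let S_1,…,S_D ∈ M^n × M^{s−1} be the D solutions of the system F_1 = … = F_s = 0, F_{s+1}(t,x,μ',1) = … = F_r(t,x,μ',1) = 0 over an algebraic closure M of K(t), and write (S_i)_1,…,(S_i)_n for the x-coordinates of S_i. Let y_1,…,y_n, U be new variables and P(U,y) = ∏_{i=1}^{D} (U − ∑_{j=1}^{n} y_j (S_i)_j). Then P has coefficients in K(t), and if P̂ ∈ K[t,U,y_1,…,y_n]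 and q ∈ K[t] satisfy q·P = P̂ and P̂ has no nonconstant factor belonging to K[t], then the degree of P̂ in the variable t is at most n·D. -/
set_option synthInstance.maxHeartbeats 1000000
set_option maxHeartbeats 1000000

open MvPolynomial

section

open scoped Pointwise

universe w

section Lift

variable {κ : Type*} [Finite κ] {M : Type*} [Field M]

/-- Translation of the coordinates, carrying the point `y` to the point `x`. -/
noncomputable def translateEquiv (v : κ → M) : MvPolynomial κ M ≃ₐ[M] MvPolynomial κ M :=
  AlgEquiv.ofAlgHom (aeval fun i => X i + C (v i)) (aeval fun i => X i - C (v i))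
    (by ext i; simp) (by ext i; simp)

theorem card_le_height_vanishingIdeal_singleton [IsAlgClosed M] (x : κ → M) :
    (Nat.card κ : ℕ∞) ≤ (vanishingIdeal M {x} : Ideal (MvPolynomial κ M)).height := by
  have hdim : ringKrullDim (MvPolynomial κ M) = (Nat.card κ : ℕ∞) := by
    rw [MvPolynomial.ringKrullDim_of_isNoetherianRing]
    simp
  have : FiniteRingKrullDim (MvPolynomial κ M) := by
    rw [finiteRingKrullDim_iff_ne_bot_and_top]
    rw [hdim]
    constructor
    · simp
    · intro h
      have := WithBot.coe_injective h
      simp at this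
  obtain ⟨p, hp, hph⟩ := Ideal.exists_isMaximal_height (R := MvPolynomial κ M)
  obtain ⟨y, rfl⟩ := isMaximal_iff_eq_vanishingIdeal_singleton.1 hp
  have h1 : (vanishingIdeal M {y} : Ideal (MvPolynomial κ M)).height = (Nat.card κ : ℕ∞) := by
    rw [hdim] at hph
    exact WithBot.coe_injective hph
  rw [← h1]
  set e := (translateEquiv (x - y)).toRingEquiv
  have h2 : (vanishingIdeal M {x} : Ideal (MvPolynomial κ M)) =
      (vanishingIdeal M {y}).comap e := by
    ext f
    rw [Ideal.mem_comap, mem_vanishingIdeal_singleton_iff, mem_vanishingIdeal_singleton_iff]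
    have : aeval y (e f) = aeval x f := by
      change ((aeval y).comp (translateEquiv (x - y)).toAlgHom) f = _
      congr 1
      ext i
      simp [translateEquiv]
    rw [this]
  rw [h2, RingEquiv.height_comap]

theorem exists_prime_of_isolated_zero {σ ι : Type*} [Finite σ] [Finite ι] [IsAlgClosed M]
    (hcard : Nat.card ι ≤ Nat.card σ) (f : ι → MvPolynomial (Option σ) M) (S : σ → M)
    (hfin : {x : σ → M | ∀ i, aeval (fun o : Option σ => o.elim 0 x) (f i) = 0}.Finite)
    (hS : ∀ i, aeval (fun o : Option σ => o.elim 0 S) (f i) = 0) :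
    ∃ p : Ideal (MvPolynomial (Option σ) M), p.IsPrime ∧ (∀ i, f i ∈ p) ∧
      X none ∉ p ∧ ∀ q ∈ p, aeval (fun o : Option σ => o.elim 0 S) q = 0 := by
  set z : Option σ → M := fun o => o.elim 0 S with hz
  have hle : Ideal.span (Set.range f) ≤ vanishingIdeal M {z} := by
    rw [Ideal.span_le]
    rintro _ ⟨i, rfl⟩
    exact (mem_vanishingIdeal_singleton_iff _ _).2 (hS i)
  obtain ⟨p, hp, hpz⟩ := Ideal.exists_minimalPrimes_le hle
  have hpp : p.IsPrime := hp.1.1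
  have hfp : ∀ i, f i ∈ p := fun i => hp.1.2 (Ideal.subset_span ⟨i, rfl⟩)
  refine ⟨p, hpp, hfp, ?_, fun q hq => (mem_vanishingIdeal_singleton_iff _ _).1 (hpz hq)⟩
  intro hX
  have hZ : (zeroLocus M p).Finite := by
    refine (hfin.image (fun (x : σ → M) (o : Option σ) => o.elim 0 x)).subset ?_
    intro w hw
    have h0 : w none = 0 := by simpa using hw _ hX
    have hw' : (fun o : Option σ => o.elim 0 fun i => w (some i)) = w := by
      funext o
      cases o
      · exact h0.symm
      · rfl
    refine ⟨fun i => w (some i), fun i => ?_, hw'⟩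
    rw [hw']
    exact hw _ (hfp i)
  have hinf : hZ.toFinset.inf (fun w => vanishingIdeal M {w}) ≤ p := by
    refine le_trans ?_ (IsPrime.vanishingIdeal_zeroLocus (K := M) p).le
    intro q hq w hw
    have := (Finset.inf_le (f := fun w => vanishingIdeal M {w}) (hZ.mem_toFinset.2 hw)) hq
    exact (mem_vanishingIdeal_singleton_iff _ _).1 this
  obtain ⟨w, -, hwp⟩ := (hpp.inf_le').1 hinf
  have hwmax : (vanishingIdeal M {w} : Ideal (MvPolynomial (Option σ) M)).IsMaximal :=
    isMaximal_iff_eq_vanishingIdeal_singleton.2 ⟨w, rfl⟩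
  have hpmax : p = vanishingIdeal M {w} := (hwmax.eq_of_le hpp.ne_top hwp).symm
  have h1 := card_le_height_vanishingIdeal_singleton w
  rw [← hpmax] at h1
  have h2 : p.height ≤ (Set.range f).ncard :=
    Ideal.height_le_card_of_mem_minimalPrimes_span (Set.finite_range f) hp
  have h3 : (Set.range f).ncard ≤ Nat.card ι := by
    rw [← Set.image_univ, ← Set.ncard_univ]
    exact Set.ncard_image_le Set.finite_univ
  have h4 : Nat.card (Option σ) ≤ (Set.range f).ncard := by exact_mod_cast h1.trans h2
  rw [Finite.card_option] at h4
  omega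

end Lift

section HilbertBound

variable {K R : Type*} [Field K] [CommRing R] [Algebra K R]

/-- The multigraded piece of multidegree `u` of the algebra generated by the submodules `E l`. -/
noncomputable def multiPiece (E : Fin 3 → Submodule K R) (u : Fin 3 → ℕ) : Submodule K R :=
  ∏ l, E l ^ u l

theorem multiPiece_mul (E : Fin 3 → Submodule K R) (u v : Fin 3 → ℕ) :
    multiPiece E u * multiPiece E v = multiPiece E (u + v) := by
  simp only [multiPiece, ← Finset.prod_mul_distrib, Pi.add_apply, pow_add]

theorem multiPiece_single (E : Fin 3 → Submodule K R) (l : Fin 3) :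
    multiPiece E (Pi.single l 1) = E l := by
  fin_cases l <;> simp [multiPiece, Fin.prod_univ_three]

theorem single_mul_multiPiece (E : Fin 3 → Submodule K R) {l : Fin 3} {u : Fin 3 → ℕ}
    (h : Pi.single l 1 ≤ u) :
    E l * multiPiece E (u - Pi.single l 1) = multiPiece E u := by
  conv_lhs => enter [1]; rw [← multiPiece_single E l]
  rw [multiPiece_mul, add_tsub_cancel_of_le h]

/-- The part of multidegree `u` of the ideal generated by the `G i`, where `G i` has
multidegree `ω i`. -/
noncomputable def idealPiece {ι : Type*} (E : Fin 3 → Submodule K R) (G : ι → R)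
    (ω : ι → Fin 3 → ℕ) (u : Fin 3 → ℕ) : Submodule K R :=
  ⨆ i, Submodule.span K {G i} * multiPiece E (u - ω i)

/-- `p` of multidegree `e`, together with the family of submodules `rest`, cuts down the
multigraded pieces to dimension at most `∑ l, a l * (u l + 1)` for all large `u`. -/
def PieceBound (E : Fin 3 → Submodule K R) (rest : (Fin 3 → ℕ) → Submodule K R)
    (a : Fin 3 → ℕ) : Prop :=
  ∃ u₀ : Fin 3 → ℕ, ∀ u, u₀ ≤ u → ∃ c : Finset R,
    c.card ≤ ∑ l, a l * (u l + 1) ∧ multiPiece E u ≤ Submodule.span K c ⊔ rest u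

theorem PieceBound.mono_rest {E : Fin 3 → Submodule K R}
    {rest rest' : (Fin 3 → ℕ) → Submodule K R} {a : Fin 3 → ℕ}
    (h : PieceBound E rest a) (hr : ∀ u, rest u ≤ rest' u) : PieceBound E rest' a := by
  obtain ⟨u₀, h⟩ := h
  refine ⟨u₀, fun u hu => ?_⟩
  obtain ⟨c, hc, hle⟩ := h u hu
  exact ⟨c, hc, hle.trans (sup_le_sup_left (hr u) _)⟩

/-- The family `rest` is eventually stable under multiplication by the multigraded pieces. -/
def IdealLike (E : Fin 3 → Submodule K R) (rest : (Fin 3 → ℕ) → Submodule K R) : Prop :=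
  ∀ e, ∃ u₀ : Fin 3 → ℕ, ∀ u, u₀ ≤ u → multiPiece E e * rest (u - e) ≤ rest u

theorem idealLike_iSup {ι : Type*} [Finite ι] (E : Fin 3 → Submodule K R) (p : ι → Prop)
    (G : ι → R) (ω : ι → Fin 3 → ℕ) :
    IdealLike E fun u => ⨆ i, ⨆ _ : p i, Submodule.span K {G i} * multiPiece E (u - ω i) := by
  cases nonempty_fintype ι
  intro e
  refine ⟨e + ∑ i, ω i, fun u hu => ?_⟩
  simp only [Submodule.mul_iSup]
  refine iSup_mono fun i => iSup_mono fun _ => le_of_eq ?_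
  have h1 : ω i ≤ ∑ i, ω i :=
    Finset.single_le_sum (f := ω) (fun _ _ => zero_le) (Finset.mem_univ i)
  have h2 : e + (u - e - ω i) = u - ω i := by
    funext l
    have := hu l
    have := h1 l
    simp only [Pi.add_apply, Pi.sub_apply] at *
    omega
  rw [mul_left_comm, multiPiece_mul, h2]

theorem PieceBound.mul {E : Fin 3 → Submodule K R} {rest : (Fin 3 → ℕ) → Submodule K R}
    (hrest : IdealLike E rest) {p q : R} {e f a b : Fin 3 → ℕ} (hp : p ∈ multiPiece E e)
    (h₁ : PieceBound E (fun u => Submodule.span K {p} * multiPiece E (u - e) ⊔ rest u) a)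
    (h₂ : PieceBound E (fun u => Submodule.span K {q} * multiPiece E (u - f) ⊔ rest u) b) :
    PieceBound E (fun u => Submodule.span K {p * q} * multiPiece E (u - (e + f)) ⊔ rest u)
      (a + b) := by
  classical
  obtain ⟨u₁, h₁⟩ := h₁
  obtain ⟨u₂, h₂⟩ := h₂
  obtain ⟨u₃, h₃⟩ := hrest e
  refine ⟨u₁ ⊔ (u₂ + e) ⊔ u₃, fun u hu => ?_⟩
  have hu1 : u₁ ≤ u := (le_sup_left.trans le_sup_left).trans hu
  have hu2 : u₂ + e ≤ u := (le_sup_right.trans le_sup_left).trans hu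
  obtain ⟨c, hc, hcle⟩ := h₁ u hu1
  obtain ⟨c', hc', hcle'⟩ := h₂ (u - e) (le_tsub_of_add_le_right hu2)
  refine ⟨c ∪ c'.image (p * ·), ?_, ?_⟩
  · calc (c ∪ c'.image (p * ·)).card ≤ c.card + c'.card :=
        (Finset.card_union_le _ _).trans (Nat.add_le_add_left Finset.card_image_le _)
      _ ≤ (∑ l, a l * (u l + 1)) + ∑ l, b l * (u l + 1) := by
        refine Nat.add_le_add hc (hc'.trans (Finset.sum_le_sum fun l _ => ?_))
        exact Nat.mul_le_mul_left _ (Nat.succ_le_succ (Nat.sub_le _ _))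
      _ = _ := by rw [← Finset.sum_add_distrib]; simp [add_mul]
  · refine hcle.trans (sup_le ?_ (sup_le ?_ ?_))
    · refine le_sup_of_le_left (Submodule.span_mono ?_)
      simp
    · refine (mul_le_mul' le_rfl hcle').trans ?_
      rw [Submodule.mul_sup, Submodule.mul_sup]
      refine sup_le ?_ (sup_le ?_ ?_)
      · refine le_sup_of_le_left ?_
        rw [Submodule.span_mul_span]
        refine Submodule.span_mono ?_
        simp [Set.singleton_mul]
      · refine le_sup_of_le_right (le_sup_of_le_left (le_of_eq ?_))
        rw [← mul_assoc, Submodule.span_mul_span, Set.singleton_mul_singleton, tsub_tsub]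
      · refine le_sup_of_le_right (le_sup_of_le_right ?_)
        refine (mul_le_mul' ?_ le_rfl).trans (h₃ u (le_sup_right.trans hu))
        rwa [Submodule.span_singleton_le_iff_mem]
    · exact le_sup_of_le_right le_sup_right

theorem PieceBound.one (E : Fin 3 → Submodule K R) (rest : (Fin 3 → ℕ) → Submodule K R) :
    PieceBound E (fun u => Submodule.span K {(1 : R)} * multiPiece E (u - 0) ⊔ rest u) 0 :=
  ⟨0, fun u _ => ⟨∅, by simp, by
    simp only [← Submodule.one_eq_span, one_mul, tsub_zero]
    exact le_sup_of_le_right le_sup_left⟩⟩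

theorem PieceBound.pow {E : Fin 3 → Submodule K R} {rest : (Fin 3 → ℕ) → Submodule K R}
    (hrest : IdealLike E rest) {p : R} {e a : Fin 3 → ℕ} (hp : p ∈ multiPiece E e)
    (h : PieceBound E (fun u => Submodule.span K {p} * multiPiece E (u - e) ⊔ rest u) a)
    (k : ℕ) :
    PieceBound E (fun u => Submodule.span K {p ^ k} * multiPiece E (u - k • e) ⊔ rest u)
      (k • a) := by
  induction k with
  | zero => simpa using PieceBound.one E rest
  | succ k ih =>
    rw [pow_succ', succ_nsmul', succ_nsmul']
    exact h.mul hrest hp ih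

theorem PieceBound.prod {E : Fin 3 → Submodule K R} {rest : (Fin 3 → ℕ) → Submodule K R}
    (hrest : IdealLike E rest) {p : Fin 3 → R} {a : Fin 3 → Fin 3 → ℕ} (hp : ∀ l, p l ∈ E l)
    (h : ∀ l, PieceBound E
      (fun u => Submodule.span K {p l} * multiPiece E (u - Pi.single l 1) ⊔ rest u) (a l))
    (k : Fin 3 → ℕ) :
    PieceBound E (fun u => Submodule.span K {∏ l, p l ^ k l} * multiPiece E (u - k) ⊔ rest u)
      (∑ l, k l • a l) := by
  have key : ∀ s : Finset (Fin 3), PieceBound E (fun u => Submodule.span K {∏ l ∈ s, p l ^ k l} *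
      multiPiece E (u - ∑ l ∈ s, k l • Pi.single l 1) ⊔ rest u) (∑ l ∈ s, k l • a l) := by
    intro s
    induction s using Finset.induction_on with
    | empty => simpa using PieceBound.one E rest
    | insert l s hl ih =>
      rw [Finset.prod_insert hl, Finset.sum_insert hl, Finset.sum_insert hl]
      have hpl : p l ∈ multiPiece E (Pi.single l 1) := by
        rw [multiPiece_single]; exact hp l
      refine PieceBound.mul hrest ?_ ((h l).pow hrest hpl (k l)) ih
      have h1 : p l ^ k l ∈ E l ^ k l := Submodule.pow_mem_pow _ (hp l) _
      have h2 : multiPiece E (k l • Pi.single l 1) = E l ^ k l := by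
        fin_cases l <;> simp [multiPiece, Fin.prod_univ_three]
      rwa [h2]
  have := key Finset.univ
  have hk : ∑ l, k l • (Pi.single l 1 : Fin 3 → ℕ) = k := by
    funext l
    simp [Finset.sum_apply, Pi.single_apply]
  rwa [hk] at this

theorem sup_pow_le (Z Y : Submodule K R) (k : ℕ) :
    (Z ⊔ Y) ^ (k + 1) ≤ Z ^ (k + 1) ⊔ Y * (Z ⊔ Y) ^ k := by
  induction k with
  | zero => simp
  | succ k ih =>
    calc (Z ⊔ Y) ^ (k + 2) = Z * (Z ⊔ Y) ^ (k + 1) ⊔ Y * (Z ⊔ Y) ^ (k + 1) := by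
          rw [pow_succ' _ (k + 1), Submodule.sup_mul]
      _ ≤ Z * (Z ^ (k + 1) ⊔ Y * (Z ⊔ Y) ^ k) ⊔ Y * (Z ⊔ Y) ^ (k + 1) :=
          sup_le_sup_right (mul_le_mul' le_rfl ih) _
      _ ≤ Z ^ (k + 2) ⊔ Y * (Z ⊔ Y) ^ (k + 1) := by
          rw [Submodule.mul_sup, ← pow_succ' Z (k + 1), mul_left_comm]
          refine sup_le (sup_le le_sup_left (le_sup_of_le_right ?_)) le_sup_right
          refine mul_le_mul' le_rfl ?_
          rw [pow_succ' (Z ⊔ Y) k]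
          exact mul_le_mul' le_sup_left le_rfl

theorem span_singleton_pow_le (a : R) (k : ℕ) :
    Submodule.span K {a} ^ k ≤ Submodule.span K {a ^ k} := by
  rw [Submodule.span_pow, Set.singleton_pow]

theorem span_pair_pow_le [DecidableEq R] (a b : R) (k : ℕ) :
    Submodule.span K {a, b} ^ k ≤
      Submodule.span K ((Finset.range (k + 1)).image fun i => a ^ i * b ^ (k - i) : Finset R) := by
  induction k with
  | zero => simp [Submodule.one_eq_span]
  | succ k ih =>
    rw [pow_succ]
    refine (mul_le_mul' ih le_rfl).trans ?_
    rw [Submodule.span_mul_span, Submodule.span_le]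
    rintro _ ⟨x, hx, y, hy, rfl⟩
    obtain ⟨i, hi, rfl⟩ := Finset.mem_image.1 (Finset.mem_coe.1 hx)
    have hi' := Finset.mem_range.1 hi
    refine Submodule.subset_span (Finset.mem_coe.2 (Finset.mem_image.2 ?_))
    rcases hy with rfl | hy
    · refine ⟨i + 1, Finset.mem_range.2 (by omega), ?_⟩
      rw [Nat.add_sub_add_right, pow_succ]
      ring
    · rw [Set.mem_singleton_iff.1 hy]
      refine ⟨i, Finset.mem_range.2 (by omega), ?_⟩
      rw [show k + 1 - i = k - i + 1 by omega, pow_succ]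
      ring

/-- Reduction modulo the linear forms `Y l`. -/
theorem multiPiece_le_prod_sup {E Z Y : Fin 3 → Submodule K R} (hE : ∀ l, E l ≤ Z l ⊔ Y l)
    (hZE : ∀ l, Z l ≤ E l) (hYE : ∀ l, Y l ≤ E l) {J : Submodule K R} {u : Fin 3 → ℕ}
    (hJ : ∀ l, 1 ≤ u l → Y l * multiPiece E (u - Pi.single l 1) ≤ J) :
    multiPiece E u ≤ (∏ l, Z l ^ u l) ⊔ J := by
  have hE' : ∀ l, E l = Z l ⊔ Y l := fun l => le_antisymm (hE l) (sup_le (hZE l) (hYE l))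
  have hstep : ∀ l, E l ^ u l ≤ Z l ^ u l ⊔ (if 1 ≤ u l then Y l * E l ^ (u l - 1) else ⊥) := by
    intro l
    cases hk : u l with
    | zero => simp
    | succ k =>
      have := sup_pow_le (Z l) (Y l) k
      rw [← hE' l] at this
      simpa using this
  have key : ∀ s : Finset (Fin 3),
      multiPiece E u ≤ ((∏ l ∈ s, Z l ^ u l) * ∏ l ∈ sᶜ, E l ^ u l) ⊔ J := by
    intro s
    induction s using Finset.induction_on with
    | empty => simp [multiPiece]
    | insert l s hl ih =>
      refine ih.trans (sup_le ?_ le_sup_right)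
      have hc : sᶜ = insert l (insert l s)ᶜ := by
        ext x
        by_cases hx : x = l <;> simp [hx, hl]
      rw [hc, Finset.prod_insert (by simp), Finset.prod_insert hl]
      set A := ∏ l ∈ s, Z l ^ u l
      set B := ∏ x ∈ (insert l s)ᶜ, E x ^ u x with hB
      have h1 : A * (E l ^ u l * B) ≤
          A * ((Z l ^ u l ⊔ (if 1 ≤ u l then Y l * E l ^ (u l - 1) else ⊥)) * B) :=
        mul_le_mul' le_rfl (mul_le_mul' (hstep l) le_rfl)
      refine h1.trans ?_
      rw [Submodule.sup_mul, Submodule.mul_sup]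
      refine sup_le (le_sup_of_le_left (le_of_eq (by ring))) (le_sup_of_le_right ?_)
      split_ifs with hu
      · refine le_trans (le_trans (b := Y l * multiPiece E (u - Pi.single l 1)) ?_ le_rfl) (hJ l hu)
        have h2 : multiPiece E (u - Pi.single l 1) =
            (∏ x ∈ s, E x ^ u x) * (E l ^ (u l - 1) * B) := by
          have h3 : ∀ x, x ≠ l → E x ^ u x = E x ^ (u - Pi.single l 1 : Fin 3 → ℕ) x := by
            intro x hx
            simp [hx]
          rw [multiPiece, ← Finset.prod_mul_prod_compl s, hc, Finset.prod_insert (by simp), hB]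
          congr 1
          · exact (Finset.prod_congr rfl fun x hx => h3 x (by rintro rfl; exact hl hx)).symm
          · congr 1
            · simp
            · refine (Finset.prod_congr rfl fun x hx => h3 x ?_).symm
              rintro rfl
              simp at hx
        rw [h2]
        have h4 : A ≤ ∏ x ∈ s, E x ^ u x :=
          Finset.prod_le_prod' fun x _ => pow_le_pow_left' (hZE x) _
        calc A * (Y l * E l ^ (u l - 1) * B) ≤
            (∏ x ∈ s, E x ^ u x) * (Y l * E l ^ (u l - 1) * B) := mul_le_mul' h4 le_rfl
          _ = _ := by ring
      · simp
  simpa using key Finset.univ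

theorem span_mul_multiPiece_le_idealPiece {ι : Type*} (E : Fin 3 → Submodule K R)
    (ℓ : ι → Fin 3 → R) (φ : ι → Fin 3) (l : Fin 3) (u : Fin 3 → ℕ) :
    Submodule.span K ((ℓ · l) '' {i | φ i = l}) * multiPiece E (u - Pi.single l 1) ≤
      idealPiece E (fun i => ℓ i (φ i)) (fun i => Pi.single (φ i) 1) u := by
  rw [← Set.biUnion_of_singleton ((ℓ · l) '' {i | φ i = l}), Set.biUnion_image,
    Submodule.span_iUnion₂]
  simp only [Submodule.iSup_mul]
  refine iSup₂_le fun i hi => ?_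
  have hi' : φ i = l := hi
  refine le_trans (le_of_eq ?_) (le_iSup _ i)
  simp only [hi']

/-- The number of degenerations of the type prescribed by `φ` to a product of a line with points,
the line being in the factor `l`. -/
def lineType {ι : Type*} [Fintype ι] (N : Fin 3 → ℕ) (φ : ι → Fin 3) (l : Fin 3) : ℕ :=
  if ∀ l', (Finset.univ.filter fun i => φ i = l').card + 1 + (if l' = l then 1 else 0) = N l'
  then 1 else 0

theorem pieceBound_linear {ι : Type*} [Fintype ι] {N : Fin 3 → ℕ} {E : Fin 3 → Submodule K R}
    {ℓ : ι → Fin 3 → R} (hmem : ∀ i l, ℓ i l ∈ E l)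
    (hspan : ∀ l (I : Finset ι), N l ≤ I.card → E l ≤ Submodule.span K ((ℓ · l) '' I))
    (hN : ∀ l, N l ≤ Fintype.card ι) (hsum : ∑ l, N l = Fintype.card ι + 4) (φ : ι → Fin 3) :
    PieceBound E (idealPiece E (fun i => ℓ i (φ i)) fun i => Pi.single (φ i) 1)
      (lineType N φ) := by
  classical
  set I : Fin 3 → Finset ι := fun l => Finset.univ.filter fun i => φ i = l with hI
  have hIset : ∀ l, ((I l : Finset ι) : Set ι) = {i | φ i = l} := fun l => by simp [hI]
  have hIsum : ∑ l, (I l).card = Fintype.card ι := by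
    rw [← Finset.card_univ]
    exact (Finset.card_eq_sum_card_fiberwise fun i _ => Finset.mem_univ (φ i)).symm
  by_cases hbig : ∃ l, N l ≤ (I l).card
  · obtain ⟨l, hl⟩ := hbig
    refine ⟨Pi.single l 1, fun u hu => ⟨∅, by simp, le_sup_of_le_right ?_⟩⟩
    rw [← single_mul_multiPiece E hu]
    refine le_trans (mul_le_mul' (hspan l _ hl) le_rfl) ?_
    rw [hIset]
    exact span_mul_multiPiece_le_idealPiece E ℓ φ l u
  · push Not at hbig
    have hex : ∀ l, ∃ t : Finset ι, I l ⊆ t ∧ t.card = N l := fun l =>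
      Finset.exists_superset_card_eq (hbig l).le (hN l)
    choose t hIt ht using hex
    set Z : Fin 3 → Submodule K R := fun l => Submodule.span K ((ℓ · l) '' (t l \ I l : Finset ι))
    have hZcard : ∀ l, (t l \ I l).card + (I l).card = N l := fun l => by
      rw [Finset.card_sdiff_add_card_eq_card (hIt l), ht]
    have hle : ∀ u, multiPiece E u ≤ (∏ l, Z l ^ u l) ⊔
        idealPiece E (fun i => ℓ i (φ i)) (fun i => Pi.single (φ i) 1) u := by
      intro u
      refine multiPiece_le_prod_sup (Z := Z)
        (Y := fun l => Submodule.span K ((ℓ · l) '' {i | φ i = l})) ?_ ?_ ?_ ?_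
      · intro l
        refine (hspan l (t l) (ht l).ge).trans ?_
        rw [← Submodule.span_union, ← Set.image_union, ← hIset, ← Finset.coe_union,
          Finset.sdiff_union_of_subset (hIt l)]
      · intro l
        rw [Submodule.span_le]
        rintro _ ⟨i, -, rfl⟩
        exact hmem i l
      · intro l
        rw [Submodule.span_le]
        rintro _ ⟨i, -, rfl⟩
        exact hmem i l
      · intro l _
        exact span_mul_multiPiece_le_idealPiece E ℓ φ l u
    have hline : ∃ l, (t l \ I l).card = 2 ∧ ∀ l', l' ≠ l → (t l' \ I l').card = 1 := by
      have h0 := hZcard 0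
      have h1 := hZcard 1
      have h2 := hZcard 2
      have b0 := hbig 0
      have b1 := hbig 1
      have b2 := hbig 2
      simp only [Fin.sum_univ_three] at hsum hIsum
      rcases (by omega : (t 0 \ I 0).card = 2 ∨ (t 1 \ I 1).card = 2 ∨ (t 2 \ I 2).card = 2)
        with h | h | h
      · refine ⟨0, h, fun l' hl' => ?_⟩
        fin_cases l' <;> simp at hl' ⊢ <;> omega
      · refine ⟨1, h, fun l' hl' => ?_⟩
        fin_cases l' <;> simp at hl' ⊢ <;> omega
      · refine ⟨2, h, fun l' hl' => ?_⟩
        fin_cases l' <;> simp at hl' ⊢ <;> omega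
    obtain ⟨l, hl2, hl1⟩ := hline
    refine ⟨0, fun u _ => ?_⟩
    have hgen : ∀ l', ∃ c : Finset R, c.card ≤ (if l' = l then u l + 1 else 1) ∧
        Z l' ^ u l' ≤ Submodule.span K c := by
      intro l'
      split_ifs with hll
      · subst hll
        obtain ⟨i, j, -, hij⟩ := Finset.card_eq_two.1 hl2
        refine ⟨(Finset.range (u l' + 1)).image fun k => ℓ i l' ^ k * ℓ j l' ^ (u l' - k),
          Finset.card_image_le.trans (by simp), ?_⟩
        simp only [Z, hij]
        rw [Finset.coe_pair, Set.image_pair]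
        exact span_pair_pow_le _ _ _
      · obtain ⟨i, hi⟩ := Finset.card_eq_one.1 (hl1 l' hll)
        refine ⟨{ℓ i l' ^ u l'}, by simp, ?_⟩
        simp only [Z, hi]
        rw [Finset.coe_singleton, Set.image_singleton, Finset.coe_singleton]
        exact span_singleton_pow_le _ _
    choose c hc hcZ using hgen
    refine ⟨c 0 * c 1 * c 2, ?_, ?_⟩
    · have htype : lineType N φ l = 1 := by
        rw [lineType, if_pos]
        intro l'
        have h3 := hZcard l'
        have h4 : (Finset.univ.filter fun i => φ i = l').card = (I l').card := rfl
        rw [h4]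
        split_ifs with hll
        · subst hll; omega
        · have := hl1 l' hll; omega
      have h5 : u l + 1 ≤ ∑ l', lineType N φ l' * (u l' + 1) := by
        refine le_trans ?_ (Finset.single_le_sum
          (f := fun l' => lineType N φ l' * (u l' + 1)) (fun _ _ => Nat.zero_le _)
          (Finset.mem_univ l))
        simp [htype]
      refine le_trans ?_ h5
      have h6 : (c 0 * c 1 * c 2).card ≤ (c 0).card * (c 1).card * (c 2).card :=
        Finset.card_mul_le.trans (Nat.mul_le_mul_right _ Finset.card_mul_le)
      refine h6.trans (le_trans (Nat.mul_le_mul (Nat.mul_le_mul (hc 0) (hc 1)) (hc 2)) ?_)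
      fin_cases l <;> simp
    · refine (hle u).trans (sup_le_sup_right ?_ _)
      rw [Fin.prod_univ_three, Finset.coe_mul, Finset.coe_mul, ← Submodule.span_mul_span,
        ← Submodule.span_mul_span]
      exact mul_le_mul' (mul_le_mul' (hcZ 0) (hcZ 1)) (hcZ 2)

theorem pieceBound_prod_linear {ι : Type*} [Fintype ι] [DecidableEq ι] {N : Fin 3 → ℕ}
    {E : Fin 3 → Submodule K R}
    {ℓ : ι → Fin 3 → R} (hmem : ∀ i l, ℓ i l ∈ E l)
    (hspan : ∀ l (I : Finset ι), N l ≤ I.card → E l ≤ Submodule.span K ((ℓ · l) '' I))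
    (hN : ∀ l, N l ≤ Fintype.card ι) (hsum : ∑ l, N l = Fintype.card ι + 4)
    (ω : ι → Fin 3 → ℕ) :
    PieceBound E (idealPiece E (fun i => ∏ l, ℓ i l ^ ω i l) ω)
      (∑ ψ : ι → Fin 3, (∏ i, ω i (ψ i)) • lineType N ψ) := by
  have key : ∀ (s : Finset ι) (φ : ι → Fin 3),
      PieceBound E (idealPiece E (fun i => if i ∈ s then ∏ l, ℓ i l ^ ω i l else ℓ i (φ i))
          fun i => if i ∈ s then ω i else Pi.single (φ i) 1)
        (∑ ψ : ι → Fin 3,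
          (if ∀ i, i ∉ s → ψ i = φ i then ∏ i ∈ s, ω i (ψ i) else 0) • lineType N ψ) := by
    intro s
    induction s using Finset.induction_on with
    | empty =>
      intro φ
      have h1 : ∑ ψ : ι → Fin 3, (if ∀ i, i ∉ (∅ : Finset ι) → ψ i = φ i then
          ∏ i ∈ (∅ : Finset ι), ω i (ψ i) else 0) • lineType N ψ = lineType N φ := by
        rw [Finset.sum_eq_single φ]
        · simp
        · intro ψ _ hψ
          rw [if_neg, zero_smul]
          intro h
          exact hψ (funext fun i => h i (by simp))
        · simp
      rw [h1]
      simpa using pieceBound_linear hmem hspan hN hsum φ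
    | insert j s hj ih =>
      intro φ
      set rest : (Fin 3 → ℕ) → Submodule K R := fun u => ⨆ i, ⨆ _ : i ≠ j,
        Submodule.span K {if i ∈ s then ∏ l, ℓ i l ^ ω i l else ℓ i (φ i)} *
          multiPiece E (u - if i ∈ s then ω i else Pi.single (φ i) 1) with hrest
      have hlike : IdealLike E rest := idealLike_iSup E (· ≠ j) _ _
      have hl : ∀ l, PieceBound E (fun u =>
          Submodule.span K {ℓ j l} * multiPiece E (u - Pi.single l 1) ⊔ rest u)
          (∑ ψ : ι → Fin 3, (if ∀ i, i ∉ s → ψ i = Function.update φ j l i then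
            ∏ i ∈ s, ω i (ψ i) else 0) • lineType N ψ) := by
        intro l
        refine (ih (Function.update φ j l)).mono_rest fun u => iSup_le fun i => ?_
        by_cases hij : i = j
        · subst hij
          refine le_sup_of_le_left (le_of_eq ?_)
          simp [hj]
        · refine le_sup_of_le_right (le_iSup₂_of_le i hij (le_of_eq ?_))
          simp [Function.update_of_ne hij]
      have h2 := PieceBound.prod hlike (fun l => hmem j l) hl (ω j)
      have h3 : ∑ l, ω j l • ∑ ψ : ι → Fin 3,
          (if ∀ i, i ∉ s → ψ i = Function.update φ j l i then ∏ i ∈ s, ω i (ψ i) else 0) •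
            lineType N ψ =
          ∑ ψ : ι → Fin 3, (if ∀ i, i ∉ insert j s → ψ i = φ i then
            ∏ i ∈ insert j s, ω i (ψ i) else 0) • lineType N ψ := by
        simp only [Finset.smul_sum]
        rw [Finset.sum_comm]
        refine Finset.sum_congr rfl fun ψ _ => ?_
        rw [Finset.sum_eq_single (ψ j)]
        · have h4 : (∀ i, i ∉ s → ψ i = Function.update φ j (ψ j) i) ↔
              ∀ i, i ∉ insert j s → ψ i = φ i := by
            constructor
            · intro h i hi
              rw [Finset.mem_insert, not_or] at hi
              rw [h i hi.2, Function.update_of_ne hi.1]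
            · intro h i hi
              by_cases hij : i = j
              · subst hij; simp
              · rw [Function.update_of_ne hij]
                exact h i (by simp [hij, hi])
          simp only [h4]
          split_ifs with h5
          · rw [Finset.prod_insert hj, mul_smul]
          · simp
        · intro l _ hl'
          rw [if_neg, zero_smul, smul_zero]
          intro h
          have := h j hj
          rw [Function.update_self] at this
          exact hl' this.symm
        · simp
      rw [h3] at h2
      refine h2.mono_rest fun u => sup_le ?_ ?_
      · refine le_trans (le_of_eq ?_) (le_iSup _ j)
        simp
      · refine iSup₂_le fun i hi => le_trans (le_of_eq ?_) (le_iSup _ i)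
        simp [hi]
  have h := key Finset.univ fun _ => 0
  simpa using h

end HilbertBound

theorem exists_general_position {K R ι κ : Type*} [Field K] [Infinite K] [CommRing R] [Algebra K R]
    [Finite ι] [Fintype κ] (b : κ → R) :
    ∃ ℓ : ι → R, (∀ i, ℓ i ∈ Submodule.span K (Set.range b)) ∧
      ∀ I : Finset ι, Fintype.card κ ≤ I.card →
        Submodule.span K (Set.range b) ≤ Submodule.span K (ℓ '' I) := by
  classical
  obtain ⟨α, hα⟩ : ∃ α : ι → K, Function.Injective α := by
    cases nonempty_fintype ι
    exact ⟨fun i => Infinite.natEmbedding K (Fintype.equivFin ι i), fun i j h => by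
      simpa [Fin.val_inj] using h⟩
  set e := Fintype.equivFin κ
  refine ⟨fun i => ∑ k, α i ^ (e k : ℕ) • b k, fun i => ?_, fun I hI => ?_⟩
  · exact Submodule.sum_mem _ fun k _ => Submodule.smul_mem _ _ (Submodule.subset_span ⟨k, rfl⟩)
  · obtain ⟨I', hI', hcard⟩ := Finset.exists_subset_card_eq hI
    let f : Fin (Fintype.card κ) ≃ I' := (I'.equivFinOfCardEq hcard).symm
    let A : Matrix (Fin (Fintype.card κ)) (Fin (Fintype.card κ)) K :=
      Matrix.vandermonde fun j => α (f j)
    have hA : IsUnit A.det := by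
      rw [isUnit_iff_ne_zero, Matrix.det_vandermonde_ne_zero_iff]
      exact fun j k hjk => f.injective (Subtype.ext (hα hjk))
    rw [Submodule.span_le]
    rintro _ ⟨k, rfl⟩
    have hk : b k = ∑ j, A⁻¹ (e k) j • ∑ k', α (f j) ^ (e k' : ℕ) • b k' := by
      simp only [Finset.smul_sum, smul_smul]
      rw [Finset.sum_comm]
      simp only [← Finset.sum_smul]
      have h1 : ∀ k', ∑ j, A⁻¹ (e k) j * α (f j) ^ (e k' : ℕ) = if k = k' then 1 else 0 := by
        intro k'
        have := congrFun (congrFun (Matrix.nonsing_inv_mul A hA) (e k)) (e k')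
        rw [Matrix.mul_apply, Matrix.one_apply] at this
        simpa [A, Matrix.vandermonde_apply] using this
      simp [h1]
    rw [hk]
    exact Submodule.sum_mem _ fun j _ => Submodule.smul_mem _ _
      (Submodule.subset_span ⟨f j, hI' (f j).2, rfl⟩)

section Relation

variable {K R : Type*} {M : Type w} [Field K] [CommRing R] [Algebra K R] [Field M] [Algebra K M]

/-- The point `ev` of the zero locus of `F` is a limit, as `ε → 0`, of zeros of `F + ε G`. -/
def IsLimitZero {ι : Type*} (F G : ι → R) (ev : R →ₐ[K] M) : Prop :=
  ∃ (O : Type w) (_ : CommRing O) (_ : IsDomain O) (_ : Algebra K O) (φ : R →ₐ[K] O)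
    (ψ : O →ₐ[K] M) (ε : O), ε ≠ 0 ∧ ψ ε = 0 ∧ (∀ i, φ (F i) + ε * φ (G i) = 0) ∧
      ψ.comp φ = ev

theorem exists_eq_X_pow_mul {Λ κ : Type*} [CommRing Λ] (c : κ → Polynomial Λ) (hc : c ≠ 0) :
    ∃ (m : ℕ) (c' : κ → Polynomial Λ), (∀ k, c k = Polynomial.X ^ m * c' k) ∧
      ∃ k, (c' k).coeff 0 ≠ 0 := by
  obtain ⟨k₀, hk₀⟩ := Function.ne_iff.1 hc
  induction hN : (c k₀).natDegree using Nat.strong_induction_on generalizing c with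
  | _ N ih =>
    by_cases h : ∃ k, (c k).coeff 0 ≠ 0
    · exact ⟨0, c, by simp, h⟩
    · push Not at h
      have hX : ∀ k, c k = Polynomial.X * (c k).divX := fun k => by
        conv_lhs => rw [← Polynomial.X_mul_divX_add (c k), h k]
        simp
      have h0 : (c k₀).divX ≠ 0 := fun h0 => hk₀ (by rw [hX k₀, h0]; simp)
      have hdeg : (c k₀).divX.natDegree < N := by
        rw [Polynomial.natDegree_divX_eq_natDegree_tsub_one, hN]
        have : (c k₀).natDegree ≠ 0 := fun h1 => by
          rw [Polynomial.eq_C_of_natDegree_eq_zero h1, h k₀] at hk₀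
          simp at hk₀
        omega
      obtain ⟨m, c', h1, h2⟩ := ih _ hdeg (fun k => (c k).divX)
        (fun h => h0 (congrFun h k₀)) h0 rfl
      refine ⟨m + 1, c', fun k => ?_, h2⟩
      rw [hX k, h1 k]
      ring

theorem exists_coords_of_coeff_mem {τ β : Type*} [Fintype β] {V : Submodule K R}
    (b : Module.Basis β K V) (p : MvPolynomial τ R) (hp : ∀ m, p.coeff m ∈ V) :
    ∃ a : β → MvPolynomial τ K, p = ∑ l, C (b l : R) * map (algebraMap K R) (a l) := by
  refine ⟨fun l => ∑ m ∈ p.support, monomial m (b.repr ⟨p.coeff m, hp m⟩ l), ?_⟩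
  simp only [map_sum, map_monomial, Finset.mul_sum, C_mul_monomial]
  rw [Finset.sum_comm]
  conv_lhs => rw [p.as_sum]
  refine Finset.sum_congr rfl fun m _ => ?_
  rw [← map_sum]
  congr 1
  have := congrArg Subtype.val (b.sum_repr ⟨p.coeff m, hp m⟩)
  refine this.symm.trans ?_
  simp only [Submodule.coe_sum, Submodule.coe_smul, Algebra.smul_def, mul_comm]

theorem mem_idealPiece {ι : Type*} [Fintype ι] {E : Fin 3 → Submodule K R} {G : ι → R}
    {ω : ι → Fin 3 → ℕ} {u : Fin 3 → ℕ} {w : R} (hw : w ∈ idealPiece E G ω u) :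
    ∃ q : ι → R, (∀ i, q i ∈ multiPiece E (u - ω i)) ∧ w = ∑ i, q i * G i := by
  classical
  rw [idealPiece, Submodule.mem_iSup_iff_exists_finsupp] at hw
  obtain ⟨f, hf, rfl⟩ := hw
  have := fun i => Submodule.mem_span_singleton_mul.1 (hf i)
  choose q hq hq' using this
  refine ⟨q, hq, ?_⟩
  rw [Finsupp.sum_fintype _ _ (by simp)]
  exact Finset.sum_congr rfl fun i _ => by rw [← hq' i, mul_comm]

theorem mul_mem_multiPiece {E : Fin 3 → Submodule K R} {e u : Fin 3 → ℕ} (he : e ≤ u) {q p : R}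
    (hq : q ∈ multiPiece E (u - e)) (hp : p ∈ multiPiece E e) : q * p ∈ multiPiece E u := by
  rw [← tsub_add_cancel_of_le he, ← multiPiece_mul]
  exact Submodule.mul_mem_mul hq hp

theorem linearIndependent_pencil {τ β : Type*} [Fintype β] {V : Submodule K R}
    (b : Module.Basis β K V) {ρ : Type*} [Fintype ρ] (p w : ρ → V) (hw : LinearIndependent K w)
    (c : ρ → Polynomial (MvPolynomial τ K))
    (hc : ∀ m, ∑ l, c l * (Polynomial.C (C (b.repr (p l) m)) +
      Polynomial.X * Polynomial.C (C (b.repr (w l) m))) = 0) : c = 0 := by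
  by_contra hne
  obtain ⟨l₀, hl₀, hmax⟩ : ∃ l₀, c l₀ ≠ 0 ∧ ∀ l, (c l).natDegree ≤ (c l₀).natDegree := by
    obtain ⟨l₁, hl₁⟩ := Function.ne_iff.1 hne
    obtain ⟨l₀, -, h⟩ := Finset.exists_max_image Finset.univ (fun l => (c l).degree) ⟨l₁, by simp⟩
    refine ⟨l₀, fun h0 => hl₁ ?_, fun l => Polynomial.natDegree_le_natDegree (h l (by simp))⟩
    have := h l₁ (by simp)
    simpa [h0] using this
  set N := (c l₀).natDegree
  have hN : (c l₀).coeff N ≠ 0 := by simpa [N] using hl₀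
  obtain ⟨mon, hmon⟩ := MvPolynomial.ne_zero_iff.1 hN
  have key : ∀ m, ∑ l, ((c l).coeff N).coeff mon * b.repr (w l) m = 0 := by
    intro m
    have h1 := congrArg (fun q => (Polynomial.coeff q (N + 1)).coeff mon) (hc m)
    simp only [Polynomial.finsetSum_coeff, mul_add, Polynomial.coeff_add, Polynomial.coeff_mul_C,
      Polynomial.coeff_zero, MvPolynomial.coeff_zero] at h1
    have h2 : ∀ l, (c l).coeff (N + 1) = 0 := fun l =>
      Polynomial.coeff_eq_zero_of_natDegree_lt (by have := hmax l; omega)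
    have h3 : ∀ l, (c l * (Polynomial.X * Polynomial.C (C (b.repr (w l) m)))).coeff (N + 1) =
        (c l).coeff N * C (b.repr (w l) m) := fun l => by
      rw [mul_left_comm, Polynomial.coeff_X_mul, Polynomial.coeff_mul_C]
    simp only [h2, h3, zero_mul, zero_add, MvPolynomial.coeff_sum] at h1
    refine Eq.trans (Finset.sum_congr rfl fun l _ => ?_) h1
    rw [mul_comm _ (C _), coeff_C_mul, mul_comm]
  refine hmon (Fintype.linearIndependent_iff.1 hw (fun l => ((c l).coeff N).coeff mon) ?_ l₀)
  apply b.repr.injective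
  ext m
  simpa using key m

theorem sum_mul_sum_add_sum {S β κ ρ : Type*} [CommRing S] [Fintype β] [Fintype κ] [Fintype ρ]
    (B : β → S) (x : κ → S) (A : κ → β → S) (y : ρ → S) (Z : ρ → β → S) :
    ∑ m, B m * (∑ k, x k * A k m + ∑ l, y l * Z l m) =
      ∑ k, x k * ∑ m, B m * A k m + ∑ l, y l * ∑ m, B m * Z l m := by
  simp only [mul_add, Finset.mul_sum, Finset.sum_add_distrib]
  rw [Finset.sum_comm, Finset.sum_comm (f := fun m l => B m * (y l * Z l m))]
  congr 1 <;> exact Finset.sum_congr rfl fun _ _ => Finset.sum_congr rfl fun _ _ => by ring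

theorem exists_relation_of_isLimitZero {ι κ τ : Type*} [Fintype ι] [Fintype κ]
    {F G : ι → R} {E : Fin 3 → Submodule K R} {ω : ι → Fin 3 → ℕ} {u : Fin 3 → ℕ}
    [Module.Finite K (multiPiece E u)]
    (hu : ∀ i, ω i ≤ u) (hF : ∀ i, F i ∈ multiPiece E (ω i)) (hG : ∀ i, G i ∈ multiPiece E (ω i))
    (c : Finset R) (hc : multiPiece E u ≤ Submodule.span K c ⊔ idealPiece E G ω u)
    (v : κ → MvPolynomial τ R) (hv : ∀ k m, (v k).coeff m ∈ multiPiece E u)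
    (hcard : c.card < Fintype.card κ) :
    ∃ γ : κ → MvPolynomial τ K, γ ≠ 0 ∧ ∀ ev : R →ₐ[K] M, IsLimitZero F G ev →
      ∑ k, map (algebraMap K M) (γ k) * map (ev : R →+* M) (v k) = 0 := by
  classical
  set V := multiPiece E u with hV
  have hle : idealPiece E G ω u ≤ V := fun w hw => by
    obtain ⟨q, hq, rfl⟩ := mem_idealPiece hw
    exact Submodule.sum_mem _ fun i _ => mul_mem_multiPiece (hu i) (hq i) (hG i)
  have : Module.Finite K (idealPiece E G ω u) := Submodule.finiteDimensional_of_le hle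
  let b := Module.finBasis K V
  let bw := Module.finBasis K (idealPiece E G ω u)
  choose q hq hqw using fun l => mem_idealPiece (bw l).2
  let w : Fin (Module.finrank K (idealPiece E G ω u)) → V := fun l => ⟨bw l, hle (bw l).2⟩
  let p : Fin (Module.finrank K (idealPiece E G ω u)) → V := fun l =>
    ⟨∑ i, q l i * F i, Submodule.sum_mem _ fun i _ => mul_mem_multiPiece (hu i) (hq l i) (hF i)⟩
  have hw : LinearIndependent K w := by
    have := bw.linearIndependent.map' (Submodule.inclusion hle) (Submodule.ker_inclusion _ _ hle)
    exact this
  choose a ha using fun k => exists_coords_of_coeff_mem b (v k) (hv k)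
  let vec : κ ⊕ Fin (Module.finrank K (idealPiece E G ω u)) →
      Fin (Module.finrank K V) → Polynomial (MvPolynomial τ K) :=
    Sum.elim (fun k m => Polynomial.C (a k m)) fun l m =>
      Polynomial.C (C (b.repr (p l) m)) + Polynomial.X * Polynomial.C (C (b.repr (w l) m))
  have hdim : Module.finrank K V ≤ c.card + Module.finrank K (idealPiece E G ω u) := by
    refine (Submodule.finrank_mono hc).trans ?_
    refine (Submodule.finrank_add_le_finrank_add_finrank _ _).trans ?_
    gcongr
    exact finrank_span_finset_le_card c
  have hdep : ¬ LinearIndependent (Polynomial (MvPolynomial τ K)) vec := fun h => by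
    have := h.fintype_card_le_finrank
    simp only [Module.finrank_fintype_fun_eq_card, Fintype.card_sum, Fintype.card_fin] at this
    omega
  obtain ⟨r, hr, hr0⟩ := Fintype.not_linearIndependent_iff.1 hdep
  have hr' : ∀ m, ∑ k, r (Sum.inl k) * Polynomial.C (a k m) +
      ∑ l, r (Sum.inr l) * (Polynomial.C (C (b.repr (p l) m)) +
        Polynomial.X * Polynomial.C (C (b.repr (w l) m))) = 0 := fun m => by
    simpa [vec] using congrFun hr m
  have hne : (fun k => r (Sum.inl k)) ≠ 0 := fun h => by
    have h1 := linearIndependent_pencil b p w hw (fun l => r (Sum.inr l)) fun m => by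
      simpa [fun k => congrFun h k] using hr' m
    obtain ⟨i | i, hi⟩ := hr0
    · exact hi (congrFun h i)
    · exact hi (congrFun h1 i)
  obtain ⟨m₀, c', hc', k₀, hk₀⟩ := exists_eq_X_pow_mul _ hne
  refine ⟨fun k => (c' k).coeff 0, fun h => hk₀ (congrFun h k₀), ?_⟩
  rintro ev ⟨O, _, _, _, φ, ψ, ε, hε, hψε, hFG, rfl⟩
  let θ : Polynomial (MvPolynomial τ K) →+* MvPolynomial τ O :=
    Polynomial.eval₂RingHom (map (algebraMap K O)) (C ε)
  have hmapφ : ∀ x : MvPolynomial τ K, map (φ : R →+* O) (map (algebraMap K R) x) =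
      map (algebraMap K O) x := fun x => by
    rw [map_map]
    exact congrArg (fun f => map f x) φ.comp_algebraMap
  have hvk : ∀ k, map (φ : R →+* O) (v k) = ∑ m, C (φ (b m)) * θ (Polynomial.C (a k m)) :=
    fun k => by
      rw [ha k]
      simp only [map_sum, map_mul, hmapφ, map_C, θ, Polynomial.coe_eval₂RingHom,
        Polynomial.eval₂_C]
      rfl
  have hpw : ∀ l, ∑ m, C (φ (b m)) * θ (Polynomial.C (C (b.repr (p l) m)) +
      Polynomial.X * Polynomial.C (C (b.repr (w l) m))) = (0 : MvPolynomial τ O) := fun l => by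
    have h1 : ∀ x : V, φ x = ∑ m, φ (b m) * algebraMap K O (b.repr x m) := fun x => by
      conv_lhs => rw [← b.sum_repr x]
      simp only [Submodule.coe_sum, Submodule.coe_smul, map_sum, Algebra.smul_def, map_mul,
        AlgHom.commutes, mul_comm]
    have h2 : φ (p l) + ε * φ (w l) = 0 := by
      have : (w l : R) = ∑ i, q l i * G i := hqw l
      rw [this]
      simp only [p, map_sum, map_mul, Finset.mul_sum, ← Finset.sum_add_distrib]
      refine Finset.sum_eq_zero fun i _ => ?_
      linear_combination φ (q l i) * hFG i
    have h3 := congrArg (C : O → MvPolynomial τ O) h2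
    rw [h1, h1] at h3
    simp only [map_add, map_sum, map_mul, map_zero, Finset.mul_sum, ← Finset.sum_add_distrib] at h3
    rw [← h3]
    refine Finset.sum_congr rfl fun m _ => ?_
    simp only [θ, Polynomial.coe_eval₂RingHom, Polynomial.eval₂_add, Polynomial.eval₂_mul,
      Polynomial.eval₂_C, Polynomial.eval₂_X, map_C]
    ring
  have hsum : ∑ k, θ (r (Sum.inl k)) * map (φ : R →+* O) (v k) = 0 := by
    have h1 : ∑ m, C (φ (b m)) * θ (∑ k, r (Sum.inl k) * Polynomial.C (a k m) +
      ∑ l, r (Sum.inr l) * (Polynomial.C (C (b.repr (p l) m)) +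
        Polynomial.X * Polynomial.C (C (b.repr (w l) m)))) = (0 : MvPolynomial τ O) :=
      Finset.sum_eq_zero fun m _ => by rw [hr' m]; simp
    rw [← h1]
    simp only [map_add θ (∑ _, _), map_sum θ, map_mul θ (r _)]
    rw [sum_mul_sum_add_sum]
    simp only [hpw, ← hvk, mul_zero, Finset.sum_const_zero, add_zero]
  have hsum' : ∑ k, θ (c' k) * map (φ : R →+* O) (v k) = 0 := by
    have h1 : (C ε : MvPolynomial τ O) ^ m₀ * ∑ k, θ (c' k) * map (φ : R →+* O) (v k) = 0 := by
      rw [← hsum, Finset.mul_sum]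
      refine Finset.sum_congr rfl fun k _ => ?_
      rw [hc' k, map_mul, map_pow]
      simp only [θ, Polynomial.coe_eval₂RingHom, Polynomial.eval₂_X]
      ring
    exact (mul_eq_zero.1 h1).resolve_left (pow_ne_zero _ ((map_ne_zero_iff _ (C_injective _ _)).2 hε))
  have h4 := congrArg (map (ψ : O →+* M)) hsum'
  rw [map_sum, map_zero] at h4
  rw [← h4]
  refine Finset.sum_congr rfl fun k _ => ?_
  rw [map_mul, map_map]
  congr 1
  simp only [θ, Polynomial.coe_eval₂RingHom]
  rw [Polynomial.hom_eval₂, map_C]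
  have h5 : (map (ψ : O →+* M)).comp (map (algebraMap K O)) =
      (map (algebraMap K M) : MvPolynomial τ K →+* MvPolynomial τ M) := by
    ext <;> simp
  have h6 : (C ((ψ : O →+* M) ε) : MvPolynomial τ M) = 0 := by simp [hψε]
  rw [h5, h6, Polynomial.eval₂_at_zero]

theorem isLimitZero_of_finite {K : Type*} {M : Type w} [Field K] [Field M] [Algebra K M]
    [IsAlgClosed M] {σ : Type} {ι : Type*} [Finite σ] [Finite ι]
    (hcard : Nat.card ι ≤ Nat.card σ) (t : M) (F G : ι → MvPolynomial (Option σ) K) (S : σ → M)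
    (hfin : {x : σ → M | ∀ i, aeval (fun o => o.elim t x) (F i) = 0}.Finite)
    (hS : ∀ i, aeval (fun o => o.elim t S) (F i) = 0) :
    IsLimitZero F G (aeval (R := K) fun o : Option σ => o.elim t S) := by
  let base : MvPolynomial (Option σ) K →ₐ[K] MvPolynomial (Option σ) M :=
    aeval fun o => o.elim (C t) fun j => X (some j)
  let ev : (σ → M) → MvPolynomial (Option σ) M →ₐ[K] M := fun x =>
    (aeval (R := M) fun o : Option σ => o.elim 0 x).restrictScalars K
  have hbase : ∀ x, (ev x).comp base = aeval fun o : Option σ => o.elim t x := fun x => by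
    ext o
    cases o <;> simp [ev, base]
  have hf : ∀ x i, aeval (fun o : Option σ => o.elim 0 x) (base (F i) + X none * base (G i)) =
      aeval (fun o : Option σ => o.elim t x) (F i) := fun x i => by
    have := DFunLike.congr_fun (hbase x) (F i)
    simp only [AlgHom.comp_apply, ev, AlgHom.restrictScalars_apply] at this
    rw [map_add, map_mul, aeval_X, this]
    simp
  obtain ⟨p, hp, hfp, hX, hpS⟩ := exists_prime_of_isolated_zero hcard
    (fun i => base (F i) + X none * base (G i)) S (by simpa only [hf] using hfin)
    (by simpa only [hf] using hS)
  refine ⟨MvPolynomial (Option σ) M ⧸ p, inferInstance, inferInstance, inferInstance,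
    (Ideal.Quotient.mkₐ K p).comp base, Ideal.Quotient.liftₐ p (ev S) hpS,
    Ideal.Quotient.mk p (X none), ?_, ?_, fun i => ?_, ?_⟩
  · rwa [Ne, Ideal.Quotient.eq_zero_iff_mem]
  · exact (Ideal.Quotient.liftₐ_apply p (ev S) hpS _).trans (by simp [ev])
  · have := Ideal.Quotient.eq_zero_iff_mem.2 (hfp i)
    simpa using this
  · rw [← hbase S]
    ext o
    exact Ideal.Quotient.liftₐ_apply p (ev S) hpS (Ideal.Quotient.mk p (base (X o)))

end Relation

theorem prod_mem_prod_submodule {K R α : Type*} [CommSemiring K] [CommSemiring R] [Algebra K R]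
    {s : Finset α} {f : α → R} {W : α → Submodule K R} (h : ∀ i ∈ s, f i ∈ W i) :
    ∏ i ∈ s, f i ∈ ∏ i ∈ s, W i := by
  classical
  induction s using Finset.induction_on with
  | empty => simpa using Submodule.one_le.1 (le_refl (1 : Submodule K R))
  | insert a s ha ih =>
    rw [Finset.prod_insert ha, Finset.prod_insert ha]
    exact Submodule.mul_mem_mul (h a (by simp)) (ih fun i hi => h i (by simp [hi]))

section VarSpan

variable {K α : Type*} [Field K]

/-- The span of `1` and of the variables with label `l`. -/
noncomputable def varSpan (K : Type*) [Field K] {α : Type*} (label : α → Fin 3) (l : Fin 3) :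
    Submodule K (MvPolynomial α K) :=
  Submodule.span K (Set.range fun o : Option {a // label a = l} => o.elim 1 fun a => X a.1)

variable {label : α → Fin 3}

theorem one_le_varSpan (l : Fin 3) : 1 ≤ varSpan K label l := by
  rw [Submodule.one_le]
  exact Submodule.subset_span ⟨none, rfl⟩

theorem X_mem_varSpan (a : α) : X a ∈ varSpan K label (label a) :=
  Submodule.subset_span ⟨some ⟨a, rfl⟩, rfl⟩

theorem varSpan_pow_mono (l : Fin 3) {i j : ℕ} (h : i ≤ j) :
    varSpan K label l ^ i ≤ varSpan K label l ^ j := by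
  obtain ⟨k, rfl⟩ := Nat.exists_eq_add_of_le h
  rw [pow_add]
  calc varSpan K label l ^ i = varSpan K label l ^ i * 1 := (mul_one _).symm
    _ ≤ _ := by gcongr; exact one_le_pow_of_one_le' (one_le_varSpan l) k

instance [Finite α] (l : Fin 3) : Module.Finite K (varSpan K label l) :=
  Module.Finite.span_of_finite K (Set.finite_range _)

theorem finite_multiPiece_varSpan [Finite α] (u : Fin 3 → ℕ) :
    Module.Finite K (multiPiece (varSpan K label) u) := by
  have h : ∀ l, (varSpan K label l).FG := fun l => Module.Finite.iff_fg.1 inferInstance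
  rw [Module.Finite.iff_fg]
  simp only [multiPiece, Fin.prod_univ_three]
  exact (((h 0).pow _).mul ((h 1).pow _)).mul ((h 2).pow _)

theorem coeff_pow_mem_pow {R τ : Type*} [CommRing R] [Algebra K R] {W : Submodule K R}
    {p : MvPolynomial τ R} (hp : ∀ m, p.coeff m ∈ W) (j : ℕ) (m : τ →₀ ℕ) :
    (p ^ j).coeff m ∈ W ^ j := by
  classical
  induction j generalizing m with
  | zero =>
    rw [pow_zero, pow_zero, coeff_one]
    split_ifs
    · exact Submodule.one_le.1 le_rfl
    · exact Submodule.zero_mem _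
  | succ j ih =>
    rw [pow_succ, pow_succ, coeff_mul]
    exact Submodule.sum_mem _ fun q _ => Submodule.mul_mem_mul (ih _) (hp _)

theorem coeff_mem_multiPiece [Finite α] {τ : Type*} [Fintype τ] (a : α) (ha : label a = 0)
    (x : τ → α) (hx : ∀ j, label (x j) = 1) {u : Fin 3 → ℕ} {i j : ℕ} (hi : i ≤ u 0) (hj : j ≤ u 1)
    (m : τ →₀ ℕ) :
    (C (X a) ^ i * (∑ k, X k * C (X (x k))) ^ j : MvPolynomial τ (MvPolynomial α K)).coeff m ∈
      multiPiece (varSpan K label) u := by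
  classical
  rw [← C_pow, coeff_C_mul]
  have h1 : (X a : MvPolynomial α K) ^ i ∈ varSpan K label 0 ^ u 0 :=
    varSpan_pow_mono 0 hi (Submodule.pow_mem_pow _ (ha ▸ X_mem_varSpan a) i)
  have h2 : ((∑ k, X k * C (X (x k)) : MvPolynomial τ (MvPolynomial α K)) ^ j).coeff m ∈
      varSpan K label 1 ^ u 1 := by
    refine varSpan_pow_mono 1 hj (coeff_pow_mem_pow (fun m => ?_) j m)
    rw [coeff_sum]
    refine Submodule.sum_mem _ fun k _ => ?_
    rw [mul_comm, coeff_C_mul, coeff_X]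
    split_ifs
    · rw [mul_one]
      exact hx k ▸ X_mem_varSpan (x k)
    · simp
  have h3 : (1 : MvPolynomial α K) ∈ varSpan K label 2 ^ u 2 :=
    Submodule.one_le.1 (one_le_pow_of_one_le' (one_le_varSpan 2) _)
  simp only [multiPiece, Fin.prod_univ_three]
  simpa using Submodule.mul_mem_mul (Submodule.mul_mem_mul h1 h2) h3

end VarSpan

/-- The coefficient of `u 1` in the bound for the multigraded Hilbert function of a system of
multidegrees `ω`. -/
def eliminantDegree {ι : Type*} [Fintype ι] [DecidableEq ι] (N : Fin 3 → ℕ) (ω : ι → Fin 3 → ℕ) :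
    ℕ :=
  ∑ ψ : ι → Fin 3, (∏ i, ω i (ψ i)) * lineType N ψ 1

theorem exists_eliminant {K : Type*} {M : Type w} [Field K] [Infinite K] [Field M] [Algebra K M]
    [IsAlgClosed M] {σ : Type} {ι τ : Type*} [Fintype σ] [Fintype ι] [DecidableEq ι] [Fintype τ]
    (hcard : Fintype.card ι = Fintype.card σ) (label : Option σ → Fin 3) (N : Fin 3 → ℕ)
    (hN : ∀ l, N l = Fintype.card {o // label o = l} + 1) (hNle : ∀ l, N l ≤ Fintype.card ι)
    (ω : ι → Fin 3 → ℕ) (F : ι → MvPolynomial (Option σ) K)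
    (hF : ∀ i, F i ∈ multiPiece (varSpan K label) (ω i))
    (t : M) (hfin : {x : σ → M | ∀ i, aeval (fun o => o.elim t x) (F i) = 0}.Finite)
    (hnone : label none = 0) (x : τ → σ) (hx : ∀ j, label (some (x j)) = 1) :
    ∃ (B : ℕ) (γ : Fin (eliminantDegree N ω + 1) × Fin (B + 1) → MvPolynomial τ K), γ ≠ 0 ∧
      ∀ S : σ → M, (∀ i, aeval (fun o : Option σ => o.elim t S) (F i) = 0) →
        ∑ k, map (algebraMap K M) (γ k) *
          (C t ^ (k.1 : ℕ) * (∑ j, X j * C (S (x j))) ^ (k.2 : ℕ)) = 0 := by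
  classical
  set δ := eliminantDegree N ω with hδ
  set E := varSpan K label with hE
  choose ℓ hℓ hℓ' using fun l : Fin 3 => exists_general_position (K := K) (ι := ι)
    fun o : Option {a // label a = l} => o.elim (1 : MvPolynomial (Option σ) K) fun a => X a.1
  have hsum : ∑ l, N l = Fintype.card ι + 4 := by
    have h1 : Fintype.card (Option σ) = ∑ l, Fintype.card {o // label o = l} := by
      rw [← Fintype.card_sigma]
      exact Fintype.card_congr (Equiv.sigmaFiberEquiv label).symm
    rw [Fintype.card_option] at h1
    simp only [hN, Finset.sum_add_distrib, ← h1, hcard]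
    simp
  obtain ⟨u₀, hu₀⟩ := pieceBound_prod_linear (E := E) (ℓ := fun i l => ℓ l i) (N := N)
    (fun i l => hℓ l i) (fun l I hI => hℓ' l I (by simpa [hN] using hI)) hNle hsum ω
  set a := ∑ ψ : ι → Fin 3, (∏ i, ω i (ψ i)) • lineType N ψ with ha
  have ha1 : a 1 = δ := by
    simp [ha, hδ, eliminantDegree, Finset.sum_apply]
  set G : ι → MvPolynomial (Option σ) K := fun i => ∏ l, ℓ l i ^ ω i l
  have hG : ∀ i, G i ∈ multiPiece E (ω i) := fun i =>
    prod_mem_prod_submodule fun l _ => Submodule.pow_mem_pow _ (hℓ l i) _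
  obtain ⟨w, hw⟩ : ∃ w : Fin 3 → ℕ, u₀ ≤ w ∧ (∀ i, ω i ≤ w) ∧ δ ≤ w 0 :=
    ⟨u₀ + ∑ i, ω i + fun _ => δ, fun l => by simp; omega, fun i l => by
      have := Finset.single_le_sum (f := fun i => ω i l) (fun _ _ => zero_le) (Finset.mem_univ i)
      simp
      omega, by simp⟩
  obtain ⟨hw1, hw2, hw3⟩ := hw
  set B := w 1 + a 0 * (w 0 + 1) + a 2 * (w 2 + 1) with hB
  set u : Fin 3 → ℕ := Function.update w 1 B with hu
  have hwu : w ≤ u := fun l => by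
    by_cases hl : l = 1
    · subst hl
      simp [hu, hB, add_assoc]
    · simp [hu, hl]
  obtain ⟨c, hc, hcu⟩ := hu₀ u (hw1.trans hwu)
  have hfinite := finite_multiPiece_varSpan (K := K) (label := label) u
  obtain ⟨γ, hγ, hev⟩ := exists_relation_of_isLimitZero (M := M) (F := F)
    (κ := Fin (δ + 1) × Fin (B + 1)) (τ := τ)
    (fun i => (hw2 i).trans hwu) hF hG c hcu
    (fun k => C (X none) ^ (k.1 : ℕ) * (∑ j, X j * C (X (some (x j)))) ^ (k.2 : ℕ))
    (fun k m => coeff_mem_multiPiece none hnone (fun j => some (x j)) hx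
      (by have := k.1.2; have : u 0 = w 0 := by simp [hu]
          omega)
      (by have := k.2.2; have : u 1 = B := by simp [hu]
          omega) m)
    (by
      refine hc.trans_lt ?_
      simp only [Fintype.card_prod, Fintype.card_fin, Fin.sum_univ_three, ha1]
      have h0 : u 0 = w 0 := by simp [hu]
      have h1 : u 1 = B := by simp [hu]
      have h2 : u 2 = w 2 := by simp [hu]
      rw [h0, h1, h2]
      have : (δ + 1) * (B + 1) = δ * (B + 1) + (B + 1) := by ring
      omega)
  refine ⟨B, γ, hγ, fun S hS => ?_⟩
  have := hev _ (isLimitZero_of_finite (by simp [hcard]) t F G S hfin hS)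
  refine Eq.trans (Finset.sum_congr rfl fun k _ => ?_) this
  simp

section Count

theorem sum_le_sum_of_exists_preimage {α β : Type*} [DecidableEq α] {A : Finset α} {T : Finset β}
    (g : β → α) {f : α → ℕ} {f' : β → ℕ} (h : ∀ a ∈ A, f a ≠ 0 → ∃ b ∈ T, g b = a ∧ f a ≤ f' b) :
    ∑ a ∈ A, f a ≤ ∑ b ∈ T, f' b := by
  calc ∑ a ∈ A, f a ≤ ∑ a ∈ A, ∑ b ∈ T with g b = a, f' b := by
        refine Finset.sum_le_sum fun a ha => ?_
        rcases eq_or_ne (f a) 0 with h0 | h0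
        · simp [h0]
        · obtain ⟨b, hb, hgb, hle⟩ := h a ha h0
          exact hle.trans (Finset.single_le_sum (f := f') (fun _ _ => zero_le) (by simp [hb, hgb]))
    _ ≤ ∑ b ∈ T, f' b := Finset.sum_fiberwise_le_sum_of_sum_fiber_nonneg fun _ _ => zero_le

theorem eliminantDegree_le {n s : ℕ} (d : Fin s → ℕ)
    (d' : Fin (n - 1) → ℕ) (hd : ∀ i, 0 < d i) (hd' : ∀ i, 0 < d' i) :
    eliminantDegree ![2, n + 1, s]
      (Sum.elim (fun i => ![1, d i, 0]) fun j => ![1, d' j, 1]) ≤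
    n * ((∏ i, d i) * ∑ E ∈ Finset.powersetCard (n - s) (Finset.univ : Finset (Fin (n - 1))),
        ∏ j ∈ E, d' j) := by
  classical
  set ω : Fin s ⊕ Fin (n - 1) → Fin 3 → ℕ :=
    Sum.elim (fun i => ![1, d i, 0]) fun j => ![1, d' j, 1] with hω
  set B : Finset (Fin s ⊕ Fin (n - 1) → Fin 3) :=
    {φ | (∀ i, φ i ≠ 0) ∧ Finset.card {i | φ i = 1} = n} with hB
  have hω01 : ∀ i, ω i 0 ≤ ω i 1 := by
    rintro (i | i)
    · exact hd i
    · exact hd' i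
  have h1 : eliminantDegree ![2, n + 1, s] ω ≤
      ∑ q ∈ B.sigma fun φ => {i | φ i = 1}, ∏ i, ω i (q.1 i) := by
    refine sum_le_sum_of_exists_preimage (fun q => Function.update q.1 q.2 0) fun ψ _ hψ => ?_
    have hline : lineType ![2, n + 1, s] ψ 1 ≠ 0 := right_ne_zero_of_mul hψ
    have hline1 : lineType ![2, n + 1, s] ψ 1 = 1 := by
      unfold lineType at hline ⊢
      split_ifs at hline ⊢ <;> simp_all
    have hcount : ∀ l', Finset.card {i | ψ i = l'} + 1 + (if l' = 1 then 1 else 0) =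
        ![2, n + 1, s] l' := by
      by_contra hne
      exact hline (if_neg hne)
    have hc0 : Finset.card {i | ψ i = 0} = 1 := by simpa using hcount 0
    have hc1 : Finset.card {i | ψ i = 1} + 1 = n := by simpa using hcount 1
    obtain ⟨i₀, hi₀⟩ := Finset.card_eq_one.1 hc0
    have hψ0 : ∀ i, ψ i = 0 ↔ i = i₀ := fun i => by
      simpa using Finset.ext_iff.1 hi₀ i
    refine ⟨⟨Function.update ψ i₀ 1, i₀⟩, ?_, ?_, ?_⟩
    · have hset : ({i | Function.update ψ i₀ 1 i = 1} : Finset _) =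
          insert i₀ ({i | ψ i = 1} : Finset _) := by
        ext i
        rcases eq_or_ne i i₀ with rfl | hi <;> simp [*]
      simp only [Finset.mem_sigma, hB, Finset.mem_filter, Finset.mem_univ, true_and]
      refine ⟨⟨fun i => ?_, ?_⟩, by simp⟩
      · rcases eq_or_ne i i₀ with rfl | hi
        · simp
        · simpa [hi] using (hψ0 i).not.2 hi
      · rw [hset, Finset.card_insert_of_notMem, hc1]
        simp [(hψ0 i₀).2 rfl]
    · simp [← (hψ0 i₀).2 rfl]
    · rw [hline1, mul_one]
      refine Finset.prod_le_prod' fun i _ => ?_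
      rcases eq_or_ne i i₀ with rfl | hi
      · simpa [(hψ0 i).2 rfl] using hω01 i
      · simp [hi]
  have h2 : ∑ q ∈ B.sigma fun φ => {i | φ i = 1}, ∏ i, ω i (q.1 i) =
      n * ∑ φ ∈ B, ∏ i, ω i (φ i) := by
    rw [Finset.sum_sigma, Finset.mul_sum]
    refine Finset.sum_congr rfl fun φ hφ => ?_
    simp only [Finset.sum_const, smul_eq_mul, (Finset.mem_filter.1 hφ).2.2]
  have h3 : ∑ φ ∈ B, ∏ i, ω i (φ i) ≤
      ∑ E ∈ Finset.powersetCard (n - s) (Finset.univ : Finset (Fin (n - 1))),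
        (∏ i, d i) * ∏ j ∈ E, d' j := by
    refine sum_le_sum_of_exists_preimage
      (fun E => Sum.elim (fun _ => 1) fun j => if j ∈ E then 1 else 2) fun φ hφ hne => ?_
    obtain ⟨hφ0, hφ1⟩ := (Finset.mem_filter.1 hφ).2
    have hφl : ∀ i, φ (Sum.inl i) = 1 := fun i => by
      have h1 := hφ0 (Sum.inl i)
      have h2 : φ (Sum.inl i) ≠ 2 := fun h2 => hne (Finset.prod_eq_zero (Finset.mem_univ (Sum.inl i))
        (by simp [h2, hω]))
      generalize φ (Sum.inl i) = a at *
      fin_cases a <;> simp_all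
    have hφr : ∀ j, φ (Sum.inr j) = if φ (Sum.inr j) = 1 then 1 else 2 := fun j => by
      have h1 := hφ0 (Sum.inr j)
      generalize φ (Sum.inr j) = a at *
      fin_cases a <;> simp_all
    refine ⟨({j | φ (Sum.inr j) = 1} : Finset _), ?_, ?_, ?_⟩
    · rw [Finset.mem_powersetCard]
      refine ⟨Finset.subset_univ _, ?_⟩
      rw [Finset.card_filter, Fintype.sum_sum_type, ← Finset.card_filter, ← Finset.card_filter] at hφ1
      simp only [hφl, Finset.filter_true, Finset.card_univ, Fintype.card_fin] at hφ1
      omega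
    · funext i
      rcases i with i | j
      · simp [hφl]
      · simpa using (hφr j).symm
    · rw [Fintype.prod_sum_type]
      refine le_of_eq (congrArg₂ _ (by simp [hφl, hω]) ?_)
      rw [Finset.prod_filter]
      refine Finset.prod_congr rfl fun j _ => ?_
      by_cases hj : φ (Sum.inr j) = 1
      · rw [if_pos hj, hj]
        rfl
      · rw [if_neg hj, hφr j, if_neg hj]
        rfl
  calc _ ≤ _ := h1
    _ = _ := h2
    _ ≤ _ := Nat.mul_le_mul_left n (h3.trans_eq (Finset.mul_sum _ _ _).symm)

end Count

section DeformedSystem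

theorem prod_pow_mem_pow_s16 {K R α : Type*} [Field K] [CommRing R] [Algebra K R] [Fintype α]
    {W : Submodule K R} (hW : 1 ≤ W) {z : α → R} (hz : ∀ a, z a ∈ W) (m : α → ℕ) {D : ℕ}
    (hm : ∑ a, m a ≤ D) : ∏ a, z a ^ m a ∈ W ^ D := by
  have h1 : ∏ a, z a ^ m a ∈ W ^ ∑ a, m a := by
    rw [← Finset.prod_pow_eq_pow_sum]
    exact prod_mem_prod_submodule fun a _ => Submodule.pow_mem_pow _ (hz a) _
  obtain ⟨k, rfl⟩ := Nat.exists_eq_add_of_le hm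
  rw [pow_add]
  simpa using Submodule.mul_mem_mul h1 (Submodule.one_le.1 (one_le_pow_of_one_le' hW k))

theorem aeval_mem_pow {K R α : Type*} [Field K] [CommRing R] [Algebra K R] [Fintype α]
    {W : Submodule K R} (hW : 1 ≤ W) {z : α → R} (hz : ∀ a, z a ∈ W) (p : MvPolynomial α K) {D : ℕ}
    (hp : ∀ m ∈ p.support, ∑ a, m a ≤ D) : aeval z p ∈ W ^ D := by
  rw [aeval_def, eval₂_eq']
  simp only [← Algebra.smul_def]
  refine Submodule.sum_mem _ fun m hm => Submodule.smul_mem _ _ ?_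
  exact prod_pow_mem_pow_s16 hW hz m (hp m hm)

theorem aeval_mem_pow_mul_pow {K R α β : Type*} [Field K] [CommRing R] [Algebra K R] [Fintype α]
    [Fintype β] {W W' : Submodule K R} (hW : 1 ≤ W) (hW' : 1 ≤ W') {z : α ⊕ β → R}
    (hz : ∀ a, z (Sum.inl a) ∈ W) (hz' : ∀ b, z (Sum.inr b) ∈ W') (p : MvPolynomial (α ⊕ β) K)
    {D D' : ℕ} (hp : ∀ m ∈ p.support, ∑ a, m (Sum.inl a) ≤ D)
    (hp' : ∀ m ∈ p.support, ∑ b, m (Sum.inr b) ≤ D') : aeval z p ∈ W ^ D * W' ^ D' := by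
  rw [aeval_def, eval₂_eq']
  simp only [← Algebra.smul_def]
  refine Submodule.sum_mem _ fun m hm => Submodule.smul_mem _ _ ?_
  rw [Fintype.prod_sum_type]
  exact Submodule.mul_mem_mul (prod_pow_mem_pow_s16 hW hz (fun a => m (Sum.inl a)) (hp m hm))
    (prod_pow_mem_pow_s16 hW' hz' (fun b => m (Sum.inr b)) (hp' m hm))

variable {K : Type*} [Field K] {n s : ℕ}

/-- The deformed system, as polynomials in `t` (of index `none`), `x` and `μ'`. -/
noncomputable def deformedSystem (h g : Fin s → MvPolynomial (Fin n) K)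
    (h' g' : Fin (n - 1) → MvPolynomial (Fin n ⊕ Fin s) K) :
    Fin s ⊕ Fin (n - 1) → MvPolynomial (Option (Fin n ⊕ Fin (s - 1))) K :=
  Sum.elim
    (fun i => (1 - X none) * aeval (fun j => X (some (Sum.inl j))) (h i) +
      X none * aeval (fun j => X (some (Sum.inl j))) (g i))
    fun i =>
      (1 - X none) * aeval (ptExt (fun j => X (some (Sum.inl j))) fun k => X (some (Sum.inr k)))
        (h' i) +
      X none * aeval (ptExt (fun j => X (some (Sum.inl j))) fun k => X (some (Sum.inr k))) (g' i)

/-- The group of variables, `t`, `x` or `μ'`, to which a variable belongs. -/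
def varLabel (n s : ℕ) : Option (Fin n ⊕ Fin (s - 1)) → Fin 3 :=
  fun o => o.elim 0 (Sum.elim (fun _ => 1) fun _ => 2)

theorem algHom_ptExt {R S : Type*} [CommRing R] [CommRing S] [Algebra K R] [Algebra K S]
    (f : R →ₐ[K] S) (x : Fin n → R) (μ : Fin (s - 1) → R) :
    (fun o => f (ptExt x μ o)) = ptExt (s := s) (fun j => f (x j)) fun k => f (μ k) := by
  funext o
  rcases o with j | k
  · rfl
  · simp only [ptExt, Sum.elim_inr]
    split_ifs <;> simp

theorem aeval_deformedSystem_eq_zero_iff {M : Type*} [Field M] [Algebra K M] (t : M)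
    (h g : Fin s → MvPolynomial (Fin n) K) (h' g' : Fin (n - 1) → MvPolynomial (Fin n ⊕ Fin s) K)
    (S : Fin n ⊕ Fin (s - 1) → M) :
    (∀ i, aeval (fun o : Option _ => o.elim t S) (deformedSystem h g h' g' i) = 0) ↔
      (fun j => S (Sum.inl j), fun k => S (Sum.inr k)) ∈ SolsF M t h g h' g' := by
  have h1 : ∀ p : MvPolynomial (Fin n) K, aeval (fun o : Option _ => o.elim t S)
      (aeval (fun j => (X (some (Sum.inl j)) : MvPolynomial (Option (Fin n ⊕ Fin (s - 1))) K)) p) =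
      aeval (fun j => S (Sum.inl j)) p := fun p => by
    rw [← AlgHom.comp_apply, comp_aeval]
    simp
  have h2 : ∀ p : MvPolynomial (Fin n ⊕ Fin s) K, aeval (fun o : Option _ => o.elim t S)
      (aeval (ptExt (fun j => (X (some (Sum.inl j)) : MvPolynomial (Option (Fin n ⊕ Fin (s - 1))) K))
        fun k => X (some (Sum.inr k))) p) =
      aeval (ptExt (fun j => S (Sum.inl j)) fun k => S (Sum.inr k)) p := fun p => by
    rw [← AlgHom.comp_apply, comp_aeval, algHom_ptExt]
    simp
  simp only [SolsF, deformedSystem, Sum.forall, Sum.elim_inl, Sum.elim_inr, map_add, map_mul,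
    map_sub, map_one, aeval_X, Option.elim_none, h1, h2, Set.mem_ofPred_eq]

theorem deformedSystem_mem_multiPiece {d : Fin s → ℕ} {d' : Fin (n - 1) → ℕ}
    {h g : Fin s → MvPolynomial (Fin n) K} {h' g' : Fin (n - 1) → MvPolynomial (Fin n ⊕ Fin s) K}
    (hh : ∀ i, (h i).totalDegree ≤ d i) (hg : ∀ i, (g i).totalDegree ≤ d i)
    (hh'x : ∀ i, ∀ mon ∈ (h' i).support, (∑ j : Fin n, mon (Sum.inl j)) ≤ d' i)
    (hh'mu : ∀ i, ∀ mon ∈ (h' i).support, (∑ k : Fin s, mon (Sum.inr k)) = 1)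
    (hg'x : ∀ i, ∀ mon ∈ (g' i).support, (∑ j : Fin n, mon (Sum.inl j)) ≤ d' i)
    (hg'mu : ∀ i, ∀ mon ∈ (g' i).support, (∑ k : Fin s, mon (Sum.inr k)) = 1)
    (i : Fin s ⊕ Fin (n - 1)) :
    deformedSystem h g h' g' i ∈ multiPiece (varSpan K (varLabel n s))
      (Sum.elim (fun i => ![1, d i, 0]) (fun j => ![1, d' j, 1]) i) := by
  have hX : (X none : MvPolynomial (Option (Fin n ⊕ Fin (s - 1))) K) ∈
      varSpan K (varLabel n s) 0 := X_mem_varSpan (label := varLabel n s) none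
  have h1X : (1 - X none : MvPolynomial (Option (Fin n ⊕ Fin (s - 1))) K) ∈
      varSpan K (varLabel n s) 0 :=
    Submodule.sub_mem _ (Submodule.one_le.1 (one_le_varSpan 0)) hX
  have hx : ∀ j : Fin n, (X (some (Sum.inl j)) : MvPolynomial (Option (Fin n ⊕ Fin (s - 1))) K) ∈
      varSpan K (varLabel n s) 1 := fun j =>
    X_mem_varSpan (label := varLabel n s) (some (Sum.inl j))
  have hμ : ∀ k : Fin s, (ptExt (fun j => X (some (Sum.inl j))) (fun k => X (some (Sum.inr k)))
      (Sum.inr k) : MvPolynomial (Option (Fin n ⊕ Fin (s - 1))) K) ∈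
      varSpan K (varLabel n s) 2 := fun k => by
    simp only [ptExt, Sum.elim_inr]
    split_ifs with hk
    · exact X_mem_varSpan (label := varLabel n s) (some (Sum.inr ⟨k, hk⟩))
    · exact Submodule.one_le.1 (one_le_varSpan 2)
  have h1 : 1 ≤ varSpan K (varLabel n s) 1 := one_le_varSpan 1
  have h2 : 1 ≤ varSpan K (varLabel n s) 2 := one_le_varSpan 2
  rcases i with i | i
  · have key : ∀ p : MvPolynomial (Fin n) K, p.totalDegree ≤ d i →
        aeval (fun j => (X (some (Sum.inl j)) : MvPolynomial (Option (Fin n ⊕ Fin (s - 1))) K)) p ∈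
          varSpan K (varLabel n s) 1 ^ d i := fun p hp => by
      refine aeval_mem_pow (W := varSpan K (varLabel n s) 1) h1 hx p fun m hm => ?_
      have := le_totalDegree hm
      rw [Finsupp.sum_fintype _ _ fun _ => rfl] at this
      exact this.trans hp
    simp only [multiPiece, Fin.prod_univ_three, Sum.elim_inl, deformedSystem, Matrix.cons_val,
      pow_one, pow_zero, mul_one]
    exact Submodule.add_mem _ (Submodule.mul_mem_mul h1X (key _ (hh i)))
      (Submodule.mul_mem_mul hX (key _ (hg i)))
  · have key : ∀ p : MvPolynomial (Fin n ⊕ Fin s) K,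
        (∀ mon ∈ p.support, (∑ j : Fin n, mon (Sum.inl j)) ≤ d' i) →
        (∀ mon ∈ p.support, (∑ k : Fin s, mon (Sum.inr k)) = 1) →
        (aeval (ptExt (fun j => X (some (Sum.inl j))) fun k => X (some (Sum.inr k))) p :
          MvPolynomial (Option (Fin n ⊕ Fin (s - 1))) K) ∈
          varSpan K (varLabel n s) 1 ^ d' i * varSpan K (varLabel n s) 2 := fun p hp hp' => by
      have := aeval_mem_pow_mul_pow h1 h2
        (z := ptExt (fun j => X (some (Sum.inl j))) fun k => X (some (Sum.inr k))) hx hμ p hp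
        fun m hm => (hp' m hm).le
      rwa [pow_one] at this
    simp only [multiPiece, Fin.prod_univ_three, Sum.elim_inr, deformedSystem, Matrix.cons_val,
      pow_one, mul_assoc]
    exact Submodule.add_mem _ (Submodule.mul_mem_mul h1X (key _ (hh'x i) (hh'mu i)))
      (Submodule.mul_mem_mul hX (key _ (hg'x i) (hg'mu i)))

theorem card_varLabel (hs : 2 ≤ s) (l : Fin 3) :
    ![2, n + 1, s] l = Fintype.card {o // varLabel n s o = l} + 1 := by
  rw [Fintype.card_subtype, Finset.card_filter, Fintype.sum_option, Fintype.sum_sum_type]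
  fin_cases l <;> simp [varLabel]
  omega

theorem exists_eliminant_deformedSystem [Infinite K] {M : Type w} [Field M] [Algebra K M]
    [IsAlgClosed M] (t : M) (hs : 2 ≤ s) (hsn : s ≤ n - 1) {d : Fin s → ℕ} {d' : Fin (n - 1) → ℕ}
    {h g : Fin s → MvPolynomial (Fin n) K} {h' g' : Fin (n - 1) → MvPolynomial (Fin n ⊕ Fin s) K}
    (hh : ∀ i, (h i).totalDegree ≤ d i) (hg : ∀ i, (g i).totalDegree ≤ d i)
    (hh'x : ∀ i, ∀ mon ∈ (h' i).support, (∑ j : Fin n, mon (Sum.inl j)) ≤ d' i)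
    (hh'mu : ∀ i, ∀ mon ∈ (h' i).support, (∑ k : Fin s, mon (Sum.inr k)) = 1)
    (hg'x : ∀ i, ∀ mon ∈ (g' i).support, (∑ j : Fin n, mon (Sum.inl j)) ≤ d' i)
    (hg'mu : ∀ i, ∀ mon ∈ (g' i).support, (∑ k : Fin s, mon (Sum.inr k)) = 1)
    (hfin : (SolsF M t h g h' g').Finite) :
    ∃ (B : ℕ) (γ : Fin (eliminantDegree ![2, n + 1, s]
        (Sum.elim (fun i => ![1, d i, 0]) fun j => ![1, d' j, 1]) + 1) × Fin (B + 1) →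
        MvPolynomial (Fin n) K), γ ≠ 0 ∧
      ∀ S ∈ SolsF M t h g h' g',
        ∑ k, map (algebraMap K M) (γ k) *
          (C t ^ (k.1 : ℕ) * (∑ j, X j * C (S.1 j)) ^ (k.2 : ℕ)) = 0 := by
  obtain ⟨B, γ, hγ, hS⟩ := exists_eliminant (σ := Fin n ⊕ Fin (s - 1))
    (ι := Fin s ⊕ Fin (n - 1)) (by simp; omega) (varLabel n s) ![2, n + 1, s]
    (card_varLabel hs)
    (fun l => by fin_cases l <;> simp <;> omega) _ (deformedSystem h g h' g')
    (deformedSystem_mem_multiPiece hh hg hh'x hh'mu hg'x hg'mu) t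
    (by
      simp only [aeval_deformedSystem_eq_zero_iff]
      refine Set.Finite.preimage (Function.Injective.injOn fun S S' hSS => ?_) hfin
      funext o
      rcases o with j | k
      · exact congrFun (congrArg Prod.fst hSS) j
      · exact congrFun (congrArg Prod.snd hSS) k)
    rfl (Sum.inl : Fin n → Fin n ⊕ Fin (s - 1)) fun _ => rfl
  refine ⟨B, γ, hγ, fun S hmem => hS (Sum.elim S.1 S.2) ?_⟩
  rw [aeval_deformedSystem_eq_zero_iff]
  exact hmem

end DeformedSystem

section Solutions

variable {K : Type*} [Field K] {n s : ℕ} {M : Type*} [Field M] [Algebra K M] {t : M}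
  {h g : Fin s → MvPolynomial (Fin n) K} {h' g' : Fin (n - 1) → MvPolynomial (Fin n ⊕ Fin s) K}

theorem algHom_mem_SolsF {S : (Fin n → M) × (Fin (s - 1) → M)} (hS : S ∈ SolsF M t h g h' g')
    (f : M →ₐ[K] M) (hf : f t = t) :
    ((fun j => f (S.1 j)), fun k => f (S.2 k)) ∈ SolsF M t h g h' g' := by
  have h1 : ∀ p : MvPolynomial (Fin n) K, aeval (fun j => f (S.1 j)) p = f (aeval S.1 p) :=
    fun p => by
      rw [← AlgHom.comp_apply, comp_aeval]
  have h2 : ∀ p : MvPolynomial (Fin n ⊕ Fin s) K,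
      aeval (ptExt (fun j => f (S.1 j)) fun k => f (S.2 k)) p = f (aeval (ptExt S.1 S.2) p) :=
    fun p => by
      rw [← AlgHom.comp_apply, comp_aeval, algHom_ptExt]
  refine ⟨fun i => ?_, fun i => ?_⟩
  · have := congrArg f (hS.1 i)
    simpa only [h1, map_add, map_mul, map_sub, map_one, hf, map_zero] using this
  · have := congrArg f (hS.2 i)
    simpa only [h2, map_add, map_mul, map_sub, map_one, hf, map_zero] using this

theorem prod_pow_eq_of_sum_eq_one {β : Type*} [Fintype β] {m : β → ℕ} (hm : ∑ b, m b = 1) :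
    ∃ b₀, ∀ ν : β → M, ∏ b, ν b ^ m b = ν b₀ := by
  classical
  obtain ⟨b₀, -, hb₀⟩ : ∃ b ∈ Finset.univ, m b ≠ 0 :=
    Finset.exists_ne_zero_of_sum_ne_zero (by rw [hm]; exact one_ne_zero)
  rw [← Finset.add_sum_erase _ _ (Finset.mem_univ b₀)] at hm
  have h0 : ∀ b ∈ Finset.univ.erase b₀, m b = 0 := Finset.sum_eq_zero_iff.1 (by omega)
  refine ⟨b₀, fun ν => ?_⟩
  rw [← Finset.mul_prod_erase _ _ (Finset.mem_univ b₀),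
    Finset.prod_eq_one fun b hb => by rw [h0 b hb, pow_zero], mul_one]
  have : m b₀ = 1 := by omega
  rw [this, pow_one]

theorem aeval_lineMap {α β : Type*} [Fintype α] [Fintype β] (p : MvPolynomial (α ⊕ β) K)
    (hp : ∀ m ∈ p.support, ∑ b, m (Sum.inr b) = 1) (x : α → M) (ν ν' : β → M) (c : M) :
    aeval (Sum.elim x fun b => (1 - c) * ν b + c * ν' b) p =
      (1 - c) * aeval (Sum.elim x ν) p + c * aeval (Sum.elim x ν') p := by
  simp only [aeval_def, eval₂_eq', Finset.mul_sum, ← Finset.sum_add_distrib]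
  refine Finset.sum_congr rfl fun m hm => ?_
  obtain ⟨b₀, hb₀⟩ := prod_pow_eq_of_sum_eq_one (M := M) (hp m hm)
  simp only [Fintype.prod_sum_type, Sum.elim_inl, Sum.elim_inr, hb₀]
  ring

theorem SolsF_fst_injOn [Infinite M]
    (hh'mu : ∀ i, ∀ mon ∈ (h' i).support, (∑ k : Fin s, mon (Sum.inr k)) = 1)
    (hg'mu : ∀ i, ∀ mon ∈ (g' i).support, (∑ k : Fin s, mon (Sum.inr k)) = 1)
    (hfin : (SolsF M t h g h' g').Finite) : Set.InjOn Prod.fst (SolsF M t h g h' g') := by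
  rintro ⟨x, μ⟩ hS ⟨x', μ'⟩ hS' (rfl : x = x')
  by_contra hne
  obtain ⟨k₀, hk₀⟩ : ∃ k, μ k ≠ μ' k := by
    by_contra! hall
    exact hne (by rw [funext hall])
  have hpt : ∀ c : M, ptExt (s := s) x (fun k => (1 - c) * μ k + c * μ' k) =
      Sum.elim x fun k => (1 - c) * ptExt x μ (Sum.inr k) + c * ptExt x μ' (Sum.inr k) := fun c => by
    funext o
    rcases o with j | k
    · rfl
    · simp only [ptExt, Sum.elim_inr]
      split_ifs
      · rfl
      · ring
  have helim : ∀ μ : Fin (s - 1) → M,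
      (Sum.elim x fun k => ptExt x μ (Sum.inr k)) = ptExt (s := s) x μ := fun μ => by
    funext o
    rcases o with j | k <;> rfl
  have hline : ∀ c : M, (x, fun k => (1 - c) * μ k + c * μ' k) ∈ SolsF M t h g h' g' := by
    refine fun c => ⟨hS.1, fun i => ?_⟩
    have e1 := hS.2 i
    have e2 := hS'.2 i
    simp only at e1 e2 ⊢
    rw [hpt, aeval_lineMap _ (hh'mu i), aeval_lineMap _ (hg'mu i), helim, helim]
    linear_combination (1 - c) * e1 + c * e2
  refine Set.infinite_of_injective_forall_mem (fun c c' hcc => ?_) hline hfin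
  have h1 := congrFun (congrArg Prod.snd hcc) k₀
  simp only at h1
  have h2 : (c - c') * (μ' k₀ - μ k₀) = 0 := by linear_combination h1
  rcases mul_eq_zero.1 h2 with h2 | h2
  · exact sub_eq_zero.1 h2
  · exact absurd (sub_eq_zero.1 h2).symm hk₀

theorem coeff_prod_mem_range {k : Type*} [Field k] [Algebra k M] [IsGalois k M] [Algebra K k]
    [IsScalarTower K k M] (ht : t ∈ Set.range (algebraMap k M))
    (hfin : (SolsF M t h g h' g').Finite) (mon : Option (Fin n) →₀ ℕ) :
    (∏ S ∈ hfin.toFinset,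
      (X (none : Option (Fin n)) - ∑ j : Fin n, C (S.1 j) * X (some j))).coeff mon ∈
      Set.range (algebraMap k M) := by
  rw [InfiniteGalois.mem_range_algebraMap_iff_fixed]
  intro f
  obtain ⟨t₀, rfl⟩ := ht
  have hmem : ∀ (f : M ≃ₐ[k] M), ∀ S ∈ hfin.toFinset,
      ((fun j => f (S.1 j)), fun k => f (S.2 k)) ∈ hfin.toFinset := fun f S hS => by
    rw [Set.Finite.mem_toFinset] at hS ⊢
    exact algHom_mem_SolsF hS ((f : M →ₐ[k] M).restrictScalars K) (by simp)
  have hmap : map (f : M →+* M) (∏ S ∈ hfin.toFinset,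
      (X (none : Option (Fin n)) - ∑ j : Fin n, C (S.1 j) * X (some j))) =
      ∏ S ∈ hfin.toFinset, (X (none : Option (Fin n)) - ∑ j : Fin n, C (S.1 j) * X (some j)) := by
    rw [map_prod]
    refine Finset.prod_nbij' (fun S => ((fun j => f (S.1 j)), fun k => f (S.2 k)))
      (fun S => ((fun j => f.symm (S.1 j)), fun k => f.symm (S.2 k))) (hmem f) (hmem f.symm)
      (fun S _ => by simp) (fun S _ => by simp) fun S _ => by simp
  conv_rhs => rw [← hmap, coeff_map]
  rfl

end Solutions

section Divisibility

/-- The exchange of the coefficient variable of a multivariate polynomial over `R[X]` with the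
remaining variables. -/
noncomputable def swapPolynomial (σ R : Type*) [CommRing R] :
    MvPolynomial σ (Polynomial R) →+* Polynomial (MvPolynomial σ R) :=
  eval₂Hom (Polynomial.mapRingHom C) fun i => Polynomial.C (X i)

theorem coeff_coeff_swapPolynomial {σ R : Type*} [CommRing R] (p : MvPolynomial σ (Polynomial R))
    (k : ℕ) (m : σ →₀ ℕ) :
    ((swapPolynomial σ R p).coeff k).coeff m = (p.coeff m).coeff k := by
  classical
  induction p using MvPolynomial.induction_on' with
  | monomial u a =>
    have h : swapPolynomial σ R (monomial u a) =
        Polynomial.map C a * Polynomial.C (monomial u 1) := by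
      rw [swapPolynomial, coe_eval₂Hom, eval₂_monomial, Polynomial.coe_mapRingHom,
        monomial_eq (a := (1 : R)), C_1, one_mul, Finsupp.prod, Finsupp.prod, map_prod]
      simp
    rw [h, Polynomial.coeff_mul_C, Polynomial.coeff_map, coeff_C_mul, coeff_monomial,
      coeff_monomial]
    split_ifs <;> simp
  | add p q hp hq => simp only [map_add, Polynomial.coeff_add, coeff_add, hp, hq]

theorem swapPolynomial_injective (σ R : Type*) [CommRing R] :
    Function.Injective (swapPolynomial σ R) := fun p q hpq => by
  ext m k
  rw [← coeff_coeff_swapPolynomial, hpq, coeff_coeff_swapPolynomial]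

theorem natDegree_coeff_le_of_dvd {σ R : Type*} [CommRing R] [IsDomain R]
    {p q : MvPolynomial σ (Polynomial R)} (hpq : p ∣ q) (hq : q ≠ 0) {δ : ℕ}
    (hδ : ∀ m, (q.coeff m).natDegree ≤ δ) (m : σ →₀ ℕ) : (p.coeff m).natDegree ≤ δ := by
  have hle : (swapPolynomial σ R q).natDegree ≤ δ := by
    refine Polynomial.natDegree_le_iff_coeff_eq_zero.2 fun k hk => ?_
    ext m
    rw [coeff_coeff_swapPolynomial, coeff_zero]
    exact Polynomial.coeff_eq_zero_of_natDegree_lt ((hδ m).trans_lt hk)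
  have hdvd := (Polynomial.natDegree_le_of_dvd (map_dvd (swapPolynomial σ R) hpq)
    ((map_ne_zero_iff _ (swapPolynomial_injective σ R)).2 hq)).trans hle
  refine Polynomial.natDegree_le_iff_coeff_eq_zero.2 fun k hk => ?_
  rw [← coeff_coeff_swapPolynomial, Polynomial.coeff_eq_zero_of_natDegree_lt (hdvd.trans_lt hk),
    coeff_zero]

theorem dvd_of_dvd_C_mul {σ A : Type*} [CommRing A] [IsDomain A] [UniqueFactorizationMonoid A]
    {p : MvPolynomial σ A} (hp : ∀ π : A, Prime π → ¬ C π ∣ p) {r : A} (hr : r ≠ 0) :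
    ∀ {q : MvPolynomial σ A}, p ∣ C r * q → p ∣ q := by
  induction r using UniqueFactorizationMonoid.induction_on_prime with
  | h₁ => exact absurd rfl hr
  | h₂ r hu => exact fun h => ((hu.map C).dvd_mul_left).1 h
  | h₃ r π hr0 hπ ih =>
    rintro q ⟨w, hw⟩
    have hπ' : Prime (C π : MvPolynomial σ A) := (prime_C_iff σ).2 hπ
    have hdvd : C π ∣ p * w := by
      rw [← hw, C_mul, mul_assoc]
      exact dvd_mul_right _ _
    obtain ⟨w, rfl⟩ := (hπ'.dvd_or_dvd hdvd).resolve_left (hp π hπ)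
    refine ih hr0 ⟨w, mul_left_cancel₀ hπ'.ne_zero ?_⟩
    rw [← mul_assoc, ← C_mul, hw]
    ring

section Localization

attribute [local instance] MvPolynomial.algebraMvPolynomial

theorem dvd_of_map_dvd_map {σ A k : Type*} [CommRing A] [IsDomain A] [UniqueFactorizationMonoid A]
    [Field k] [Algebra A k] [IsFractionRing A k] {p q : MvPolynomial σ A}
    (hp : ∀ π : A, Prime π → ¬ C π ∣ p)
    (hpq : map (algebraMap A k) p ∣ map (algebraMap A k) q) : p ∣ q := by
  obtain ⟨R, hR⟩ := hpq
  obtain ⟨⟨-, r, hr, rfl⟩, R₁, hR₁⟩ := IsLocalization.exists_integer_multiple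
    ((nonZeroDivisors A).map (C : A →+* MvPolynomial σ A)) R
  refine dvd_of_dvd_C_mul hp (nonZeroDivisors.ne_zero hr) (q := q) ⟨R₁, ?_⟩
  apply map_injective _ (IsFractionRing.injective A k)
  have hR₁' : map (algebraMap A k) R₁ = C (algebraMap A k r) * R := by
    rw [Algebra.smul_def] at hR₁
    rw [← map_C]
    exact hR₁
  rw [map_mul, map_mul, map_C, hR, hR₁']
  ring

end Localization

theorem optionEquivLeft_map {σ R S : Type*} [CommRing R] [CommRing S] (f : R →+* S)
    (p : MvPolynomial (Option σ) R) :
    optionEquivLeft S σ (map f p) = (optionEquivLeft R σ p).map (map f) := by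
  induction p using MvPolynomial.induction_on with
  | C a => simp
  | add p q hp hq => simp [hp, hq]
  | mul_X p i hp => cases i <;> simp [hp]

/-- A product of distinct linear factors divides every polynomial vanishing at its roots, already
over any subfield containing its coefficients. -/
theorem dvd_of_forall_eval_eq_zero {σ ι k M : Type*} [Field k] [Field M] [Algebra k M]
    (s : Finset ι) (a : ι → MvPolynomial σ M) (ha : Set.InjOn a s)
    {p q : MvPolynomial (Option σ) k} (hq : q ≠ 0)
    (hp : optionEquivLeft M σ (map (algebraMap k M) p) =
      ∏ i ∈ s, (Polynomial.X - Polynomial.C (a i)))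
    (heval : ∀ i ∈ s, (optionEquivLeft M σ (map (algebraMap k M) q)).eval (a i) = 0) : p ∣ q := by
  classical
  have hinj : Function.Injective (map (algebraMap k M) : MvPolynomial σ k →+* MvPolynomial σ M) :=
    map_injective _ (algebraMap k M).injective
  have hmonic : (optionEquivLeft M σ (map (algebraMap k M) p)).Monic := by
    rw [hp]
    exact Polynomial.monic_prod_of_monic _ _ fun i _ => Polynomial.monic_X_sub_C _
  have hq0 : optionEquivLeft M σ (map (algebraMap k M) q) ≠ 0 := by
    rw [optionEquivLeft_map]
    refine (Polynomial.map_ne_zero_iff hinj).2 ?_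
    simpa using hq
  have hdvd : optionEquivLeft M σ (map (algebraMap k M) p) ∣
      optionEquivLeft M σ (map (algebraMap k M) q) := by
    have hval : s.val.map (fun i => Polynomial.X - Polynomial.C (a i)) =
        (s.val.map a).map fun b => Polynomial.X - Polynomial.C b := by
      rw [Multiset.map_map]
      rfl
    rw [hp, Finset.prod, hval, Multiset.prod_X_sub_C_dvd_iff_le_roots hq0,
      Multiset.le_iff_subset (Multiset.Nodup.map_on (fun x hx y hy h => ha hx hy h) s.nodup)]
    intro b hb
    obtain ⟨i, hi, rfl⟩ := Multiset.mem_map.1 hb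
    exact (Polynomial.mem_roots hq0).2 (heval i hi)
  rw [optionEquivLeft_map] at hmonic
  rw [optionEquivLeft_map, optionEquivLeft_map,
    Polynomial.map_dvd_map _ hinj (Polynomial.monic_of_injective hinj hmonic)] at hdvd
  exact (map_dvd_iff (optionEquivLeft k σ)).1 hdvd

/-- The polynomial `∑ γ_{ij}(y) t^i U^j`, where `U` is the variable of index `none` and `t` is
the variable of the coefficient ring. -/
noncomputable def relationPolynomial {σ K : Type*} [Field K] {a b : ℕ}
    (γ : Fin a × Fin b → MvPolynomial σ K) : MvPolynomial (Option σ) (Polynomial K) :=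
  ∑ k, rename some (map Polynomial.C (γ k)) *
    (C (Polynomial.X ^ (k.1 : ℕ)) * X none ^ (k.2 : ℕ))

theorem optionEquivLeft_rename_some {σ R : Type*} [CommRing R] (p : MvPolynomial σ R) :
    optionEquivLeft R σ (rename some p) = Polynomial.C p := by
  induction p using MvPolynomial.induction_on with
  | C a => simp
  | add p q hp hq => simp [hp, hq]
  | mul_X p i hp => simp [hp]

theorem optionEquivLeft_map_relationPolynomial {σ K M : Type*} [Field K] [CommRing M] {a b : ℕ}
    (γ : Fin a × Fin b → MvPolynomial σ K) (f : Polynomial K →+* M) :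
    optionEquivLeft M σ (map f (relationPolynomial γ)) =
      ∑ k, Polynomial.C (map (f.comp Polynomial.C) (γ k) * C (f Polynomial.X) ^ (k.1 : ℕ)) *
        Polynomial.X ^ (k.2 : ℕ) := by
  rw [relationPolynomial, map_sum, map_sum]
  refine Finset.sum_congr rfl fun k _ => ?_
  rw [map_mul, map_mul, map_rename, optionEquivLeft_rename_some, map_map]
  simp [mul_assoc]

theorem coeff_coeff_relationPolynomial {σ K : Type*} [Field K] {a b : ℕ}
    (γ : Fin a × Fin b → MvPolynomial σ K) (m : Option σ →₀ ℕ) (i : ℕ) :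
    ((relationPolynomial γ).coeff m).coeff i =
      ∑ k, if (k.1 : ℕ) = i ∧ (k.2 : ℕ) = m none then (γ k).coeff m.some else 0 := by
  have h := optionEquivLeft_map_relationPolynomial γ (RingHom.id _)
  rw [map_id] at h
  rw [← optionEquivLeft_coeff_some_coeff_none, h, Polynomial.finsetSum_coeff, coeff_sum,
    Polynomial.finsetSum_coeff]
  refine Finset.sum_congr rfl fun k _ => ?_
  rw [Polynomial.coeff_C_mul_X_pow, RingHom.id_apply, RingHom.id_comp, ← C_pow]
  by_cases h2 : (k.2 : ℕ) = m none
  · rw [if_pos h2.symm, mul_comm, coeff_C_mul, coeff_map, Polynomial.coeff_mul_C,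
      Polynomial.coeff_X_pow]
    by_cases h1 : (k.1 : ℕ) = i
    · simp [h1, h2]
    · simp [h1, Ne.symm h1]
  · simp [h2, Ne.symm h2]

theorem relationPolynomial_ne_zero {σ K : Type*} [Field K] {a b : ℕ}
    {γ : Fin a × Fin b → MvPolynomial σ K} (hγ : γ ≠ 0) : relationPolynomial γ ≠ 0 := by
  refine fun h0 => hγ (funext fun k => MvPolynomial.ext _ _ fun m => ?_)
  have h := coeff_coeff_relationPolynomial γ (m.optionElim k.2) k.1
  rw [h0, coeff_zero, Polynomial.coeff_zero, Finset.sum_eq_single k] at h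
  · simpa using h.symm
  · refine fun l _ hl => if_neg fun hlk => hl ?_
    exact Prod.ext (Fin.ext hlk.1) (Fin.ext (by simpa using hlk.2))
  · exact fun hk => absurd (Finset.mem_univ k) hk

theorem natDegree_coeff_relationPolynomial_le {σ K : Type*} [Field K] {a b : ℕ}
    (γ : Fin (a + 1) × Fin b → MvPolynomial σ K) (m : Option σ →₀ ℕ) :
    ((relationPolynomial γ).coeff m).natDegree ≤ a := by
  refine Polynomial.natDegree_le_iff_coeff_eq_zero.2 fun i hi => ?_
  rw [coeff_coeff_relationPolynomial]
  exact Finset.sum_eq_zero fun k _ => if_neg fun hk => by have := k.1.2; omega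

end Divisibility

end

theorem statement16 (K : Subfield ℝ)
    (L : Type*) [Field L] [Algebra ↥K L] [IsAlgClosure ↥K L]
    (M : Type*) [Field M] [Algebra ↥K M] [Algebra (RatFunc ↥K) M]
    [IsScalarTower ↥K (RatFunc ↥K) M] [IsAlgClosure (RatFunc ↥K) M]
    (n s : ℕ) (hn : 3 ≤ n) (hs : 2 ≤ s) (hsn : s ≤ n - 1)
    (d : Fin s → ℕ) (d' : Fin (n - 1) → ℕ) (hd : ∀ i, 0 < d i) (hd' : ∀ i, 0 < d' i)
    (h g : Fin s → MvPolynomial (Fin n) ↥K)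
    (h' g' : Fin (n - 1) → MvPolynomial (Fin n ⊕ Fin s) ↥K)
    (hhdeg : ∀ i, (h i).totalDegree ≤ d i)
    (hgdeg : ∀ i, (g i).totalDegree = d i)
    (hh'x : ∀ i, ∀ mon ∈ (h' i).support, (∑ j : Fin n, mon (Sum.inl j)) ≤ d' i)
    (hh'mu : ∀ i, ∀ mon ∈ (h' i).support, (∑ k : Fin s, mon (Sum.inr k)) = 1)
    (hg'xle : ∀ i, ∀ mon ∈ (g' i).support, (∑ j : Fin n, mon (Sum.inl j)) ≤ d' i)
    (hg'xeq : ∀ i, ∃ mon ∈ (g' i).support, (∑ j : Fin n, mon (Sum.inl j)) = d' i)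
    (hg'mu : ∀ i, ∀ mon ∈ (g' i).support, (∑ k : Fin s, mon (Sum.inr k)) = 1)
    (D : ℕ)
    (hD : D = (∏ i, d i) *
      ∑ E ∈ Finset.powersetCard (n - s) (Finset.univ : Finset (Fin (n - 1))),
        ∏ j ∈ E, d' j)
    (e : (Fin s ⊕ Fin (n - 1)) ≃ (Fin n ⊕ Fin (s - 1)))
    -- condition (H) on the initial system
    (hHfin : (Sols0 L g g').Finite)
    (hHcard : (Sols0 L g g').ncard = D)
    (hHinj : ∀ p ∈ Sols0 L g g', ∀ q ∈ Sols0 L g g', p.1 = q.1 → p = q)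
    (hHjac : ∀ p ∈ Sols0 L g g', (jacMat L g g' e p.1 p.2).det ≠ 0)
    -- the finite set of solutions of the deformed system over `M`
    (hfinF : (SolsF M (algebraMap (RatFunc ↥K) M RatFunc.X) h g h' g').Finite)
    -- `P(U, y) = ∏_{i=1}^{D} (U - ∑_j y_j (S_i)_j)`, where `U` is the variable of
    -- index `none` and `y_j` the variable of index `some j`
    (P : MvPolynomial (Option (Fin n)) M)
    (hP : P = ∏ S ∈ hfinF.toFinset,
      (X (none : Option (Fin n)) - ∑ j : Fin n, C (S.1 j) * X (some j))) :
    (∀ mon : Option (Fin n) →₀ ℕ,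
      P.coeff mon ∈ Set.range (algebraMap (RatFunc ↥K) M)) ∧
    ∀ Phat : MvPolynomial (Option (Fin n)) (Polynomial ↥K), ∀ qden : Polynomial ↥K,
      MvPolynomial.map
          ((algebraMap (RatFunc ↥K) M).comp (algebraMap (Polynomial ↥K) (RatFunc ↥K)))
          Phat =
        C ((algebraMap (RatFunc ↥K) M)
            ((algebraMap (Polynomial ↥K) (RatFunc ↥K)) qden)) * P →
      (∀ w : Polynomial ↥K, MvPolynomial.C w ∣ Phat → w.natDegree = 0) →
      ∀ mon : Option (Fin n) →₀ ℕ, (Phat.coeff mon).natDegree ≤ n * D := by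
  have hchar : CharZero (RatFunc K) := charZero_of_injective_algebraMap
    (algebraMap K (RatFunc K)).injective
  have : IsAlgClosed M := IsAlgClosure.isAlgClosed (RatFunc K)
  have : CharZero M := charZero_of_injective_algebraMap (algebraMap (RatFunc K) M).injective
  have hcoeff : ∀ mon : Option (Fin n) →₀ ℕ,
      P.coeff mon ∈ Set.range (algebraMap (RatFunc K) M) := fun mon => by
    rw [hP]
    exact coeff_prod_mem_range ⟨_, rfl⟩ hfinF mon
  refine ⟨hcoeff, fun Phat qden hPhat hprim => ?_⟩
  obtain ⟨P₀, hP₀⟩ : ∃ P₀, map (algebraMap (RatFunc K) M) P₀ = P :=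
    (mem_range_map_iff_coeffs_subset).2 fun c hc => by
      obtain ⟨mon, -, rfl⟩ := mem_coeffs_iff.1 hc
      exact hcoeff mon
  obtain ⟨B, γ, hγ, hrel⟩ := exists_eliminant_deformedSystem _ hs hsn hhdeg
    (fun i => (hgdeg i).le) hh'x hh'mu hg'xle hg'mu hfinF
  have hmap : ∀ p : MvPolynomial (Option (Fin n)) (Polynomial K),
      map (algebraMap (RatFunc K) M) (map (algebraMap (Polynomial K) (RatFunc K)) p) =
        map ((algebraMap (RatFunc K) M).comp (algebraMap (Polynomial K) (RatFunc K))) p :=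
    fun p => map_map _ _ p
  have hq0 : qden ≠ 0 := by
    rintro rfl
    have h0 : Phat = 0 := by
      have hinj : Function.Injective
          ((algebraMap (RatFunc K) M).comp (algebraMap (Polynomial K) (RatFunc K))) := by
        rw [RingHom.coe_comp]
        exact (algebraMap (RatFunc K) M).injective.comp (RatFunc.algebraMap_injective K)
      refine map_injective _ hinj ?_
      rw [map_zero]
      simpa using hPhat
    simpa using hprim Polynomial.X (h0 ▸ dvd_zero _)
  have hdvd₀ : P₀ ∣ map (algebraMap (Polynomial K) (RatFunc K)) (relationPolynomial γ) := by
    refine dvd_of_forall_eval_eq_zero (M := M) hfinF.toFinset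
      (fun S => ∑ j, X j * C (S.1 j)) (fun S hS S' hS' hSS => ?_)
      ((map_ne_zero_iff _ (map_injective _ (RatFunc.algebraMap_injective K))).2
        (relationPolynomial_ne_zero hγ)) ?_ fun S hS => ?_
    · refine SolsF_fst_injOn hh'mu hg'mu hfinF (hfinF.mem_toFinset.1 hS)
        (hfinF.mem_toFinset.1 hS') (funext fun j => ?_)
      have := congrArg (coeff (Finsupp.single j 1)) hSS
      simpa [coeff_sum, mul_comm (X _), coeff_C_mul, coeff_X, Finsupp.single_left_inj] using this
    · rw [hP₀, hP, map_prod]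
      refine Finset.prod_congr rfl fun S _ => ?_
      simp [mul_comm]
    · rw [hmap, optionEquivLeft_map_relationPolynomial, Polynomial.eval_finsetSum]
      rw [← hrel S (hfinF.mem_toFinset.1 hS)]
      refine Finset.sum_congr rfl fun k _ => ?_
      have hC : ((algebraMap (RatFunc K) M).comp (algebraMap (Polynomial K) (RatFunc K))).comp
          Polynomial.C = algebraMap K M := by
        ext c
        rw [IsScalarTower.algebraMap_apply K (RatFunc K) M]
        simp
      rw [hC, Polynomial.eval_mul, Polynomial.eval_C, Polynomial.eval_pow, Polynomial.eval_X,
        RingHom.comp_apply, RatFunc.algebraMap_X, mul_assoc]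
  have hdvd : Phat ∣ relationPolynomial γ := by
    refine dvd_of_map_dvd_map (k := RatFunc K) (fun π hπ hdvd => ?_) ?_
    · exact hπ.not_isUnit (Polynomial.isUnit_iff_degree_eq_zero.2
        (by rw [Polynomial.degree_eq_natDegree hπ.ne_zero, hprim π hdvd]; rfl))
    · have hPhat₀ : map (algebraMap (Polynomial K) (RatFunc K)) Phat =
          C (algebraMap (Polynomial K) (RatFunc K) qden) * P₀ := by
        refine map_injective _ (algebraMap (RatFunc K) M).injective ?_
        rw [hmap, hPhat, map_mul, map_C, hP₀]
      have hunit : IsUnit (C (algebraMap (Polynomial K) (RatFunc K) qden) :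
          MvPolynomial (Option (Fin n)) (RatFunc K)) :=
        (IsUnit.mk0 _ (RatFunc.algebraMap_ne_zero hq0)).map C
      rw [hPhat₀, hunit.mul_left_dvd]
      exact hdvd₀
  intro mon
  rw [hD]
  exact (natDegree_coeff_le_of_dvd hdvd (relationPolynomial_ne_zero hγ)
    (natDegree_coeff_relationPolynomial_le γ) mon).trans (eliminantDegree_le d d' hd hd')
end
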